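/- Let ℓ be an odd prime, r ≥ 1, and let F be a finite field with ℓ^r elements. Then H_d(O_{n,n}(F); F_ℓ) = 0 for all d with 0 < d < n, where F_ℓ is the ℓ-element field with trivial action. -/

import Mathlib

/-! # Group homology via the inhomogeneous bar complex (trivial coefficients) -/

namespace GroupHomologyBar

variable (G : Type) [Group G] (A : Type) [AddCommGroup A]

/-- Inhomogeneous `n`-chains of `G` with coefficients in `A`. -/
abbrev chains (n : ℕ) : Type := (Fin n → G) →₀ A

/-- The differential of the inhomogeneous bar complex with trivial `G`-action on the
coefficients, sending `[g₁|…|g_{n+1}] ⊗ a` to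
`[g₂|…|g_{n+1}] ⊗ a + ∑ⱼ (-1)^{j+1} [g₁|…|gⱼg_{j+1}|…|g_{n+1}] ⊗ a`
(the last summand of the sum being `(-1)^{n+1} [g₁|…|g_n] ⊗ a`). -/
noncomputable def d (n : ℕ) : chains G A (n + 1) →ₗ[ℤ] chains G A n :=
  Finsupp.lsum ℤ fun g =>
    (Finsupp.lsingle (Fin.tail g) : A →ₗ[ℤ] chains G A n)
      + ∑ j : Fin (n + 1),
          ((-1 : ℤ) ^ ((j : ℕ) + 1)) • Finsupp.lsingle (Fin.contractNth j (· * ·) g)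

/-- The `n`-cycles. -/
noncomputable def cycles : (n : ℕ) → Submodule ℤ (chains G A n)
  | 0 => ⊤
  | (n + 1) => LinearMap.ker (d G A n)

/-- The `n`-boundaries, viewed as a submodule of the `n`-cycles. -/
noncomputable def boundaries (n : ℕ) : Submodule ℤ (cycles G A n) :=
  Submodule.comap (cycles G A n).subtype (LinearMap.range (d G A n))

/-- The group homology `H_n(G; A)` of `G` with trivial coefficients in `A`. -/
abbrev Homology (n : ℕ) : Type := cycles G A n ⧸ boundaries G A n

variable {G}
variable {G' : Type} [Group G']

/-- The map on chains induced by a group homomorphism. -/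
noncomputable def chainsMap (φ : G →* G') (n : ℕ) : chains G A n →ₗ[ℤ] chains G' A n :=
  Finsupp.lmapDomain A ℤ fun v => φ ∘ v

lemma chainsMap_single (φ : G →* G') {n : ℕ} (v : Fin n → G) (a : A) :
    chainsMap A φ n (Finsupp.single v a) = Finsupp.single (φ ∘ v) a := by
  simp [chainsMap, Finsupp.mapDomain_single]

lemma d_single {n : ℕ} (g : Fin (n + 1) → G) (a : A) :
    d G A n (Finsupp.single g a)
      = Finsupp.single (Fin.tail g) a
        + ∑ j : Fin (n + 1),
            ((-1 : ℤ) ^ ((j : ℕ) + 1)) • Finsupp.single (Fin.contractNth j (· * ·) g) a := by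
  simp [d, Finsupp.lsum_single]

lemma d_chainsMap (φ : G →* G') (n : ℕ) :
    (d G' A n).comp (chainsMap A φ (n + 1)) = (chainsMap A φ n).comp (d G A n) := by
  apply Finsupp.lhom_ext
  intro g a
  have hc : ∀ j : Fin (n + 1),
      φ ∘ Fin.contractNth j (· * ·) g = Fin.contractNth j (· * ·) (φ ∘ g) := by
    intro j
    funext k
    simp only [Function.comp_apply, Fin.contractNth]
    split_ifs <;> simp
  simp only [LinearMap.comp_apply, chainsMap_single, d_single, map_add, map_sum, map_smul,
    chainsMap_single, Fin.comp_tail, hc]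

lemma chainsMap_mem_cycles (φ : G →* G') (n : ℕ) :
    ∀ x ∈ cycles G A n, chainsMap A φ n x ∈ cycles G' A n := by
  intro x hx
  cases n with
  | zero => trivial
  | succ n =>
    simp only [cycles, LinearMap.mem_ker] at hx ⊢
    have := congrArg (fun L : chains G A (n + 1) →ₗ[ℤ] chains G' A n => L x) (d_chainsMap A φ n)
    simp only [LinearMap.comp_apply] at this
    rw [this, hx, map_zero]

/-- The map on cycles induced by a group homomorphism. -/
noncomputable def cyclesMap (φ : G →* G') (n : ℕ) : cycles G A n →ₗ[ℤ] cycles G' A n :=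
  (chainsMap A φ n).restrict (chainsMap_mem_cycles A φ n)

/-- The map `H_n(G; A) → H_n(G'; A)` on group homology induced by a group
homomorphism `φ : G →* G'`. -/
noncomputable def inducedMap (φ : G →* G') (n : ℕ) :
    Homology G A n →ₗ[ℤ] Homology G' A n :=
  Submodule.mapQ _ _ (cyclesMap A φ n) (by
    rintro ⟨x, hx⟩ hmem
    simp only [boundaries, Submodule.mem_comap, Submodule.subtype_apply,
      LinearMap.mem_range] at hmem ⊢
    obtain ⟨y, hy⟩ := hmem
    refine ⟨chainsMap A φ (n + 1) y, ?_⟩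
    have := congrArg (fun L : chains G A (n + 1) →ₗ[ℤ] chains G' A n => L y) (d_chainsMap A φ n)
    simp only [LinearMap.comp_apply] at this
    rw [this, hy]
    rfl)

end GroupHomologyBar

section Isometries

variable (F : Type) [Field F] {W : Type} [AddCommGroup W] [Module F W]

/-- The group of linear automorphisms of a vector space `V` preserving a
function `Q : V → F` (e.g. a quadratic form). -/
def quadIsoms {V : Type} [AddCommGroup V] [Module F V] (Q : V → F) :
    Subgroup (V ≃ₗ[F] V) where
  carrier := {g | ∀ v, Q (g v) = Q v}
  one_mem' := fun _ => rfl
  mul_mem' := fun {a b} ha hb v => by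
    rw [show (a * b) v = a (b v) from rfl, ha, hb]
  inv_mem' := fun {a} ha v => by
    rw [show (a⁻¹ : V ≃ₗ[F] V) v = a.symm v from rfl, ← ha (a.symm v), a.apply_symm_apply]

/-- The group of linear automorphisms of a vector space `V` preserving a
pairing `ω : V → V → F` (e.g. a bilinear or sesquilinear form). -/
def bilinIsoms {V : Type} [AddCommGroup V] [Module F V] (ω : V → V → F) :
    Subgroup (V ≃ₗ[F] V) where
  carrier := {g | ∀ v w, ω (g v) (g w) = ω v w}
  one_mem' := fun _ _ => rfl
  mul_mem' := fun {a b} ha hb v w => by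
    rw [show (a * b) v = a (b v) from rfl, show (a * b) w = a (b w) from rfl, ha, hb]
  inv_mem' := fun {a} ha v w => by
    rw [show (a⁻¹ : V ≃ₗ[F] V) v = a.symm v from rfl,
      show (a⁻¹ : V ≃ₗ[F] V) w = a.symm w from rfl,
      ← ha (a.symm v) (a.symm w), a.apply_symm_apply, a.apply_symm_apply]

/-- The "orthogonal sum" form `x ↦ ∑ i, q (x i)` on `W^n`. -/
def sumForm (q : W → F) (n : ℕ) (x : Fin n → W) : F := ∑ i, q (x i)

/-- The "orthogonal sum" pairing `(x, y) ↦ ∑ i, β (x i) (y i)` on `W^n`. -/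
def pairForm (β : W → W → F) (n : ℕ) (x y : Fin n → W) : F := ∑ i, β (x i) (y i)

/-- The linear equivalence `W^{n+1} ≃ W^n × W` splitting off the last coordinate. -/
def lastSplit (n : ℕ) : (Fin (n + 1) → W) ≃ₗ[F] (Fin n → W) × W where
  toLinearMap := (LinearMap.funLeft F W Fin.castSucc).prod (LinearMap.proj (Fin.last n))
  invFun p := Fin.snoc p.1 p.2
  left_inv x := Fin.snoc_init_self x
  right_inv p := by
    refine Prod.ext (funext fun i => ?_) ?_
    · exact @Fin.snoc_castSucc n (fun _ => W) p.2 p.1 i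
    · exact @Fin.snoc_last n (fun _ => W) p.2 p.1

lemma lastSplit_symm_apply (n : ℕ) (p : Fin n → W) (w : W) :
    (lastSplit F n).symm (p, w) = Fin.snoc p w := rfl

/-- Extension of an automorphism of `W^n` to `W^{n+1}` by the identity on the
added last coordinate. -/
def stabAut (n : ℕ) (g : (Fin n → W) ≃ₗ[F] (Fin n → W)) :
    (Fin (n + 1) → W) ≃ₗ[F] (Fin (n + 1) → W) :=
  (lastSplit F n).trans ((g.prodCongr (LinearEquiv.refl F W)).trans (lastSplit F n).symm)

lemma stabAut_symm_apply (n : ℕ) (g : (Fin n → W) ≃ₗ[F] (Fin n → W))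
    (p : Fin n → W) (w : W) :
    stabAut F n g ((lastSplit F n).symm (p, w)) = (lastSplit F n).symm (g p, w) := by
  simp [stabAut, LinearEquiv.trans_apply, LinearEquiv.apply_symm_apply, LinearEquiv.prodCongr_apply]

lemma sumForm_snoc (q : W → F) (n : ℕ) (p : Fin n → W) (w : W) :
    sumForm F q (n + 1) ((lastSplit F n).symm (p, w)) = sumForm F q n p + q w := by
  simp [sumForm, lastSplit_symm_apply, Fin.sum_univ_castSucc, Fin.snoc_castSucc, Fin.snoc_last]

lemma pairForm_snoc (β : W → W → F) (n : ℕ) (p p' : Fin n → W) (w w' : W) :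
    pairForm F β (n + 1) ((lastSplit F n).symm (p, w)) ((lastSplit F n).symm (p', w'))
      = pairForm F β n p p' + β w w' := by
  simp [pairForm, lastSplit_symm_apply, Fin.sum_univ_castSucc, Fin.snoc_castSucc, Fin.snoc_last]

/-- The stabilization homomorphism on the isometry group of the form `sumForm q n`,
extending an isometry by the identity on the added summand. -/
def quadStab (q : W → F) (n : ℕ) :
    quadIsoms F (sumForm F q n) →* quadIsoms F (sumForm F q (n + 1)) where
  toFun g := ⟨stabAut F n g.1, by
    intro v
    obtain ⟨⟨p, w⟩, rfl⟩ : ∃ x, (lastSplit F n).symm x = v :=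
      ⟨lastSplit F n v, (lastSplit F n).symm_apply_apply v⟩
    rw [stabAut_symm_apply, sumForm_snoc, sumForm_snoc, g.2 p]⟩
  map_one' := by
    refine Subtype.ext (LinearEquiv.ext fun v => ?_)
    show stabAut F n 1 v = v
    obtain ⟨⟨p, w⟩, rfl⟩ : ∃ x, (lastSplit F n).symm x = v :=
      ⟨lastSplit F n v, (lastSplit F n).symm_apply_apply v⟩
    rw [stabAut_symm_apply]
    rfl
  map_mul' g h := by
    refine Subtype.ext (LinearEquiv.ext fun v => ?_)
    show stabAut F n (g.1 * h.1) v = stabAut F n g.1 (stabAut F n h.1 v)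
    obtain ⟨⟨p, w⟩, rfl⟩ : ∃ x, (lastSplit F n).symm x = v :=
      ⟨lastSplit F n v, (lastSplit F n).symm_apply_apply v⟩
    rw [stabAut_symm_apply, stabAut_symm_apply, stabAut_symm_apply]
    rfl

/-- The stabilization homomorphism on the isometry group of the pairing `pairForm β n`,
extending an isometry by the identity on the added summand. -/
def bilinStab (β : W → W → F) (n : ℕ) :
    bilinIsoms F (pairForm F β n) →* bilinIsoms F (pairForm F β (n + 1)) where
  toFun g := ⟨stabAut F n g.1, by
    intro v v'
    obtain ⟨⟨p, w⟩, rfl⟩ : ∃ x, (lastSplit F n).symm x = v :=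
      ⟨lastSplit F n v, (lastSplit F n).symm_apply_apply v⟩
    obtain ⟨⟨p', w'⟩, rfl⟩ : ∃ x, (lastSplit F n).symm x = v' :=
      ⟨lastSplit F n v', (lastSplit F n).symm_apply_apply v'⟩
    rw [stabAut_symm_apply, stabAut_symm_apply, pairForm_snoc, pairForm_snoc, g.2 p p']⟩
  map_one' := by
    refine Subtype.ext (LinearEquiv.ext fun v => ?_)
    show stabAut F n 1 v = v
    obtain ⟨⟨p, w⟩, rfl⟩ : ∃ x, (lastSplit F n).symm x = v :=
      ⟨lastSplit F n v, (lastSplit F n).symm_apply_apply v⟩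
    rw [stabAut_symm_apply]
    rfl
  map_mul' g h := by
    refine Subtype.ext (LinearEquiv.ext fun v => ?_)
    show stabAut F n (g.1 * h.1) v = stabAut F n g.1 (stabAut F n h.1 v)
    obtain ⟨⟨p, w⟩, rfl⟩ : ∃ x, (lastSplit F n).symm x = v :=
      ⟨lastSplit F n v, (lastSplit F n).symm_apply_apply v⟩
    rw [stabAut_symm_apply, stabAut_symm_apply, stabAut_symm_apply]
    rfl

end Isometries

/-- The hyperbolic quadratic form on the hyperbolic plane `F² = F × F`. -/
def hypPlaneQuad (F : Type) [Field F] (s : F × F) : F := s.1 * s.2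


/-! ### Alternating sums over lists -/

namespace OV

section eps
variable {A A' M N : Type*} [AddCommGroup M] [AddCommGroup N]

/-- alternating sum of `f` over the lists obtained by deleting one entry. -/
def eps : List A → (List A → M) → M
  | [], _ => 0
  | (a :: l), f => f l - eps l (fun l' => f (a :: l'))

@[simp] lemma eps_nil (f : List A → M) : eps [] f = 0 := rfl
lemma eps_cons (a : A) (l : List A) (f : List A → M) :
    eps (a :: l) f = f l - eps l (fun l' => f (a :: l')) := rfl

lemma eps_congr (l : List A) : ∀ {f g : List A → M},
    (∀ l', l'.Sublist l → l'.length + 1 = l.length → f l' = g l') → eps l f = eps l g := by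
  induction l with
  | nil => intros; rfl
  | cons a l ih =>
    intro f g h
    rw [eps_cons, eps_cons, h l (List.sublist_cons_self a l) (by simp)]
    congr 1
    exact ih (fun l' hl' hlen => h _ (hl'.cons_cons a) (by simp [hlen]))

lemma eps_hom (φ : M →+ N) (l : List A) : ∀ (f : List A → M),
    eps l (fun l' => φ (f l')) = φ (eps l f) := by
  induction l with
  | nil => intro f; simp
  | cons a l ih => intro f; simp [eps_cons, ih]

lemma eps_add (l : List A) : ∀ (f g : List A → M),
    eps l (fun l' => f l' + g l') = eps l f + eps l g := by
  induction l with
  | nil => intro f g; simp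
  | cons a l ih => intro f g; simp only [eps_cons, ih]; abel

lemma eps_neg (l : List A) (f : List A → M) :
    eps l (fun l' => - f l') = - eps l f := eps_hom (negAddMonoidHom) l f

lemma eps_sub (l : List A) (f g : List A → M) :
    eps l (fun l' => f l' - g l') = eps l f - eps l g := by
  simp only [sub_eq_add_neg, eps_add, eps_neg]

lemma eps_zero (l : List A) : eps l (fun _ => (0 : M)) = 0 := by
  have := eps_hom (0 : M →+ M) l (fun _ => 0)
  simpa using this

lemma eps_zero' (l : List A) {f : List A → M}
    (h : ∀ l', l'.Sublist l → l'.length + 1 = l.length → f l' = 0) : eps l f = 0 := by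
  rw [eps_congr l h, eps_zero]

lemma eps_smul {k : Type*} [Semiring k] [Module k M] (c : k) (l : List A) (f : List A → M) :
    eps l (fun l' => c • f l') = c • eps l f := by
  have := eps_hom (DistribSMul.toAddMonoidHom M c) l f
  simpa using this

lemma eps_apply {ι : Type*} {M : ι → Type*} [∀ i, AddCommGroup (M i)] (l : List A) (f : List A → ∀ i, M i) (i : ι) :
    eps l f i = eps l (fun l' => f l' i) := by
  have := eps_hom (Pi.evalAddMonoidHom M i) l f
  simpa using this.symm

lemma eps_eps (l : List A) : ∀ (f : List A → M), eps l (fun l' => eps l' f) = 0 := by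
  induction l with
  | nil => intro f; simp
  | cons a l ih =>
    intro f
    simp only [eps_cons, eps_sub, ih]
    abel

lemma eps_map (θ : A → A') (l : List A) : ∀ (f : List A' → M),
    eps (l.map θ) f = eps l (fun l' => f (l'.map θ)) := by
  induction l with
  | nil => intro f; simp
  | cons a l ih => intro f; simp [eps_cons, ih]

lemma eps_comm (l : List A) : ∀ (m : List A') (f : List A → List A' → M),
    eps l (fun l' => eps m (fun m' => f l' m')) = eps m (fun m' => eps l (fun l' => f l' m')) := by
  induction l with
  | nil => intro m f; simp [eps_zero]
  | cons a l ih => intro m f; simp only [eps_cons, ih, eps_sub]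

lemma eps_append (l r : List A) : ∀ (f : List A → M),
    eps (l ++ r) f = eps l (fun l' => f (l' ++ r)) + (-1 : ℤ) ^ l.length • eps r (fun r' => f (l ++ r')) := by
  induction l with
  | nil => intro f; simp
  | cons a l ih =>
    intro f
    simp only [List.cons_append, eps_cons, ih, List.length_cons, pow_succ]
    simp
    abel

/-- prism operator. -/
def Pr (θ : A → A) : (List A → M) → List A → M
  | _, [] => 0
  | f, (y :: l) => f (y :: θ y :: l.map θ) - Pr θ (fun l' => f (y :: l')) l

@[simp] lemma Pr_nil (θ : A → A) (f : List A → M) : Pr θ f [] = 0 := rfl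
lemma Pr_cons (θ : A → A) (f : List A → M) (y : A) (l : List A) :
  Pr θ f (y :: l) = f (y :: θ y :: l.map θ) - Pr θ (fun l' => f (y :: l')) l := rfl

lemma Pr_sub (θ : A → A) (l : List A) : ∀ (f g : List A → M),
    Pr θ (fun l' => f l' - g l') l = Pr θ f l - Pr θ g l := by
  induction l with
  | nil => intro f g; simp
  | cons a l ih => intro f g; simp only [Pr_cons, ih]; abel

lemma Pr_congr (θ : A → A) (l : List A) : ∀ (f g : List A → M),
    (∀ l', l'.length = l.length + 1 → f l' = g l') → Pr θ f l = Pr θ g l := by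
  induction l with
  | nil => intro f g _; simp
  | cons a l ih =>
    intro f g h
    rw [Pr_cons, Pr_cons, h _ (by simp)]
    congr 1
    exact ih _ _ (fun l' hl' => h _ (by simp [hl']))

lemma Pr_zero (θ : A → A) (l : List A) : Pr θ (fun _ => (0 : M)) l = 0 := by
  have := Pr_sub θ l (fun _ => (0:M)) (fun _ => 0)
  simpa using this

lemma Pr_equiv (θ : A → A) (γ : A → A) (h : ∀ y, θ (γ y) = γ (θ y)) (l : List A) : ∀ (f : List A → M),
    Pr θ f (l.map γ) = Pr θ (fun l' => f (l'.map γ)) l := by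
  induction l with
  | nil => intro f; simp
  | cons a l ih =>
    intro f
    have h2 : θ ∘ γ = γ ∘ θ := funext h
    simp only [List.map_cons, Pr_cons, ih]
    simp [h, h2]

lemma prism (θ : A → A) (l : List A) : ∀ (f : List A → M),
    eps l (Pr θ f) + Pr θ (fun l' => eps l' f) l = f (l.map θ) - f l + (if l = [] then 0 else 0) := by
  induction l with
  | nil => intro f; simp
  | cons a l ih =>
    intro f
    have h2 := ih (fun l' => f (a :: l'))
    simp only [eps_cons, Pr_cons, eps_sub, Pr_sub, eps_map, List.map_cons] at h2 ⊢
    simp only [ite_self, add_zero] at h2 ⊢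
    have h3 : eps l (fun l' => Pr θ (fun l'' => f (a :: l'')) l') =  f (a :: l.map θ) - f (a :: l)
      - Pr θ (fun l' => eps l' (fun l'' => f (a :: l''))) l := by rw [← h2]; abel
    rw [h3]
    abel

lemma prism' (θ : A → A) (l : List A) (f : List A → M) :
    eps l (Pr θ f) + Pr θ (fun l' => eps l' f) l = f (l.map θ) - f l := by
  have := prism θ l f
  simpa using this

end eps

section choice
variable {Γ A B : Type*} [Group Γ] [MulAction Γ A] [MulAction Γ B]

lemma equivariant_choice (H : Subgroup Γ) (P : A → B → Prop)
    (hP : ∀ g ∈ H, ∀ a b, P a b → P (g • a) (g • b))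
    (hex : ∀ a, ∃ b, P a b ∧ ∀ g ∈ H, g • a = a → g • b = b) :
    ∃ φ : A → B, (∀ a, P a (φ a)) ∧ ∀ g ∈ H, ∀ a, φ (g • a) = g • φ a := by
  classical
  choose b hb1 hb2 using hex
  let rep : A → A := fun a => Quotient.out (s := MulAction.orbitRel H A) (Quotient.mk (MulAction.orbitRel H A) a)
  have hrep : ∀ a, ∃ g : H, g • rep a = a := by
    intro a
    have : (MulAction.orbitRel H A).r (rep a) a := Quotient.mk_out (s := MulAction.orbitRel H A) a
    have := (MulAction.orbitRel H A).symm this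
    exact this
  have hrep2 : ∀ g ∈ H, ∀ a, rep (g • a) = rep a := by
    intro g hg a
    have : (Quotient.mk (MulAction.orbitRel H A) (g • a)) = (Quotient.mk (MulAction.orbitRel H A) a) :=
      Quotient.sound ⟨⟨g, hg⟩, rfl⟩
    simp only [rep, this]
  choose s hs using hrep
  refine ⟨fun a => (s a : Γ) • b (rep a), fun a => ?_, fun g hg a => ?_⟩
  · have := hP (s a) (s a).2 _ _ (hb1 (rep a))
    have h2 : (s a : Γ) • rep a = a := hs a
    rwa [h2] at this
  · have h1 : (s (g • a) : Γ) • rep (g • a) = g • a := hs (g • a)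
    have h2 : (s a : Γ) • rep a = a := hs a
    have h3 : ((s a : Γ)⁻¹ * g⁻¹ * (s (g • a) : Γ)) • rep a = rep a := by
      rw [mul_smul, mul_smul, ← hrep2 g hg a, h1, inv_smul_smul, hrep2 g hg a]
      rw [inv_smul_eq_iff, h2]
    have h4 := hb2 (rep a) _ (H.mul_mem (H.mul_mem (H.inv_mem (s a).2) (H.inv_mem hg)) (s (g•a)).2) h3
    show (s (g • a) : Γ) • b (rep (g • a)) = g • (s a : Γ) • b (rep a)
    rw [hrep2 g hg a]
    rw [mul_smul, mul_smul, inv_smul_eq_iff, inv_smul_eq_iff] at h4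
    exact h4

end choice
end OV

namespace OV

section listact
variable {Γ A : Type*} [Group Γ] [MulAction Γ A]

instance listAction : MulAction Γ (List A) where
  smul g l := l.map (fun a => g • a)
  one_smul l := by
    show l.map (fun a => (1 : Γ) • a) = l
    simp
  mul_smul g h l := by
    show l.map (fun a => (g * h) • a) = (l.map (fun a => h • a)).map (fun a => g • a)
    simp [mul_smul]

lemma smul_list_def (g : Γ) (l : List A) : g • l = l.map (fun a => g • a) := rfl
@[simp] lemma smul_list_nil (g : Γ) : g • ([] : List A) = [] := rfl
@[simp] lemma smul_list_cons (g : Γ) (a : A) (l : List A) : g • (a :: l) = (g • a) :: (g • l) := rfl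
@[simp] lemma smul_list_length (g : Γ) (l : List A) : (g • l).length = l.length := by
  simp [smul_list_def]
@[simp] lemma smul_list_append (g : Γ) (l m : List A) : g • (l ++ m) = g • l ++ g • m := by
  simp [smul_list_def]
lemma mem_smul_list (g : Γ) (l : List A) (a : A) : a ∈ g • l ↔ ∃ b ∈ l, g • b = a := by
  simp [smul_list_def]
lemma smul_list_eq_self (g : Γ) (l : List A) : g • l = l ↔ ∀ a ∈ l, g • a = a := by
  induction l with
  | nil => simp
  | cons a l ih => simp [ih]
lemma eps_smul_list {M : Type*} [AddCommGroup M] (g : Γ) (l : List A) (f : List A → M) :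
    eps (g • l) f = eps l (fun l' => f (g • l')) := eps_map _ l f

instance optionAction : MulAction Γ (Option A) where
  one_smul l := by cases l <;> simp
  mul_smul g h l := by cases l <;> simp [mul_smul]
@[simp] lemma smul_opt_none (g : Γ) : g • (none : Option A) = none := rfl
@[simp] lemma smul_opt_some (g : Γ) (a : A) : g • (some a) = some (g • a) := rfl
lemma smul_opt_eq_none (g : Γ) (t : Option A) : g • t = none ↔ t = none := by
  cases t <;> simp
end listact

section R
variable {Γ Y T k : Type*} [Group Γ] [MulAction Γ Y] [MulAction Γ T] [Field k]

open Classical in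
/-- differential of the relative cochain complex. -/
noncomputable def D (X : Set T) (f : List Y → Option T → k) : List Y → Option T → k := fun l t =>
  match t with
  | none => eps l (fun l' => f l' none)
  | some x => if x ∈ X then f l none - eps l (fun l' => f l' (some x)) else 0

lemma D_none (X : Set T) (f : List Y → Option T → k) (l : List Y) :
   D X f l none = eps l (fun l' => f l' none) := rfl
lemma D_some {X : Set T} (f : List Y → Option T → k) (l : List Y) {x : T} (hx : x ∈ X) :
   D X f l (some x) = f l none - eps l (fun l' => f l' (some x)) := by simp [D, hx]
lemma D_some_not {X : Set T} (f : List Y → Option T → k) (l : List Y) {x : T} (hx : x ∉ X) :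
   D X f l (some x) = 0 := by simp [D, hx]

lemma D_add (X : Set T) (f g : List Y → Option T → k) : D X (f + g) = D X f + D X g := by
  funext l t
  rcases t with _ | x
  · simp [D, eps_add]
  · by_cases hx : x ∈ X
    · simp [D, hx, eps_add]; ring
    · simp [D, hx]
lemma D_smul (X : Set T) (c : k) (f : List Y → Option T → k) : D X (c • f) = c • D X f := by
  funext l t
  have := fun t => eps_smul c l (fun l' => f l' t)
  simp only [smul_eq_mul] at this
  rcases t with _ | x
  · simp [D, this]
  · by_cases hx : x ∈ X
    · simp [D, hx, this]; ring
    · simp [D, hx]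
/-- `D` as a linear map. -/
noncomputable def Dl (X : Set T) : (List Y → Option T → k) →ₗ[k] (List Y → Option T → k) where
  toFun := D X
  map_add' := D_add X
  map_smul' := D_smul X
lemma D_sub (X : Set T) (f g : List Y → Option T → k) : D X (f - g) = D X f - D X g :=
  map_sub (Dl X) f g
lemma D_zero (X : Set T) : D X (0 : List Y → Option T → k) = 0 := map_zero (Dl X)
lemma D_neg (X : Set T) (f : List Y → Option T → k) : D X (-f) = - D X f := map_neg (Dl X) f
lemma D_D (X : Set T) (f : List Y → Option T → k) : D X (D X f) = 0 := by
  funext l t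
  rcases t with _ | x
  · simp [D, eps_eps]
  · by_cases hx : x ∈ X
    · simp [D, hx, eps_eps, eps_sub]
    · simp [D, hx]

/-- relative cochains of degree `q`. -/
structure IsR (H : Subgroup Γ) (X : Set T) (q : ℕ) (f : List Y → Option T → k) : Prop where
  inv : ∀ h ∈ H, ∀ l t, f (h • l) (h • t) = f l t
  nil : ∀ t, f [] t = 0
  supp : ∀ l t, f l t ≠ 0 → (∀ x, t = some x → x ∈ X) ∧ l.length = q + (if t.isNone then 1 else 0)

variable {H : Subgroup Γ} {X : Set T} {q : ℕ}

lemma IsR.add {f g : List Y → Option T → k} (hf : IsR H X q f) (hg : IsR H X q g) :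
    IsR H X q (f + g) where
  inv h hh l t := by simp [hf.inv h hh, hg.inv h hh]
  nil t := by simp [hf.nil, hg.nil]
  supp l t h := by
    by_cases h1 : f l t = 0
    · exact hg.supp l t (by intro h2; simp [h1, h2] at h)
    · exact hf.supp l t h1
lemma IsR.smul (c : k) {f : List Y → Option T → k} (hf : IsR H X q f) : IsR H X q (c • f) where
  inv h hh l t := by simp [hf.inv h hh]
  nil t := by simp [hf.nil]
  supp l t h := hf.supp l t (by intro h2; simp [h2] at h)
lemma IsR.neg {f : List Y → Option T → k} (hf : IsR H X q f) : IsR H X q (-f) := by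
  simpa using hf.smul (-1)
lemma IsR.sub {f g : List Y → Option T → k} (hf : IsR H X q f) (hg : IsR H X q g) :
    IsR H X q (f - g) := by
  rw [sub_eq_add_neg]; exact hf.add hg.neg
lemma IsR.zero : IsR H X q (0 : List Y → Option T → k) where
  inv h hh l t := by simp
  nil t := by simp
  supp l t h := by simp at h

lemma eps_ne_zero {A M : Type*} [AddCommGroup M] {l : List A} {f : List A → M} (h : eps l f ≠ 0) :
    ∃ l', l'.Sublist l ∧ l'.length + 1 = l.length ∧ f l' ≠ 0 := by
  by_contra hc
  push Not at hc
  exact h (eps_zero' l hc)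

lemma D_supp {f : List Y → Option T → k}
    (hf : ∀ l t, f l t ≠ 0 → (∀ x, t = some x → x ∈ X) ∧ l.length = q + (if t.isNone then 1 else 0))
    (l : List Y) (t : Option T) (h : D X f l t ≠ 0) :
    (∀ x, t = some x → x ∈ X) ∧ l.length = (q + 1) + (if t.isNone then 1 else 0) := by
  rcases t with _ | x
  · obtain ⟨l', h1, h2, h3⟩ := eps_ne_zero (D_none X f l ▸ h)
    have := (hf _ _ h3).2
    simp at this ⊢; omega
  · by_cases hx : x ∈ X
    · rw [D_some f l hx] at h
      refine ⟨fun y hy => by simp at hy; rwa [← hy], ?_⟩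
      by_cases h1 : f l none = 0
      · rw [h1, zero_sub, neg_ne_zero] at h
        obtain ⟨l', h1, h2, h3⟩ := eps_ne_zero h
        have := (hf _ _ h3).2
        simp at this ⊢; omega
      · have := (hf _ _ h1).2
        simp at this ⊢; omega
    · exact absurd (D_some_not f l hx) h

lemma D_smul_inv {f f' : List Y → Option T → k} (h : Γ) {X X' : Set T} (hX : ∀ x, x ∈ X ↔ h • x ∈ X')
   (hinv : ∀ l t, f' (h • l) (h • t) = f l t) (l : List Y) (t : Option T) :
   D X' f' (h • l) (h • t) = D X f l t := by
  rcases t with _ | x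
  · have := fun l => hinv l none
    simp only [smul_opt_none] at this
    simp only [smul_opt_none, D_none, eps_smul_list, this]
  · have h1 := fun l => hinv l none
    simp only [smul_opt_none] at h1
    have h2 := fun l => hinv l (some x)
    simp only [smul_opt_some] at h2
    by_cases hx : x ∈ X
    · simp only [smul_opt_some, D_some _ _ hx, D_some _ _ ((hX x).1 hx), eps_smul_list, h1, h2]
    · rw [smul_opt_some, D_some_not _ _ hx, D_some_not _ _ (fun h => hx ((hX x).2 h))]

lemma setinv_iff (hX : ∀ h ∈ H, ∀ x ∈ X, h • x ∈ X) {h : Γ} (hh : h ∈ H) (x : T) :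
    x ∈ X ↔ h • x ∈ X :=
  ⟨hX h hh x, fun h1 => by simpa using hX h⁻¹ (H.inv_mem hh) _ h1⟩

lemma IsR.D (hX : ∀ h ∈ H, ∀ x ∈ X, h • x ∈ X) {f : List Y → Option T → k} (hf : IsR H X q f) :
    IsR H X (q + 1) (D X f) where
  inv h hh l t := D_smul_inv h (setinv_iff hX hh) (hf.inv h hh) l t
  nil t := by
    rcases t with _ | x
    · simp [OV.D]
    · simp [OV.D, hf.nil]
  supp := D_supp hf.supp

/-- being a coboundary. -/
def Cob (H : Subgroup Γ) (X : Set T) : ℕ → (List Y → Option T → k) → Prop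
  | 0, f => f = 0
  | (q + 1), f => ∃ g, IsR H X q g ∧ D X g = f

lemma Cob.zero : Cob H X q (0 : List Y → Option T → k) := by
  cases q with
  | zero => rfl
  | succ q => exact ⟨0, IsR.zero, D_zero X⟩
lemma Cob.add {f g : List Y → Option T → k} (hf : Cob H X q f) (hg : Cob H X q g) :
    Cob H X q (f + g) := by
  cases q with
  | zero => simp only [Cob] at *; simp [hf, hg]
  | succ q =>
    obtain ⟨a, ha, rfl⟩ := hf
    obtain ⟨b, hb, rfl⟩ := hg
    exact ⟨a + b, ha.add hb, D_add X a b⟩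
lemma Cob.smul (c : k) {f : List Y → Option T → k} (hf : Cob H X q f) : Cob H X q (c • f) := by
  cases q with
  | zero => simp only [Cob] at *; simp [hf]
  | succ q =>
    obtain ⟨a, ha, rfl⟩ := hf
    exact ⟨c • a, ha.smul c, D_smul X c a⟩

/-- the space of coboundaries. -/
def CobS (H : Subgroup Γ) (X : Set T) (q : ℕ) : Submodule k (List Y → Option T → k) where
  carrier := {f | Cob H X q f}
  add_mem' := Cob.add
  zero_mem' := Cob.zero
  smul_mem' c _ hf := hf.smul c
lemma mem_CobS {f : List Y → Option T → k} : f ∈ CobS H X q ↔ Cob H X q f := Iff.rfl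
lemma Cob.neg {f : List Y → Option T → k} (hf : Cob H X q f) :
    Cob H X q (-f) := by
  simpa using hf.smul (-1)
lemma Cob.sub {f g : List Y → Option T → k} (hf : Cob H X q f) (hg : Cob H X q g) :
    Cob H X q (f - g) := by
  rw [sub_eq_add_neg]; exact hf.add hg.neg

open Classical in
/-- restriction of the relative part. -/
noncomputable def cut (X : Set T) : (List Y → Option T → k) →ₗ[k] (List Y → Option T → k) where
  toFun f := fun l t => if (∀ x, t = some x → x ∈ X) then f l t else 0
  map_add' f g := by
    funext l t
    simp only [Pi.add_apply]
    split_ifs <;> simp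
  map_smul' c f := by
    funext l t
    simp only [Pi.smul_apply, RingHom.id_apply]
    split_ifs <;> simp
@[simp] lemma cut_none (X : Set T) (f : List Y → Option T → k) (l : List Y) :
    cut X f l none = f l none := by simp [cut]
lemma cut_some {X : Set T} (f : List Y → Option T → k) (l : List Y) {x : T} (hx : x ∈ X) :
    cut X f l (some x) = f l (some x) := by simp [cut, hx]
lemma cut_some_not {X : Set T} (f : List Y → Option T → k) (l : List Y) {x : T} (hx : x ∉ X) :
    cut X f l (some x) = 0 := by simp [cut, hx]

variable {H' : Subgroup Γ} {X' : Set T}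
lemma cut_D (hX : X' ⊆ X) (f : List Y → Option T → k) : D X' (cut X' f) = cut X' (D X f) := by
  funext l t
  rcases t with _ | x
  · simp [D_none]
  · by_cases hx : x ∈ X'
    · rw [D_some _ _ hx, cut_some _ _ hx, D_some _ _ (hX hx)]
      simp [cut_some _ _ hx]
    · rw [D_some_not _ _ hx, cut_some_not _ _ hx]
lemma D_cut (X : Set T) (f : List Y → Option T → k) : D X (cut X f) = D X f := by
  funext l t
  rcases t with _ | x
  · simp [D_none]
  · by_cases hx : x ∈ X
    · rw [D_some _ _ hx, D_some _ _ hx]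
      simp [cut_some _ _ hx]
    · rw [D_some_not _ _ hx, D_some_not _ _ hx]
lemma IsR.cut (hH : H' ≤ H) (hX' : ∀ h ∈ H', ∀ x ∈ X', h • x ∈ X')
    {f : List Y → Option T → k} (hf : IsR H X q f) : IsR H' X' q (cut X' f) where
  inv h hh l t := by
    rcases t with _ | x
    · simpa using hf.inv h (hH hh) l none
    · by_cases hx : x ∈ X'
      · rw [smul_opt_some, cut_some _ _ hx, cut_some _ _ (hX' h hh x hx)]
        exact hf.inv h (hH hh) l (some x)
      · rw [smul_opt_some, cut_some_not _ _ hx, cut_some_not]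
        rwa [← setinv_iff hX' hh]
  nil t := by simp [OV.cut, hf.nil]
  supp l t h := by
    by_cases h1 : ∀ x, t = some x → x ∈ X'
    · refine ⟨h1, ?_⟩
      simp only [OV.cut, LinearMap.coe_mk, AddHom.coe_mk, if_pos h1] at h
      exact (hf.supp l t h).2
    · simp only [OV.cut, LinearMap.coe_mk, AddHom.coe_mk, if_neg h1] at h
      exact absurd rfl h
lemma IsR.cut_self {f : List Y → Option T → k} (hf : IsR H X q f) : OV.cut X f = f := by
  funext l t
  by_cases h : f l t = 0
  · simp [OV.cut, h]
  · simp only [OV.cut, LinearMap.coe_mk, AddHom.coe_mk, if_pos (hf.supp l t h).1]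
lemma cut_cut (hX : X' ⊆ X) (f : List Y → Option T → k) : cut X' (cut X f) = cut X' f := by
  funext l t
  rcases t with _ | x
  · simp
  · by_cases hx : x ∈ X'
    · rw [cut_some _ _ hx, cut_some _ _ hx, cut_some _ _ (hX hx)]
    · rw [cut_some_not _ _ hx, cut_some_not _ _ hx]
lemma Cob.cut (hH : H' ≤ H) (hXX : X' ⊆ X) (hX' : ∀ h ∈ H', ∀ x ∈ X', h • x ∈ X')
    {f : List Y → Option T → k} (hf : Cob H X q f) : Cob H' X' q (cut X' f) := by
  cases q with
  | zero => simp only [Cob] at *; simp [hf]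
  | succ q =>
    obtain ⟨a, ha, rfl⟩ := hf
    exact ⟨OV.cut X' a, ha.cut hH hX', cut_D hXX a⟩
end R
end OV

set_option linter.unusedSectionVars false
namespace OV
section K
variable {Γ Y T A k : Type*} [Group Γ] [MulAction Γ Y] [MulAction Γ T] [MulAction Γ A] [Field k]

/-- admissibility data for the double complex. -/
structure OkData (H : Subgroup Γ) (ok : List A → Option T → Prop) : Prop where
  none_of_some : ∀ σ x, ok σ (some x) → ok σ none
  sub : ∀ σ σ' t, σ'.Sublist σ → ok σ t → ok σ' t
  equi : ∀ h ∈ H, ∀ σ t, ok σ t → ok (h • σ) (h • t)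

/-- admissible set at a simplex. -/
def Xs (ok : List A → Option T → Prop) (σ : List A) : Set T := {x | ok σ (some x)}

/-- pointwise stabilizer. -/
def stabL (H : Subgroup Γ) (σ : List A) : Subgroup Γ := H ⊓ MulAction.stabilizer Γ σ
lemma mem_stabL {H : Subgroup Γ} {σ : List A} {g : Γ} : g ∈ stabL H σ ↔ g ∈ H ∧ g • σ = σ := by
  simp [stabL, MulAction.mem_stabilizer_iff]

/-- bigraded cochains. -/
structure IsK (H : Subgroup Γ) (ok : List A → Option T → Prop) (q p : ℕ)
    (c : List A → List Y → Option T → k) : Prop where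
  inv : ∀ h ∈ H, ∀ σ l t, c (h • σ) (h • l) (h • t) = c σ l t
  nil : ∀ σ t, c σ [] t = 0
  supp : ∀ σ l t, c σ l t ≠ 0 → ok σ t ∧ σ.length = p ∧ l.length = q + (if t.isNone then 1 else 0)

variable {H : Subgroup Γ} {ok : List A → Option T → Prop} {q p : ℕ}

/-- vertical differential. -/
noncomputable def dK (ok : List A → Option T → Prop) (c : List A → List Y → Option T → k) :
    List A → List Y → Option T → k := fun σ => D (Xs ok σ) (c σ)

open Classical in
/-- horizontal differential. -/
noncomputable def eK (ok : List A → Option T → Prop) (c : List A → List Y → Option T → k) :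
    List A → List Y → Option T → k := fun σ l t => if ok σ t then eps σ (fun σ' => c σ' l t) else 0

lemma IsK.sub {c c' : List A → List Y → Option T → k} (hc : IsK H ok q p c) (hc' : IsK H ok q p c') :
    IsK H ok q p (c - c') where
  inv h hh σ l t := by simp [hc.inv h hh, hc'.inv h hh]
  nil σ t := by simp [hc.nil, hc'.nil]
  supp σ l t h := by
    by_cases h1 : c σ l t = 0
    · exact hc'.supp σ l t (by intro h2; simp [h1, h2] at h)
    · exact hc.supp σ l t h1
lemma IsK.zero : IsK H ok q p (0 : List A → List Y → Option T → k) where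
  inv h hh σ l t := by simp
  nil σ t := by simp
  supp σ l t h := by simp at h

lemma dK_sub (c c' : List A → List Y → Option T → k) : dK ok (c - c') = dK ok c - dK ok c' := by
  funext σ; exact D_sub _ _ _
lemma dK_zero : dK ok (0 : List A → List Y → Option T → k) = 0 := by
  funext σ; exact D_zero _
lemma eK_sub (c c' : List A → List Y → Option T → k) : eK ok (c - c') = eK ok c - eK ok c' := by
  funext σ l t
  simp only [eK, Pi.sub_apply, eps_sub]
  split_ifs <;> simp
lemma eK_zero : eK ok (0 : List A → List Y → Option T → k) = 0 := by
  have := eK_sub (ok := ok) (0 : List A → List Y → Option T → k) 0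
  simpa using this
lemma dK_dK (c : List A → List Y → Option T → k) : dK ok (dK ok c) = 0 := by
  funext σ; exact D_D _ _
lemma eK_pos (c : List A → List Y → Option T → k) {σ : List A} (l : List Y) {t : Option T}
    (h : ok σ t) : eK ok c σ l t = eps σ (fun σ' => c σ' l t) := by simp [eK, h]
lemma eK_neg (c : List A → List Y → Option T → k) {σ : List A} (l : List Y) {t : Option T}
    (h : ¬ ok σ t) : eK ok c σ l t = 0 := by simp [eK, h]

lemma eK_eK (hok : OkData H ok) (c : List A → List Y → Option T → k) : eK ok (eK ok c) = 0 := by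
  funext σ l t
  by_cases h : ok σ t
  · rw [eK_pos _ _ h, eps_congr σ (g := fun σ' => eps σ' (fun σ'' => c σ'' l t)), eps_eps]; · rfl
    intro σ' hs _
    rw [eK_pos _ _ (hok.sub _ _ _ hs h)]
  · rw [eK_neg _ _ h]; rfl

lemma dK_eK (hok : OkData H ok) (c : List A → List Y → Option T → k) :
    dK ok (eK ok c) = eK ok (dK ok c) := by
  funext σ l t
  rcases t with _ | x
  · by_cases h : ok σ none
    · simp only [dK, D_none, eK_pos _ _ h]
      rw [eps_comm]
    · simp only [dK, D_none, eK_neg _ _ h, eps_zero]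
  · by_cases h : ok σ (some x)
    · have h0 := hok.none_of_some _ _ h
      rw [eK_pos _ _ h, dK, D_some _ _ (show x ∈ Xs ok σ from h)]
      simp only [eK_pos _ _ h, eK_pos _ _ h0]
      rw [eps_comm, ← eps_sub]
      refine eps_congr σ fun σ' hs _ => ?_
      rw [dK, D_some _ _ (show x ∈ Xs ok σ' from hok.sub _ _ _ hs h)]
    · rw [eK_neg _ _ h, dK, D_some_not _ _ (show x ∉ Xs ok σ from h)]

lemma ok_iff (hok : OkData H ok) {h : Γ} (hh : h ∈ H) (σ : List A) (t : Option T) :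
    ok σ t ↔ ok (h • σ) (h • t) :=
  ⟨hok.equi h hh σ t, fun h1 => by simpa using hok.equi h⁻¹ (H.inv_mem hh) _ _ h1⟩

lemma IsK.eK (hok : OkData H ok) {c : List A → List Y → Option T → k} (hc : IsK H ok q p c) :
    IsK H ok q (p + 1) (eK ok c) where
  inv h hh σ l t := by
    by_cases h1 : ok σ t
    · rw [eK_pos _ _ h1, eK_pos _ _ ((ok_iff hok hh σ t).1 h1), eps_smul_list]
      simp only [hc.inv h hh]
    · rw [eK_neg _ _ h1, eK_neg _ _ (fun h2 => h1 ((ok_iff hok hh σ t).2 h2))]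
  nil σ t := by simp [OV.eK, hc.nil, eps_zero]
  supp σ l t h := by
    by_cases h1 : ok σ t
    · rw [eK_pos _ _ h1] at h
      obtain ⟨σ', h2, h3, h4⟩ := eps_ne_zero h
      obtain ⟨h5, h6, h7⟩ := hc.supp _ _ _ h4
      exact ⟨h1, by omega, h7⟩
    · exact absurd (eK_neg _ _ h1) h

lemma IsK.isR (_hok : OkData H ok) {c : List A → List Y → Option T → k} (hc : IsK H ok q p c) (σ : List A) :
    IsR (stabL H σ) (Xs ok σ) q (c σ) where
  inv h hh l t := by
    rw [mem_stabL] at hh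
    have := hc.inv h hh.1 σ l t
    rwa [hh.2] at this
  nil t := hc.nil σ t
  supp l t h := by
    obtain ⟨h1, h2, h3⟩ := hc.supp _ _ _ h
    exact ⟨fun x hx => by subst hx; exact h1, h3⟩

lemma IsK.dK (hok : OkData H ok) {c : List A → List Y → Option T → k} (hc : IsK H ok q p c) :
    IsK H ok (q + 1) p (dK ok c) where
  inv h hh σ l t := D_smul_inv h (fun x => by
      have := ok_iff hok hh σ (some x)
      exact this) (fun l t => hc.inv h hh σ l t) l t
  nil σ t := by
    rcases t with _ | x
    · simp [OV.dK, OV.D]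
    · simp [OV.dK, OV.D, hc.nil]
  supp σ l t h := by
    have h0 := D_supp (hc.isR hok σ).supp l t h
    have h1 : (ok σ none ∧ σ.length = p) := by
      by_contra hcon
      have : c σ = 0 := by
        funext l t
        by_contra hne
        obtain ⟨a1, a2, a3⟩ := hc.supp σ l t hne
        refine hcon ⟨?_, a2⟩
        rcases t with _ | x
        · exact a1
        · exact hok.none_of_some _ _ a1
      apply h
      simp only [OV.dK, this, D_zero, Pi.zero_apply]
    refine ⟨?_, h1.2, h0.2⟩
    rcases t with _ | x
    · exact h1.1
    · exact h0.1 x rfl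

/-- the translation action on cochains. -/
@[reducible] def funAct : MulAction Γ (List Y → Option T → k) where
  smul g f := fun l t => f (g⁻¹ • l) (g⁻¹ • t)
  one_smul f := by
    funext l t
    show f ((1 : Γ)⁻¹ • l) ((1 : Γ)⁻¹ • t) = f l t
    simp
  mul_smul g h f := by
    funext l t
    show f ((g * h)⁻¹ • l) ((g * h)⁻¹ • t) = f (h⁻¹ • g⁻¹ • l) (h⁻¹ • g⁻¹ • t)
    simp [mul_smul]

/-- families that are objectwise coboundaries are coboundaries. -/
lemma W2 (hok : OkData H ok) {c : List A → List Y → Option T → k} (hc : IsK H ok (q + 1) p c)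
    (h : ∀ σ, σ.length = p → ok σ none → Cob (stabL H σ) (Xs ok σ) (q + 1) (c σ)) :
    ∃ u, IsK H ok q p u ∧ dK ok u = c := by
  let _ : MulAction Γ (List Y → Option T → k) := funAct
  have key := equivariant_choice H (A := List A) (B := List Y → Option T → k)
    (fun σ b => D (Xs ok σ) b = c σ ∧ (∀ t, b [] t = 0) ∧
      ∀ l t, b l t ≠ 0 → ok σ t ∧ σ.length = p ∧ l.length = q + (if t.isNone then 1 else 0)) ?_ ?_
  · obtain ⟨φ, h1, h2⟩ := key
    refine ⟨φ, ⟨fun g hg σ l t => ?_, fun σ t => (h1 σ).2.1 t, fun σ l t => (h1 σ).2.2 l t⟩,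
      funext fun σ => (h1 σ).1⟩
    rw [h2 g hg]
    show φ σ (g⁻¹ • g • l) (g⁻¹ • g • t) = _
    simp
  · rintro g hg σ b ⟨h1, h2, h3⟩
    refine ⟨?_, fun t => ?_, fun l t hlt => ?_⟩
    · funext l t
      have h5 := D_smul_inv (f := b) (f' := g • b) (X := Xs ok σ) (X' := Xs ok (g • σ)) g
        (fun x => ok_iff hok hg σ (some x))
        (fun l t => by
          show b (g⁻¹ • g • l) (g⁻¹ • g • t) = b l t
          simp) (g⁻¹ • l) (g⁻¹ • t)
      rw [smul_inv_smul, smul_inv_smul] at h5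
      rw [h5, h1]
      have h6 := hc.inv g hg σ (g⁻¹ • l) (g⁻¹ • t)
      rw [smul_inv_smul, smul_inv_smul] at h6
      exact h6.symm
    · show b (g⁻¹ • []) (g⁻¹ • t) = 0
      simp [h2]
    · have h4 := h3 (g⁻¹ • l) (g⁻¹ • t) hlt
      obtain ⟨h5, h6, h7⟩ := h4
      have h8 := hok.equi g hg _ _ h5
      rw [smul_inv_smul] at h8
      refine ⟨h8, by simpa using h6, ?_⟩
      simp only [smul_list_length] at h7
      rw [h7]
      cases t <;> rfl
  · intro σ
    by_cases hσ : σ.length = p ∧ ok σ none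
    · obtain ⟨b, hb1, hb2⟩ := h σ hσ.1 hσ.2
      refine ⟨b, ⟨hb2, hb1.nil, fun l t hlt => ?_⟩, fun g hg hgσ => ?_⟩
      · obtain ⟨h1, h2⟩ := hb1.supp l t hlt
        refine ⟨?_, hσ.1, h2⟩
        rcases t with _ | x
        · exact hσ.2
        · exact h1 x rfl
      · funext l t
        exact hb1.inv g⁻¹ ((stabL H σ).inv_mem (mem_stabL.2 ⟨hg, hgσ⟩)) l t
    · refine ⟨0, ⟨?_, fun t => rfl, fun l t hlt => absurd rfl hlt⟩, fun g hg hgσ => rfl⟩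
      rw [D_zero]
      funext l t
      by_contra hne
      obtain ⟨h1, h2, h3⟩ := hc.supp σ l t (fun h0 => hne h0.symm)
      refine hσ ⟨h2, ?_⟩
      rcases t with _ | x
      · exact h1
      · exact hok.none_of_some _ _ h1

/-- row exactness. -/
structure RowEx (H : Subgroup Γ) (ok : List A → Option T → Prop) (Y k : Type*) [MulAction Γ Y] [Field k] :
    Prop where
  inj : ∀ q (c : List A → List Y → Option T → k), IsK H ok q 0 c → eK ok c = 0 → c = 0
  ex : ∀ q p (c : List A → List Y → Option T → k), IsK H ok q (p + 1) c → eK ok c = 0 →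
    ∃ c', IsK H ok q p c' ∧ eK ok c' = c

lemma zig_aux (hok : OkData H ok) (hrow : RowEx H ok Y k) (n : ℕ)
    (V0 : ∀ (c : List A → List Y → Option T → k), 2 ≤ n + 1 → IsK H ok 0 (n + 1) c → dK ok c = 0 → eK ok c = 0 →
      ∃ c', IsK H ok 0 n c' ∧ dK ok c' = 0 ∧ eK ok c' = c)
    (V1 : ∀ j P (c : List A → List Y → Option T → k), 2 ≤ P → j + 1 + P = n + 1 → IsK H ok (j + 1) P c →
      dK ok c = 0 → eK ok c = 0 → ∃ u, IsK H ok j P u ∧ dK ok u = c) :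
    ∀ q p (g : List A → List Y → Option T → k), 1 ≤ p → q + p = n → IsK H ok q p g → dK ok (eK ok g) = 0 →
      ∃ g', IsK H ok q p g' ∧ dK ok g' = dK ok g ∧ eK ok g' = 0 := by
  intro q
  induction q with
  | zero =>
    intro p g hp hn hg hdg
    obtain rfl : p = n := by omega
    obtain ⟨c', h1, h2, h3⟩ := V0 (eK ok g) (by omega) (hg.eK hok) hdg (eK_eK hok g)
    exact ⟨g - c', hg.sub h1, by rw [dK_sub, h2, sub_zero], by rw [eK_sub, h3, sub_self]⟩
  | succ q ih =>
    intro p g hp hn hg hdg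
    obtain ⟨u, hu, hdu⟩ := V1 q (p + 1) (eK ok g) (by omega) (by omega) (hg.eK hok) hdg (eK_eK hok g)
    obtain ⟨u', hu', hdu', heu'⟩ := ih (p + 1) u (by omega) (by omega) hu (by
      rw [dK_eK hok, hdu, eK_eK hok])
    obtain ⟨w, hw, hew⟩ := hrow.ex q p u' hu' heu'
    refine ⟨g - dK ok w, hg.sub (hw.dK hok), by rw [dK_sub, dK_dK, sub_zero], ?_⟩
    rw [eK_sub, ← dK_eK hok, hew, hdu', hdu, sub_self]

open Classical in
/-- The zigzag lemma. -/
lemma zigzag (hok : OkData H ok) (hnil : ok [] none) (hrow : RowEx H ok Y k) (n : ℕ)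
    (V0 : ∀ (c : List A → List Y → Option T → k), 2 ≤ n + 1 → IsK H ok 0 (n + 1) c → dK ok c = 0 → eK ok c = 0 →
      ∃ c', IsK H ok 0 n c' ∧ dK ok c' = 0 ∧ eK ok c' = c)
    (V1 : ∀ j P (c : List A → List Y → Option T → k), 2 ≤ P → j + 1 + P = n + 1 → IsK H ok (j + 1) P c →
      dK ok c = 0 → eK ok c = 0 → ∃ u, IsK H ok j P u ∧ dK ok u = c)
    (f : List Y → Option T → k) (hf : IsR H (Xs ok []) n f) (hdf : D (Xs ok []) f = 0)
    (hv : ∀ v, ok [v] none → Cob (stabL H [v]) (Xs ok [v]) n (cut (Xs ok [v]) f)) :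
    Cob H (Xs ok []) n f := by
  set c : List A → List Y → Option T → k := fun σ => if σ = [] then f else 0 with hcdef
  have hc : IsK H ok n 0 c := by
    refine ⟨fun h hh σ l t => ?_, fun σ t => ?_, fun σ l t hne => ?_⟩
    · rcases σ with _ | ⟨a, σ⟩
      · simp [c, hf.inv h hh]
      · simp [c]
    · rcases σ with _ | ⟨a, σ⟩
      · simp [c, hf.nil]
      · simp [c]
    · rcases σ with _ | ⟨a, σ⟩
      · simp only [c, if_true] at hne
        obtain ⟨h1, h2⟩ := hf.supp l t hne
        refine ⟨?_, rfl, h2⟩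
        rcases t with _ | x
        · exact hnil
        · exact h1 x rfl
      · simp [c] at hne
  have hdc : dK ok c = 0 := by
    funext σ
    rcases σ with _ | ⟨a, σ⟩
    · simp only [dK, c, if_true, hdf]; rfl
    · simp only [dK, c, reduceCtorEq, if_false, D_zero]; rfl
  have hec : ∀ v, ok [v] none → eK ok c [v] = cut (Xs ok [v]) f := by
    intro v hv
    funext l t
    rcases t with _ | x
    · rw [eK_pos _ _ hv]; simp [eps_cons, c]
    · by_cases hx : ok [v] (some x)
      · rw [eK_pos _ _ hx, cut_some _ _ (show x ∈ Xs ok [v] from hx)]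
        simp [eps_cons, c]
      · rw [eK_neg _ _ hx, cut_some_not _ _ (show x ∉ Xs ok [v] from hx)]
  rcases n with _ | n
  · have : eK ok c = 0 := by
      funext σ l t
      by_contra hne
      obtain ⟨h1, h2, h3⟩ := (hc.eK hok).supp σ l t hne
      obtain ⟨v, rfl⟩ := List.length_eq_one_iff.1 (by simpa using h2)
      have h0 : ok [v] none := by
        rcases t with _ | x
        · exact h1
        · exact hok.none_of_some _ _ h1
      apply hne
      rw [hec v h0]
      have := hv v h0
      simp only [Cob] at this
      rw [this]; rfl
    have := hrow.inj 0 c hc this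
    have := congrFun this []
    show f = 0
    simpa [c] using this
  · obtain ⟨u, hu, hdu⟩ := W2 hok (hc.eK hok) (fun σ hσ hok' => by
      obtain ⟨v, rfl⟩ := List.length_eq_one_iff.1 (by simpa using hσ)
      rw [hec v hok']
      exact hv v hok')
    obtain ⟨g', hg', hdg', heg'⟩ := zig_aux hok hrow (n + 1) V0 V1 n 1 u le_rfl rfl hu (by
      rw [dK_eK hok, hdu, eK_eK hok])
    obtain ⟨w, hw, hew⟩ := hrow.ex n 0 g' hg' heg'
    have h1 : c - dK ok w = 0 := by
      refine hrow.inj (n + 1) _ (hc.sub (hw.dK hok)) ?_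
      rw [eK_sub, ← dK_eK hok, hew, hdg', hdu, sub_self]
    refine ⟨w [], ?_, ?_⟩
    · have := hw.isR hok []
      refine ⟨fun h hh l t => hw.inv h hh [] l t, this.nil, this.supp⟩
    · have := congrFun (sub_eq_zero.1 h1) []
      simp only [c, if_true] at this
      rw [this]; rfl

end K
end OV

namespace OV
section L
variable {Γ Y T A k : Type*} [Group Γ] [MulAction Γ Y] [MulAction Γ T] [MulAction Γ A] [Field k]

/-- relative prism operator. -/
def PrR (θ : Y → Y) (f : List Y → Option T → k) : List Y → Option T → k := fun l t =>
  match t with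
  | none => Pr θ (fun l' => f l' none) l
  | some x => - Pr θ (fun l' => f l' (some x)) l

lemma PrR_D {X : Set T} (θ : Y → Y) (f : List Y → Option T → k) (hX : ∀ l x, x ∉ X → f l (some x) = 0)
    (hD : D X f = 0) : D X (PrR θ f) = fun l t => f (l.map θ) t - f l t := by
  funext l t
  rcases t with _ | x
  · have h1 : ∀ l, eps l (fun l' => f l' none) = 0 := fun l => congrFun (congrFun hD l) none
    have := prism' θ l (fun l' => f l' none)
    simp only [h1, Pr_zero, add_zero] at this
    exact this
  · by_cases hx : x ∈ X
    · rw [D_some _ _ hx]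
      have h1 : ∀ l, eps l (fun l' => f l' (some x)) = f l none := fun l => by
        have := congrFun (congrFun hD l) (some x)
        rw [D_some _ _ hx, Pi.zero_apply, Pi.zero_apply, sub_eq_zero] at this
        exact this.symm
      have := prism' θ l (fun l' => f l' (some x))
      simp only [h1] at this
      simp only [PrR, eps_neg]
      rw [← this]; ring
    · rw [D_some_not _ _ hx, hX _ _ hx, hX _ _ hx, sub_zero]

lemma PrR_zero_of {q : ℕ} {θ : Y → Y} {f : List Y → Option T → k}
    (hf : ∀ l t, f l t ≠ 0 → l.length = q + (if t.isNone then 1 else 0)) (l : List Y) (t : Option T)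
    (h : PrR θ f l t ≠ 0) : l.length + 1 = q + (if t.isNone then 1 else 0) ∧ l ≠ [] := by
  refine ⟨?_, ?_⟩
  · by_contra hl
    apply h
    rcases t with _ | x
    · show Pr θ (fun l' => f l' none) l = 0
      rw [Pr_congr θ l _ (fun _ => 0), Pr_zero]
      intro l' hl'
      by_contra hne
      exact hl (by rw [← hf _ _ hne, hl'])
    · show - Pr θ (fun l' => f l' (some x)) l = 0
      rw [Pr_congr θ l _ (fun _ => 0), Pr_zero, neg_zero]
      intro l' hl'
      by_contra hne
      exact hl (by rw [← hf _ _ hne, hl'])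
  · rintro rfl
    apply h
    rcases t with _ | x <;> simp [PrR]

lemma prism_cob {H : Subgroup Γ} {X : Set T} {q : ℕ} {θ : Y → Y} (hθ : ∀ h ∈ H, ∀ y, θ (h • y) = h • θ y)
    {f : List Y → Option T → k} (hf : IsR H X q f) (hD : D X f = 0) :
    Cob H X q (fun l t => f (l.map θ) t - f l t) := by
  have hX : ∀ l x, x ∉ X → f l (some x) = 0 := fun l x hx => by
    by_contra hne
    exact hx ((hf.supp l (some x) hne).1 x rfl)
  have h1 := PrR_D θ f hX hD
  have hz := PrR_zero_of (θ := θ) (fun l t h => (hf.supp l t h).2)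
  cases q with
  | zero =>
    show _ = _
    rw [← h1]
    have : PrR θ f = 0 := by
      funext l t
      by_contra hne
      have := hz l t hne
      have h2 : l.length ≠ 0 := by simpa using this.2
      rcases t with _ | x
      · simp at this
      · simp at this
    rw [this, D_zero]
  | succ q =>
    refine ⟨PrR θ f, ⟨fun h hh l t => ?_, fun t => ?_, fun l t hne => ?_⟩, h1⟩
    · have h3 : ∀ t, Pr θ (fun l' => f l' (h • t)) (h • l) = Pr θ (fun l' => f l' t) l := by
        intro t
        rw [smul_list_def, Pr_equiv θ (fun a => h • a) (hθ h hh)]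
        congr 1
        funext l'
        exact hf.inv h hh l' t
      rcases t with _ | x
      · exact h3 none
      · exact congrArg Neg.neg (h3 (some x))
    · rcases t with _ | x <;> simp [PrR]
    · refine ⟨?_, ?_⟩
      · rintro x rfl
        by_contra hx
        apply hne
        show - Pr θ (fun l' => f l' (some x)) l = 0
        simp only [hX _ x hx, Pr_zero, neg_zero]
      · have := (hz l t hne).1
        omega

open Classical in
lemma coneEx {H : Subgroup Γ} {ok : List A → Option T → Prop} (hok : OkData H ok)
    (hnil : ok [] none)
    (hfree : ∀ (g : Γ) (y : Y), g • y = y → g = 1)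
    (hv : ∀ t, ok [] t → ∃ v, ∀ σ, ok σ t → ok (v :: σ) t) : RowEx H ok Y k := by
  have key := equivariant_choice H (A := Y × Option T) (B := A)
    (fun a v => ∀ σ, ok σ a.2 → ok (v :: σ) a.2) ?_ ?_
  · obtain ⟨ν, h1, h2⟩ := key
    constructor
    · intro q c hc he
      funext σ l t
      by_contra hne
      obtain ⟨a1, a2, a3⟩ := hc.supp _ _ _ hne
      obtain rfl : σ = [] := by simpa using a2
      rcases l with _ | ⟨y, l⟩
      · exact hne (hc.nil _ _)
      have h3 := congrFun (congrFun (congrFun he [ν (y, t)]) (y :: l)) t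
      rw [eK_pos _ _ (h1 (y, t) [] a1)] at h3
      apply hne
      simpa [eps_cons] using h3
    · intro q p c hc he
      let c' : List A → List Y → Option T → k := fun σ l t => match l with
        | [] => 0
        | (y :: l) => c (ν (y, t) :: σ) (y :: l) t
      refine ⟨c', ⟨fun h hh σ l t => ?_, fun σ t => rfl, fun σ l t hne => ?_⟩, ?_⟩
      · rcases l with _ | ⟨y, l⟩
        · rfl
        · show c (ν (h • y, h • t) :: h • σ) (h • (y :: l)) (h • t) = c (ν (y, t) :: σ) (y :: l) t
          rw [← hc.inv h hh (ν (y, t) :: σ), smul_list_cons h (ν (y, t)) σ, ← h2 h hh]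
          rfl
      · rcases l with _ | ⟨y, l⟩
        · exact absurd rfl hne
        · obtain ⟨a1, a2, a3⟩ := hc.supp _ _ _ hne
          exact ⟨hok.sub _ _ _ (List.sublist_cons_self _ _) a1, by simpa using a2, a3⟩
      · funext σ l t
        rcases l with _ | ⟨y, l⟩
        · rw [hc.nil]
          simp only [eK, c', eps_zero, ite_self]
        · by_cases hσ : ok σ t
          · rw [eK_pos _ _ hσ]
            have h3 := congrFun (congrFun (congrFun he (ν (y, t) :: σ)) (y :: l)) t
            rw [eK_pos _ _ (h1 (y, t) σ hσ), eps_cons] at h3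
            exact (sub_eq_zero.1 h3).symm
          · rw [eK_neg _ _ hσ]
            by_contra hne
            exact hσ (hc.supp _ _ _ (fun h => hne h.symm)).1
  · rintro g hg ⟨y, t⟩ v hP σ hσ
    have h3 := hok.equi g⁻¹ (H.inv_mem hg) σ _ hσ
    have h4 := hok.equi g hg _ _ (hP (g⁻¹ • σ) (by simpa using h3))
    simpa using h4
  · rintro ⟨y, t⟩
    have triv : ∀ v : A, ∀ g ∈ H, g • (y, t) = (y, t) → g • v = v := by
      intro v g hg h
      have : g • y = y := (Prod.ext_iff.1 h).1
      rw [hfree g y this, one_smul]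
    by_cases ht : ok [] t
    · obtain ⟨v, hv⟩ := hv t ht
      exact ⟨v, hv, triv v⟩
    · obtain ⟨v, _⟩ := hv none hnil
      exact ⟨v, fun σ hσ => absurd (hok.sub _ _ _ (List.nil_sublist σ) hσ) ht, triv v⟩

end L
end OV

namespace OV
open Submodule
section C
variable {F V : Type*} [Field F] [AddCommGroup V] [Module F V]

/-- the polar form -/
def bl (Q : QuadraticForm F V) : V →ₗ[F] V →ₗ[F] F := Q.polarBilin

variable {Q : QuadraticForm F V}
lemma Q_add (x y : V) : Q (x + y) = Q x + Q y + bl Q x y := by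
  simp [bl, QuadraticMap.polar]
lemma bl_comm (x y : V) : bl Q x y = bl Q y x := by
  simp [bl, QuadraticMap.polar_comm]
lemma bl_self (x : V) : bl Q x x = 2 * Q x := by
  simp [bl]
lemma Q_smul (a : F) (x : V) : Q (a • x) = a * a * Q x := by
  simp [QuadraticMap.map_smul]
lemma Q_neg (x : V) : Q (-x) = Q x := by simp
lemma Q_sub (x y : V) : Q (x - y) = Q x + Q y - bl Q x y := by
  rw [sub_eq_add_neg, Q_add, Q_neg, map_neg]; ring
lemma Q_zero : Q (0 : V) = 0 := by simp

variable (Q) in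
/-- orthogonal complement -/
def perp (Z : Submodule F V) : Submodule F V where
  carrier := {v | ∀ z ∈ Z, bl Q v z = 0}
  add_mem' ha hb z hz := by simp [ha z hz, hb z hz]
  zero_mem' z _ := by simp
  smul_mem' c v hv z hz := by simp [hv z hz]
lemma mem_perp {Z : Submodule F V} {v : V} : v ∈ perp Q Z ↔ ∀ z ∈ Z, bl Q v z = 0 := Iff.rfl
lemma perp_anti {Z Z' : Submodule F V} (h : Z ≤ Z') : perp Q Z' ≤ perp Q Z :=
  fun _ hv z hz => hv z (h hz)
lemma le_perp_perp (Z : Submodule F V) : Z ≤ perp Q (perp Q Z) := fun z hz w hw => by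
  rw [bl_comm]; exact hw z hz
lemma mem_perp_sup_span {Z : Submodule F V} {S : Set V} {v : V} :
    v ∈ perp Q (Z ⊔ span F S) ↔ v ∈ perp Q Z ∧ ∀ s ∈ S, bl Q v s = 0 := by
  constructor
  · intro h
    exact ⟨fun z hz => h z (mem_sup_left hz), fun s hs => h s (mem_sup_right (subset_span hs))⟩
  · rintro ⟨h1, h2⟩ z hz
    have : Z ⊔ span F S ≤ LinearMap.ker (bl Q v) := by
      refine sup_le (fun z hz => h1 z hz) (span_le.2 fun s hs => h2 s hs)
    exact this hz

lemma mem_sup_single (Z : Submodule F V) (v : V) : v ∈ Z ⊔ span F {v} :=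
  mem_sup_right (mem_span_singleton_self v)

variable (Q) in
/-- hyperbolic pairs orthogonal to `Z` -/
def HP (Z : Submodule F V) (x : V × V) : Prop :=
  Q x.1 = 0 ∧ Q x.2 = 0 ∧ bl Q x.1 x.2 = 1 ∧ x.1 ∈ perp Q Z ∧ x.2 ∈ perp Q Z

/-- the set of the two entries -/
def prs (x : V × V) : Set V := {x.1, x.2}

variable (Q) in
/-- there are `n` orthogonal hyperbolic planes orthogonal to `Z`. -/
def Hyp : Submodule F V → ℕ → Prop
  | _, 0 => True
  | Z, (n + 1) => ∃ x, HP Q Z x ∧ Hyp (Z ⊔ span F (prs x)) n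

lemma HP.mono {Z Z' : Submodule F V} (h : Z ≤ Z') {x : V × V} (hx : HP Q Z' x) : HP Q Z x :=
  ⟨hx.1, hx.2.1, hx.2.2.1, perp_anti h hx.2.2.2.1, perp_anti h hx.2.2.2.2⟩

lemma Hyp.mono {n : ℕ} : ∀ {Z Z' : Submodule F V}, Z ≤ Z' → Hyp Q Z' n → Hyp Q Z n := by
  induction n with
  | zero => intros; trivial
  | succ n ih =>
    rintro Z Z' h ⟨x, hx, h2⟩
    exact ⟨x, hx.mono h, ih (sup_le_sup_right h _) h2⟩

lemma HP.mem_left {Z : Submodule F V} {x : V × V} (_ : HP Q Z x) : x.1 ∈ Z ⊔ span F (prs x) :=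
  mem_sup_right (subset_span (by simp [prs]))
lemma HP.mem_right {Z : Submodule F V} {x : V × V} (_ : HP Q Z x) : x.2 ∈ Z ⊔ span F (prs x) :=
  mem_sup_right (subset_span (by simp [prs]))

lemma Hyp.L2 {n : ℕ} : ∀ {Z : Submodule F V} {p v : V}, p ∈ Z → p ∈ perp Q Z → Q p = 0 → bl Q v p ≠ 0 →
    Hyp Q Z n → Hyp Q (Z ⊔ span F {v}) n := by
  induction n with
  | zero => intros; trivial
  | succ n ih =>
    rintro Z p v hpZ hpp hQp hvp ⟨⟨e, f⟩, ⟨h1, h2, h3, h4, h5⟩, h6⟩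
    simp only at h1 h2 h3 h4 h5
    have hep : bl Q e p = 0 := h4 p hpZ
    have hfp : bl Q f p = 0 := h5 p hpZ
    have hpv : bl Q p v ≠ 0 := by rwa [bl_comm]
    set a := - bl Q e v / bl Q p v with ha
    set b := - bl Q f v / bl Q p v with hb
    refine ⟨(e + a • p, f + b • p), ⟨?_, ?_, ?_, ?_, ?_⟩, ?_⟩
    · simp [Q_add, h1, Q_smul, hQp, hep]
    · simp [Q_add, h2, Q_smul, hQp, hfp]
    · simp [h3, hep, bl_comm p f, hfp, bl_self, hQp]
    · rw [mem_perp_sup_span]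
      refine ⟨add_mem h4 ((perp Q Z).smul_mem _ hpp), ?_⟩
      rintro s rfl
      simp [ha]
      field_simp
      ring
    · rw [mem_perp_sup_span]
      refine ⟨add_mem h5 ((perp Q Z).smul_mem _ hpp), ?_⟩
      rintro s rfl
      simp [hb]
      field_simp
      ring
    · have h7 := ih (Z := Z ⊔ span F (prs (e, f))) (p := p) (v := v) (mem_sup_left hpZ)
        (by
          rw [mem_perp_sup_span]
          refine ⟨hpp, ?_⟩
          rintro s (rfl | rfl)
          · rw [bl_comm]; exact hep
          · rw [bl_comm]; exact hfp) hQp hvp h6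
      refine h7.mono ?_
      refine sup_le (sup_le (le_sup_of_le_left le_sup_left) le_sup_right) ?_
      rw [span_le]
      have hp' : p ∈ Z ⊔ span F (prs (e, f)) ⊔ span F {v} := mem_sup_left (mem_sup_left hpZ)
      rintro s (rfl | rfl)
      · exact add_mem (mem_sup_left (mem_sup_right (subset_span (by simp [prs])))) (smul_mem _ _ hp')
      · exact add_mem (mem_sup_left (mem_sup_right (subset_span (by simp [prs])))) (smul_mem _ _ hp')

lemma Hyp.L1 {g : ℕ} : ∀ {Z : Submodule F V} (v : V), Hyp Q Z (g + 1) → Hyp Q (Z ⊔ span F {v}) g := by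
  induction g with
  | zero => intros; trivial
  | succ g ih =>
    rintro Z v ⟨x, hx, h2⟩
    have key : ∀ p, (p = x.1 ∨ p = x.2) → bl Q v p ≠ 0 → Hyp Q (Z ⊔ span F {v}) (g + 1) := by
      intro p hp hvp
      have hpp : p ∈ prs x := by simpa [prs] using hp
      have h3 : Hyp Q (Z ⊔ span F {p}) (g + 1) := h2.mono
        (sup_le_sup_left (span_mono (by simpa using hpp)) _)
      have hQ : Q p = 0 := by rcases hp with rfl | rfl; exacts [hx.1, hx.2.1]
      have hpZ : p ∈ perp Q Z := by rcases hp with rfl | rfl; exacts [hx.2.2.2.1, hx.2.2.2.2]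
      have h4 := h3.L2 (p := p) (v := v) (mem_sup_single _ _) (by
        rw [mem_perp_sup_span]
        refine ⟨hpZ, ?_⟩
        rintro s rfl
        rw [bl_self, hQ, mul_zero]) hQ hvp
      exact h4.mono (sup_le_sup_right le_sup_left _)
    by_cases h3 : bl Q v x.1 = 0
    · by_cases h4 : bl Q v x.2 = 0
      · refine ⟨x, ⟨hx.1, hx.2.1, hx.2.2.1, ?_, ?_⟩, ?_⟩
        · rw [mem_perp_sup_span]
          refine ⟨hx.2.2.2.1, ?_⟩
          rintro s rfl
          rw [bl_comm]; exact h3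
        · rw [mem_perp_sup_span]
          refine ⟨hx.2.2.2.2, ?_⟩
          rintro s rfl
          rw [bl_comm]; exact h4
        · rw [sup_right_comm]
          exact ih v h2
      · exact key _ (Or.inr rfl) h4
    · exact key _ (Or.inl rfl) h3

lemma Hyp.pred {g : ℕ} {Z : Submodule F V} (h : Hyp Q Z (g + 1)) : Hyp Q Z g := by
  have := h.L1 0
  simpa using this
lemma Hyp.le {g g' : ℕ} (hg : g ≤ g') {Z : Submodule F V} (h : Hyp Q Z g') : Hyp Q Z g := by
  induction hg with
  | refl => exact h
  | step _ ih => exact ih h.pred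

lemma Hyp.L3 {g : ℕ} {Z : Submodule F V} {x : V × V} (hx : HP Q Z x) (h : Hyp Q Z (g + 1)) :
    Hyp Q (Z ⊔ span F (prs x)) g := by
  have h1 := h.L1 x.1
  have h2 := h1.L2 (p := x.1) (v := x.2) (mem_sup_single _ _) (by
        rw [mem_perp_sup_span]
        refine ⟨hx.2.2.2.1, ?_⟩
        rintro s rfl
        rw [bl_self, hx.1, mul_zero]) hx.1 (by rw [bl_comm, hx.2.2.1]; exact one_ne_zero)
  refine h2.mono ?_
  rw [sup_assoc, ← span_union]
  exact sup_le_sup_left (span_mono (by intro s; simp [prs, or_comm])) _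

lemma finrank_sup_HP [FiniteDimensional F V] {Z : Submodule F V} {x : V × V} (hx : HP Q Z x) :
    Module.finrank F Z + 2 ≤ Module.finrank F ↥(Z ⊔ span F (prs x)) := by
  have h1 : Z < Z ⊔ span F {x.1} := by
    refine lt_of_le_of_ne le_sup_left fun h => ?_
    have : x.1 ∈ Z := by rw [h]; exact mem_sup_single _ _
    have := hx.2.2.2.2 _ this
    rw [bl_comm, hx.2.2.1] at this
    exact one_ne_zero this
  have h2 : Z ⊔ span F {x.1} < Z ⊔ span F (prs x) := by
    refine lt_of_le_of_ne (sup_le_sup_left (span_mono (by simp [prs])) _) fun h => ?_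
    have h3 : x.2 ∈ Z ⊔ span F {x.1} := by rw [h]; exact hx.mem_right
    have h4 : x.1 ∈ perp Q (Z ⊔ span F {x.1}) := by
      rw [mem_perp_sup_span]
      refine ⟨hx.2.2.2.1, ?_⟩
      rintro s rfl
      rw [bl_self, hx.1, mul_zero]
    have := h4 _ h3
    rw [hx.2.2.1] at this
    exact one_ne_zero this
  have := finrank_lt_finrank_of_lt h1
  have := finrank_lt_finrank_of_lt h2
  omega

lemma Hyp.drop [FiniteDimensional F V] {n m : ℕ} : ∀ {T T' : Submodule F V}, T ≤ T' →
    Module.finrank F T' ≤ Module.finrank F T + m → Hyp Q T (n + m) → Hyp Q T' n := by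
  induction m with
  | zero =>
    intro T T' h1 h2 h3
    rwa [← eq_of_le_of_finrank_le h1 h2]
  | succ m ih =>
    intro T T' h1 h2 h3
    by_cases h : T' ≤ T
    · rw [le_antisymm h h1]
      exact h3.le (by omega)
    · obtain ⟨v, hv, hvT⟩ := Set.not_subset.1 h
      have h4 : T < T ⊔ span F {v} := by
        refine lt_of_le_of_ne le_sup_left fun h => hvT ?_
        show v ∈ T
        rw [h]; exact mem_sup_single _ _
      have := finrank_lt_finrank_of_lt h4
      refine ih (T := T ⊔ span F {v}) (sup_le h1 ?_) (by omega) (Hyp.L1 v h3)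
      rw [span_le]; simpa using hv

lemma Hyp.strict [FiniteDimensional F V] {n m : ℕ} {T T' : Submodule F V} (h1 : T ≤ T')
    {x : V × V} (hx : HP Q T x) (hx1 : x.1 ∈ T') (hx2 : x.2 ∈ T')
    (h2 : Module.finrank F T' ≤ Module.finrank F T + (m + 1)) (h3 : Hyp Q T (n + m)) : Hyp Q T' n := by
  have hle : T ⊔ span F (prs x) ≤ T' := by
    refine sup_le h1 (span_le.2 ?_)
    rintro s (rfl | rfl)
    exacts [hx1, hx2]
  have h4 := finrank_sup_HP hx
  have h5 := finrank_mono hle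
  obtain ⟨m, rfl⟩ : ∃ m', m = m' + 1 := ⟨m - 1, by omega⟩
  exact (Hyp.L3 hx h3).drop hle (by omega)

/-- nondegenerate subspaces -/
def Nd (Q : QuadraticForm F V) (Z : Submodule F V) : Prop := Z ⊓ perp Q Z = ⊥

lemma Nd.rep {Z : Submodule F V} [FiniteDimensional F Z] (h : Nd Q Z) (φ : V →ₗ[F] F) :
    ∃ z ∈ Z, ∀ w ∈ Z, bl Q z w = φ w := by
  let β : Z →ₗ[F] (Module.Dual F Z) := (LinearMap.lcomp F F Z.subtype).comp ((bl Q).comp Z.subtype)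
  have hβ : ∀ a b : Z, β a b = bl Q a b := fun a b => rfl
  have hinj : Function.Injective β := by
    rw [← LinearMap.ker_eq_bot, eq_bot_iff]
    intro a ha
    have : (a : V) ∈ Z ⊓ perp Q Z := ⟨a.2, fun z hz => by
      have := congrArg (fun f : Module.Dual F Z => f ⟨z, hz⟩) (LinearMap.mem_ker.1 ha)
      simpa [hβ] using this⟩
    rw [h] at this
    simpa using this
  have hsurj : Function.Surjective β :=
    (LinearMap.injective_iff_surjective_of_finrank_eq_finrank (Subspace.dual_finrank_eq).symm).1 hinj
  obtain ⟨z, hz⟩ := hsurj (φ.comp Z.subtype)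
  refine ⟨z, z.2, fun w hw => ?_⟩
  have := congrArg (fun f : Module.Dual F Z => f ⟨w, hw⟩) hz
  simpa [hβ] using this

lemma Nd.proj {Z : Submodule F V} [FiniteDimensional F Z] (h : Nd Q Z) (v : V) :
    ∃ z ∈ Z, v - z ∈ perp Q Z := by
  obtain ⟨z, hz, h1⟩ := h.rep (bl Q v)
  exact ⟨z, hz, fun w hw => by rw [map_sub, LinearMap.sub_apply, h1 w hw, sub_self]⟩

lemma Nd.eq_zero {Z : Submodule F V} (h : Nd Q Z) {v : V} (hv : v ∈ Z) (hv2 : v ∈ perp Q Z) : v = 0 := by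
  have : v ∈ Z ⊓ perp Q Z := ⟨hv, hv2⟩
  rw [h] at this
  simpa using this

lemma Nd.perp_perp (hV : perp Q ⊤ = ⊥) {Z : Submodule F V} [FiniteDimensional F Z] (h : Nd Q Z) : perp Q (perp Q Z) = Z := by
  refine le_antisymm (fun v hv => ?_) (le_perp_perp Z)
  obtain ⟨z, hz, h1⟩ := h.proj v
  have h2 : v - z ∈ perp Q (perp Q Z) := sub_mem hv (le_perp_perp Z hz)
  have h3 : v - z ∈ perp Q ⊤ := fun w _ => by
    obtain ⟨z', hz', h4⟩ := h.proj w
    have : w = z' + (w - z') := by abel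
    rw [this, map_add, h1 z' hz', h2 _ h4, add_zero]
  rw [hV, mem_bot, sub_eq_zero] at h3
  rwa [h3]

lemma Nd.sep {Z Y : Submodule F V} [FiniteDimensional F Z] (h : Nd Q Z) {d : V}
    (hd : d ∈ Z) (hdY : d ∉ Y) : ∃ d' ∈ Z, (∀ y ∈ Y ⊓ Z, bl Q d' y = 0) ∧ bl Q d' d = 1 := by
  obtain ⟨φ, h1, h2⟩ := Submodule.exists_le_ker_of_notMem hdY
  obtain ⟨z, hz, h3⟩ := h.rep φ
  refine ⟨(φ d)⁻¹ • z, smul_mem _ _ hz, fun y hy => ?_, ?_⟩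
  · rw [map_smul, LinearMap.smul_apply, h3 y hy.2, show φ y = 0 from h2 hy.1, smul_zero]
  · rw [map_smul, LinearMap.smul_apply, h3 d hd, smul_eq_mul, inv_mul_cancel₀ h1]

/-- reflection along an anisotropic vector -/
def refl (Q : QuadraticForm F V) (a : V) (ha : Q a ≠ 0) : V ≃ₗ[F] V :=
  LinearEquiv.ofInvolutive (LinearMap.id - (LinearMap.toSpanSingleton F V a).comp ((Q a)⁻¹ • bl Q a)) (by
    intro v
    simp [bl_self]
    match_scalars <;> field_simp <;> ring)

lemma refl_apply (a : V) (ha : Q a ≠ 0) (v : V) : refl Q a ha v = v - ((Q a)⁻¹ * bl Q a v) • a := by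
  show (LinearMap.id - (LinearMap.toSpanSingleton F V a).comp ((Q a)⁻¹ • bl Q a) : V →ₗ[F] V) v = _
  simp

lemma refl_isom (a : V) (ha : Q a ≠ 0) (v : V) : Q (refl Q a ha v) = Q v := by
  rw [refl_apply, Q_sub, Q_smul, map_smul, bl_comm v a, smul_eq_mul]
  field_simp
  ring

lemma refl_fix (a : V) (ha : Q a ≠ 0) (v : V) (h : bl Q a v = 0) : refl Q a ha v = v := by
  simp [refl_apply, h]

lemma refl_self (a : V) (ha : Q a ≠ 0) : refl Q a ha a = -a := by
  rw [refl_apply, bl_self]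
  match_scalars
  field_simp
  norm_num

/-- groups of isometries containing all reflections -/
structure Good (Q : QuadraticForm F V) (G : Subgroup (V ≃ₗ[F] V)) : Prop where
  isom : ∀ g ∈ G, ∀ v, Q (g v) = Q v
  refl : ∀ a (ha : Q a ≠ 0), refl Q a ha ∈ G

lemma Good.bl {G : Subgroup (V ≃ₗ[F] V)} (hG : Good Q G) {g : V ≃ₗ[F] V} (hg : g ∈ G) (v w : V) :
    bl Q (g v) (g w) = bl Q v w := by
  have h1 := hG.isom g hg (v + w)
  rw [map_add, Q_add, Q_add, hG.isom g hg, hG.isom g hg] at h1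
  simpa using h1

lemma Good.refl_comm {G : Subgroup (V ≃ₗ[F] V)} (hG : Good Q G) {a : V} (ha : Q a ≠ 0) {h : V ≃ₗ[F] V}
    (hh : h ∈ G) (hha : h a = a) (v : V) : OV.refl Q a ha (h v) = h (OV.refl Q a ha v) := by
  rw [refl_apply, refl_apply, map_sub, map_smul, hha]
  congr 3
  conv_lhs => rw [← hha, hG.bl hh]

lemma swap_lemma {G : Subgroup (V ≃ₗ[F] V)} (hG : Good Q G) {Z Y : Submodule F V}
    [FiniteDimensional F Z] (hZ : Nd Q Z) (hY : Y ≤ Z) {d : V} (hd : d ∈ Z) (hdY : d ∈ perp Q Y) (hdn : d ∉ Y) :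
    ∃ g ∈ G, (∀ y ∈ Y, g y = y) ∧ (∀ w ∈ perp Q Z, g w = w) ∧
      (∀ h ∈ G, (∀ z ∈ Z, h z = z) → ∀ v, g (h v) = h (g v)) ∧ g d = -d := by
  by_cases hQ : Q d = 0
  · obtain ⟨d', hd', h1, h2⟩ := hZ.sep hd hdn
    set e := d' - Q d' • d with he
    have heZ : e ∈ Z := sub_mem hd' (smul_mem _ _ hd)
    have hed : OV.bl Q e d = 1 := by simp [he, h2, bl_self, hQ]
    have hde : OV.bl Q d e = 1 := by rw [bl_comm, hed]
    have hee : Q e = 0 := by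
      rw [he, Q_sub, Q_smul, hQ, map_smul, h2]; simp
    have heY : ∀ y ∈ Y, OV.bl Q e y = 0 := fun y hy => by
      simp [he, h1 y ⟨hy, hY hy⟩, hdY y hy]
    have ha : Q (d + e) = 1 := by rw [Q_add, hQ, hee, hde]; simp
    have hb : Q (d - e) = -1 := by rw [Q_sub, hQ, hee, hde]; simp
    have ha' : Q (d + e) ≠ 0 := by rw [ha]; exact one_ne_zero
    have hb' : Q (d - e) ≠ 0 := by rw [hb]; exact neg_ne_zero.2 one_ne_zero
    refine ⟨OV.refl Q _ ha' * OV.refl Q _ hb', G.mul_mem (hG.refl _ _) (hG.refl _ _), ?_, ?_, ?_, ?_⟩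
    · intro y hy
      show OV.refl Q _ ha' (OV.refl Q _ hb' y) = y
      rw [refl_fix _ hb', refl_fix _ ha']
      · simp [hdY y hy, heY y hy]
      · simp [hdY y hy, heY y hy]
    · intro w hw
      show OV.refl Q _ ha' (OV.refl Q _ hb' w) = w
      rw [refl_fix _ hb', refl_fix _ ha']
      · rw [bl_comm]; exact hw _ (add_mem hd heZ)
      · rw [bl_comm]; exact hw _ (sub_mem hd heZ)
    · intro h hh hz v
      show OV.refl Q _ ha' (OV.refl Q _ hb' (h v)) = h (OV.refl Q _ ha' (OV.refl Q _ hb' v))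
      rw [hG.refl_comm hb' hh (hz _ (sub_mem hd heZ)), hG.refl_comm ha' hh (hz _ (add_mem hd heZ))]
    · show OV.refl Q _ ha' (OV.refl Q _ hb' d) = -d
      have h5 : OV.refl Q _ hb' d = e := by
        rw [refl_apply, hb]
        simp [bl_self, hQ, hed]
      rw [h5, refl_apply, ha]
      simp [bl_self, hee, hde]
  · refine ⟨OV.refl Q d hQ, hG.refl _ _, ?_, ?_, ?_, refl_self d hQ⟩
    · intro y hy
      exact refl_fix _ _ _ (hdY y hy)
    · intro w hw
      refine refl_fix _ _ _ ?_
      rw [bl_comm]; exact hw _ hd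
    · intro h hh hz v
      exact hG.refl_comm hQ hh (hz _ hd) v

end C
end OV

namespace OV
open Submodule
section P
variable {F V M : Type*} [Field F] [AddCommGroup V] [Module F V] [AddCommGroup M]

/-- span of a subspace and a list -/
def adj (Z : Submodule F V) (σ : List V) : Submodule F V := Z ⊔ span F {v | v ∈ σ}

lemma adj_nil (Z : Submodule F V) : adj Z [] = Z := by simp [adj]
lemma adj_cons (Z : Submodule F V) (v : V) (σ : List V) : adj Z (v :: σ) = adj (Z ⊔ span F {v}) σ := by
  have : {w | w ∈ v :: σ} = {v} ∪ {w | w ∈ σ} := by ext w; simp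
  rw [adj, adj, this, span_union, sup_assoc]
lemma adj_single (Z : Submodule F V) (v : V) : adj Z [v] = Z ⊔ span F {v} := by
  rw [adj_cons, adj_nil]
lemma le_adj (Z : Submodule F V) (σ : List V) : Z ≤ adj Z σ := le_sup_left
lemma mem_adj (Z : Submodule F V) {σ : List V} {v : V} (h : v ∈ σ) : v ∈ adj Z σ :=
  mem_sup_right (subset_span h)
lemma adj_le {Z W : Submodule F V} {σ : List V} : adj Z σ ≤ W ↔ Z ≤ W ∧ ∀ v ∈ σ, v ∈ W := by
  rw [adj, sup_le_iff, span_le]; rfl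
lemma adj_mono {Z Z' : Submodule F V} {σ σ' : List V} (h : Z ≤ Z') (h' : σ ⊆ σ') : adj Z σ ≤ adj Z' σ' :=
  adj_le.2 ⟨h.trans (le_adj _ _), fun _ hv => mem_adj _ (h' hv)⟩
lemma adj_perm (Z : Submodule F V) {σ σ' : List V} (h : σ.Perm σ') : adj Z σ = adj Z σ' :=
  le_antisymm (adj_mono le_rfl h.subset) (adj_mono le_rfl h.symm.subset)
lemma finrank_adj [FiniteDimensional F V] (σ : List V) : ∀ (Z : Submodule F V),
    Module.finrank F (adj Z σ) ≤ Module.finrank F Z + σ.length := by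
  induction σ with
  | nil => intro Z; rw [adj_nil]; simp
  | cons a σ ih =>
    intro Z
    rw [adj_cons]
    have h1 := ih (Z ⊔ span F {a})
    have h2 := Submodule.finrank_add_le_finrank_add_finrank Z (span F {a})
    have h3 : Module.finrank F (span F {a}) ≤ 1 := by
      have := finrank_span_le_card (R := F) ({a} : Set V)
      simpa using this
    simp only [List.length_cons]
    omega

/-- hypotheses of the combinatorial lemma -/
structure PhiData (Q : QuadraticForm F V) (G : Subgroup (V ≃ₗ[F] V)) (Z Z' : Submodule F V) (S : Set V)
    (j m : ℕ) (Φ : List V → M) : Prop where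
  good : Good Q G
  nd : Nd Q Z'
  le : Z ≤ Z'
  sub : ∀ v ∈ S, v ∈ Z'
  iso : ∀ v ∈ S, Q v = 0
  pair : ∀ a ∈ S, ∀ b ∈ S, ∀ z ∈ Z, bl Q a z = bl Q b z
  hyp : ∀ v ∈ S, Hyp Q (Z ⊔ span F {v}) (j + 1 + m)
  F1 : ∀ ρ : List V, (∀ v ∈ ρ, v ∈ S) → ρ.length = m + 3 → eps ρ Φ = 0
  F2 : ∀ ρ : List V, (∀ v ∈ ρ, v ∈ S) → ρ.length = m + 2 → Hyp Q (adj Z ρ) (j + 1) → Φ ρ = 0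
  F3 : ∀ g ∈ G, (∀ z ∈ Z, g z = z) → (∀ w ∈ perp Q Z', g w = w) →
      (∀ h ∈ G, (∀ z ∈ Z', h z = z) → ∀ v, g (h v) = h (g v)) →
      ∀ ρ : List V, (∀ v ∈ ρ, v ∈ S) → ρ.length = m + 2 → Φ (ρ.map g) = Φ ρ
  two : ∀ x : M, x + x = 0 → x = 0
  two' : (2 : F) ≠ 0

variable {Q : QuadraticForm F V} {G : Subgroup (V ≃ₗ[F] V)} {Z Z' : Submodule F V} {S : Set V}
    {j m : ℕ} {Φ : List V → M} [FiniteDimensional F V]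

lemma PhiData.small (h : PhiData Q G Z Z' S j m Φ) {v : V} (hv : v ∈ S) {ρ : List V}
    (hρ : ∀ v ∈ ρ, v ∈ S) (hl : ρ.length = m + 2) (hle : Z ⊔ span F {v} ≤ adj Z ρ)
    (hr : Module.finrank F (adj Z ρ) ≤ Module.finrank F ↥(Z ⊔ span F {v}) + m) : Φ ρ = 0 :=
  h.F2 ρ hρ hl ((h.hyp v hv).drop hle hr)

lemma PhiData.dep (h : PhiData Q G Z Z' S j m Φ) {ρ : List V} (hρ : ∀ v ∈ ρ, v ∈ S)
    (hl : ρ.length = m + 2) {a : V} {ρ' : List V} (hp : ρ.Perm (a :: ρ')) (ha : a ∈ adj Z ρ') : Φ ρ = 0 := by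
  have hl' : ρ'.length = m + 1 := by have := hp.length_eq; simp at this; omega
  rcases ρ' with _ | ⟨b, ρ'⟩
  · simp at hl'
  have hb : b ∈ ρ := hp.symm.subset (by simp)
  have he : adj Z ρ = adj (Z ⊔ span F {b}) ρ' := by
    rw [adj_perm Z hp, ← adj_cons]
    refine le_antisymm (adj_le.2 ⟨le_adj _ _, ?_⟩) (adj_mono le_rfl (by simp))
    intro v hv
    rcases List.mem_cons.1 hv with rfl | hv
    · exact ha
    · exact mem_adj _ hv
  refine h.small (hρ b hb) hρ hl ?_ ?_
  · rw [he]; exact le_adj _ _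
  · rw [he]
    have := finrank_adj ρ' (Z ⊔ span F {b})
    simp at hl'
    omega

lemma PhiData.anti (h : PhiData Q G Z Z' S j m Φ) {l1 l2 : List V} {a b : V}
    (hρ : ∀ v ∈ l1 ++ a :: b :: l2, v ∈ S) (hl : (l1 ++ a :: b :: l2).length = m + 2) :
    Φ (l1 ++ b :: a :: l2) + Φ (l1 ++ a :: b :: l2) = 0 := by
  have h0 := h.F1 (l1 ++ a :: b :: a :: l2) (by
    intro v hv; apply hρ; simp at hv ⊢; tauto) (by simp at hl ⊢; omega)
  have key : ∀ l : List V, (∀ v ∈ l, v ∈ l1 ++ a :: b :: l2) → l.length = m + 2 →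
      (∃ l', l.Perm (a :: a :: l')) → Φ l = 0 := by
    rintro l hl1 hl2 ⟨l', hp⟩
    exact h.dep (fun v hv => hρ v (hl1 v hv)) hl2 hp (mem_adj _ (by simp))
  rw [eps_append, eps_zero', zero_add] at h0
  · simp only [eps_cons] at h0
    have h1 : eps l2 (fun l' => Φ (l1 ++ a :: b :: a :: l')) = 0 := by
      refine eps_zero' _ fun l' hs hlen => key _ ?_ ?_ ⟨l1 ++ b :: l', ?_⟩
      · intro v hv
        have := hs.subset (a := v)
        simp at hv ⊢; tauto
      · simp at hl ⊢; omega
      · have := List.perm_middle (a := a) (l₁ := l1) (l₂ := b :: a :: l')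
        refine this.trans (List.Perm.cons a ?_)
        rw [show l1 ++ b :: a :: l' = (l1 ++ [b]) ++ a :: l' by simp, show l1 ++ b :: l' = (l1 ++ [b]) ++ l' by simp]
        exact List.perm_middle
    have h2 : Φ (l1 ++ a :: a :: l2) = 0 := by
      refine key _ ?_ ?_ ⟨l1 ++ l2, ?_⟩
      · intro v hv; simp at hv ⊢; tauto
      · simp at hl ⊢; omega
      · exact (List.perm_middle (a := a) (l₁ := l1) (l₂ := a :: l2)).trans (List.Perm.cons a List.perm_middle)
    rw [h1, h2] at h0
    have h3 : (-1 : ℤ) ^ l1.length • (Φ (l1 ++ b :: a :: l2) + Φ (l1 ++ a :: b :: l2)) = 0 := by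
      rw [← h0]; congr 1; abel
    rcases neg_one_pow_eq_or ℤ l1.length with h4 | h4
    · rwa [h4, one_smul] at h3
    · rwa [h4, neg_one_smul, neg_eq_zero] at h3
  · intro l' hs hlen
    refine key _ ?_ ?_ ⟨l' ++ b :: l2, ?_⟩
    · intro v hv
      have := hs.subset (a := v)
      simp at hv ⊢; tauto
    · simp at hl ⊢; omega
    · have := List.perm_middle (a := a) (l₁ := l') (l₂ := b :: a :: l2)
      refine this.trans (List.Perm.cons a ?_)
      rw [show l' ++ b :: a :: l2 = (l' ++ [b]) ++ a :: l2 by simp, show l' ++ b :: l2 = (l' ++ [b]) ++ l2 by simp]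
      exact List.perm_middle

lemma PhiData.perm_aux (h : PhiData Q G Z Z' S j m Φ) {l l' : List V} (hp : l.Perm l') :
    ∀ pre : List V, (∀ v ∈ pre ++ l, v ∈ S) → (pre ++ l).length = m + 2 →
      Φ (pre ++ l) = 0 → Φ (pre ++ l') = 0 := by
  induction hp with
  | nil => intro pre _ _ h; exact h
  | cons x hp ih =>
    intro pre h1 h2 h3
    have := ih (pre ++ [x]) (by simpa using h1) (by simpa using h2) (by simpa using h3)
    simpa using this
  | swap x y l =>
    intro pre h1 h2 h3
    have := h.anti h1 h2
    rwa [h3, add_zero] at this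
  | trans hp1 hp2 ih1 ih2 =>
    intro pre h1 h2 h3
    refine ih2 pre ?_ ?_ (ih1 pre h1 h2 h3)
    · intro v hv
      apply h1
      rw [List.mem_append] at hv ⊢
      rwa [hp1.mem_iff]
    · rw [← h2]; simp [hp1.length_eq]

lemma PhiData.perm (h : PhiData Q G Z Z' S j m Φ) {l l' : List V} (hp : l.Perm l')
    (hl : ∀ v ∈ l', v ∈ S) (hlen : l'.length = m + 2) (h0 : Φ l' = 0) : Φ l = 0 := by
  have := h.perm_aux hp.symm [] (by simpa using hl) (by simpa using hlen) (by simpa using h0)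
  simpa using this

lemma PhiData.goodpair (h : PhiData Q G Z Z' S j m Φ) {ρ : List V} (hρ : ∀ v ∈ ρ, v ∈ S)
    (hl : ρ.length = m + 2) {a b : V} {r : List V} (hp : ρ.Perm (a :: b :: r))
    (hr : ∀ v ∈ r, bl Q a v = bl Q b v) : Φ ρ = 0 := by
  have hρ' : ∀ v ∈ a :: b :: r, v ∈ S := fun v hv => hρ v (hp.symm.subset hv)
  have hl' : (a :: b :: r).length = m + 2 := by rw [← hp.length_eq, hl]
  have ha : a ∈ S := hρ' a (by simp)
  have hb : b ∈ S := hρ' b (by simp)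
  refine h.perm hp hρ' hl' ?_
  by_cases hdep : a ∈ adj Z (b :: r)
  · exact h.dep hρ' hl' (List.Perm.refl _) hdep
  have haZ : a ∉ Z := fun h0 => hdep (le_adj _ _ h0)
  set d := a - b with hd
  set Y := adj Z ((a + b) :: r) with hY
  by_cases hdY : d ∈ Y
  · have hab : a + b ∈ Y := mem_adj _ (by simp)
    have ha' : a ∈ Y := by
      have : a = (2 : F)⁻¹ • (d + (a + b)) := by
        rw [hd, show a - b + (a + b) = (2 : F) • a by rw [two_smul]; abel, smul_smul, inv_mul_cancel₀ h.two', one_smul]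
      rw [this]; exact smul_mem _ _ (add_mem hdY hab)
    have hb' : b ∈ Y := by
      have : b = (a + b) - a := by abel
      rw [this]; exact sub_mem hab ha'
    have hle : adj Z (a :: b :: r) ≤ Y := by
      refine adj_le.2 ⟨le_adj _ _, ?_⟩
      intro v hv
      rcases List.mem_cons.1 hv with rfl | hv
      · exact ha'
      rcases List.mem_cons.1 hv with rfl | hv
      · exact hb'
      exact mem_adj _ (by simp [hv])
    refine h.small ha hρ' hl' (by rw [adj_cons]; exact le_adj _ _) ?_
    have h1 := finrank_mono hle
    have h2 := finrank_adj ((a + b) :: r) Z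
    have h3 : Z < Z ⊔ span F {a} := by
      refine lt_of_le_of_ne le_sup_left fun h => haZ ?_
      rw [h]; exact mem_sup_single _ _
    have h4 := finrank_lt_finrank_of_lt h3
    rw [← hY] at h2
    simp at h2 hl'
    omega
  · have hYZ : Y ≤ Z' := adj_le.2 ⟨h.le, by
      intro v hv
      rcases List.mem_cons.1 hv with rfl | hv
      · exact add_mem (h.sub _ ha) (h.sub _ hb)
      · exact h.sub _ (hρ' _ (by simp [hv]))⟩
    have hdp : d ∈ perp Q Y := by
      rw [hY, adj, mem_perp_sup_span]
      refine ⟨fun z hz => ?_, fun v hv => ?_⟩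
      · rw [hd, map_sub, LinearMap.sub_apply, h.pair a ha b hb z hz, sub_self]
      · rcases List.mem_cons.1 hv with rfl | hv
        · simp [hd, bl_self, h.iso a ha, h.iso b hb, bl_comm b a]
        · rw [hd, map_sub, LinearMap.sub_apply, hr v hv, sub_self]
    obtain ⟨g, hg, g1, g2, g3, g4⟩ := swap_lemma h.good h.nd hYZ (sub_mem (h.sub _ ha) (h.sub _ hb)) hdp hdY
    have hab : g (a + b) = a + b := g1 _ (mem_adj _ (by simp))
    have hga : g a + g a = b + b := by
      have : g a + g a = g (a + b) + g (a - b) := by rw [← map_add, ← map_add]; congr 1; abel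
      rw [this, hab, g4]; show a + b + -(a - b) = b + b; abel
    have hga : g a = b := by
      have h5 : (2 : F) • g a = (2 : F) • b := by rw [two_smul, two_smul, hga]
      exact smul_right_injective V h.two' h5
    have hgb : g b = a := by
      have h5 : g b = g (a + b) - g a := by rw [map_add]; abel
      rw [h5, hab, hga]; abel
    have h6 := h.F3 g hg (fun z hz => g1 z (le_adj _ _ hz)) g2 g3 (a :: b :: r) hρ' hl'
    have h7 : r.map g = r := by
      conv_rhs => rw [← List.map_id r]
      exact List.map_congr_left fun v hv => g1 v (mem_adj _ (by simp [hv]))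
    rw [List.map_cons, List.map_cons, hga, hgb, h7] at h6
    have h8 := h.anti (l1 := []) hρ' hl'
    simp only [List.nil_append] at h8
    rw [h6] at h8
    exact h.two _ h8

end P
end OV

namespace OV
open Submodule
section P2
variable {F V M : Type*} [Field F] [AddCommGroup V] [Module F V] [AddCommGroup M]
variable {Q : QuadraticForm F V}

lemma ternary [Finite F] (A B C D E G : F) :
    ∃ x y z : F, (x ≠ 0 ∨ y ≠ 0 ∨ z ≠ 0) ∧
      A * x * x + B * y * y + C * z * z + D * x * y + E * x * z + G * y * z = 0 := by
  classical
  have := Fintype.ofFinite F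
  obtain ⟨p, hp⟩ := CharP.exists F
  have := hp
  have hpp : p.Prime := (CharP.char_is_prime_or_zero F p).resolve_right (CharP.char_ne_zero_of_finite F p)
  let f : MvPolynomial (Fin 3) F :=
    MvPolynomial.C A * (MvPolynomial.X 0 * MvPolynomial.X 0) + MvPolynomial.C B * (MvPolynomial.X 1 * MvPolynomial.X 1)
    + MvPolynomial.C C * (MvPolynomial.X 2 * MvPolynomial.X 2) + MvPolynomial.C D * (MvPolynomial.X 0 * MvPolynomial.X 1)
    + MvPolynomial.C E * (MvPolynomial.X 0 * MvPolynomial.X 2) + MvPolynomial.C G * (MvPolynomial.X 1 * MvPolynomial.X 2)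
  have hm : ∀ (c : F) (i j : Fin 3), (MvPolynomial.C c * (MvPolynomial.X i * MvPolynomial.X j)).IsHomogeneous 2 := by
    intro c i j
    have := (MvPolynomial.isHomogeneous_C (Fin 3) c).mul
      ((MvPolynomial.isHomogeneous_X F i).mul (MvPolynomial.isHomogeneous_X F j))
    simpa using this
  have hf : f.IsHomogeneous 2 := (((((hm _ _ _).add (hm _ _ _)).add (hm _ _ _)).add (hm _ _ _)).add (hm _ _ _)).add (hm _ _ _)
  have hd : f.totalDegree < Fintype.card (Fin 3) := by
    have := hf.totalDegree_le
    simp; omega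
  have hdvd := char_dvd_card_solutions p hd
  have hev : ∀ x : Fin 3 → F, MvPolynomial.eval x f = A * x 0 * x 0 + B * x 1 * x 1 + C * x 2 * x 2
     + D * x 0 * x 1 + E * x 0 * x 2 + G * x 1 * x 2 := by
    intro x; simp [f]; ring
  have h0 : MvPolynomial.eval (0 : Fin 3 → F) f = 0 := by rw [hev]; simp
  have hpos : 0 < Fintype.card { x : Fin 3 → F // MvPolynomial.eval x f = 0 } := Fintype.card_pos_iff.2 ⟨⟨0, h0⟩⟩
  have h1 : 1 < Fintype.card { x : Fin 3 → F // MvPolynomial.eval x f = 0 } :=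
    lt_of_lt_of_le hpp.one_lt (Nat.le_of_dvd hpos hdvd)
  obtain ⟨⟨x, hx⟩, hne⟩ := Fintype.exists_ne_of_one_lt_card h1 ⟨0, h0⟩
  refine ⟨x 0, x 1, x 2, ?_, by rw [← hev]; exact hx⟩
  by_contra hcon
  push Not at hcon
  apply hne
  ext i
  fin_cases i
  exacts [hcon.1, hcon.2.1, hcon.2.2]

lemma span_split (r : List V) : ∀ {u : V}, u ∈ span F {v | v ∈ r} → u ≠ 0 →
    ∃ (l1 : List V) (a : V) (l2 : List V) (c : F), r = l1 ++ a :: l2 ∧ c ≠ 0 ∧ u - c • a ∈ span F {v | v ∈ l1 ++ l2} := by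
  induction r with
  | nil => intro u hu h0; simp at hu; exact absurd hu h0
  | cons b r ih =>
    intro u hu h0
    have hs : {v | v ∈ b :: r} = insert b {v | v ∈ r} := by ext v; simp
    rw [hs, mem_span_insert] at hu
    obtain ⟨c, y, hy, rfl⟩ := hu
    by_cases hc : c = 0
    · subst hc
      rw [zero_smul, zero_add] at h0 ⊢
      obtain ⟨l1, a, l2, c, rfl, hc, h⟩ := ih hy h0
      refine ⟨b :: l1, a, l2, c, rfl, hc, span_mono ?_ h⟩
      intro v hv
      exact List.mem_cons_of_mem _ hv
    · exact ⟨[], b, r, c, rfl, hc, by simpa using hy⟩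

lemma affine_core [Finite F] (h2 : (2 : F) ≠ 0) (U : Submodule F V) (m : ℕ) (Ψ : List V → M)
    (hE : ∀ ws : List V, (∀ v ∈ ws, v ∈ U) → ws.length = m + 3 → eps ws Ψ = 0)
    (hP : ∀ ws ws' : List V, ws.Perm ws' → (∀ v ∈ ws', v ∈ U) → ws'.length = m + 2 → Ψ ws' = 0 → Ψ ws = 0)
    (hD : ∀ ws : List V, (∀ v ∈ ws, v ∈ U) → ws.length = m + 2 → ∀ a r, ws.Perm (a :: 0 :: r) →
      a ∈ span F {v | v ∈ r} → Ψ ws = 0)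
    (hG : ∀ ws : List V, (∀ v ∈ ws, v ∈ U) → ws.length = m + 2 → ∀ a b r, ws.Perm (a :: b :: r) →
      (∀ c ∈ r, Q (a - c) = Q (b - c)) → Ψ ws = 0)
    (hI : ∀ r : List V, (∀ v ∈ r, v ∈ U) → r.length = m + 1 → ∀ u ∈ span F {v | v ∈ r}, ∀ n ∈ span F {v | v ∈ r},
      Q u = 0 → Q n = 0 → bl Q u n = 1 → Ψ (0 :: r) = 0)
    (r : List V) (hr : ∀ v ∈ r, v ∈ U) (hl : r.length = m + 1) : Ψ (0 :: r) = 0 := by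
  have hU0 : ∀ v ∈ (0 : V) :: r, v ∈ U := by
    intro v hv
    rcases List.mem_cons.1 hv with rfl | hv
    · exact zero_mem _
    · exact hr v hv
  have hl0 : ((0 : V) :: r).length = m + 2 := by simp [hl]
  have hspan : span F {v | v ∈ r} ≤ U := span_le.2 hr
  by_cases hiso : ∃ u ∈ span F {v | v ∈ r}, u ≠ 0 ∧ Q u = 0
  · obtain ⟨u, hu, hu0, hQu⟩ := hiso
    by_cases hn : ∃ n ∈ span F {v | v ∈ r}, bl Q u n ≠ 0
    · obtain ⟨n, hn, hun⟩ := hn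
      refine hI r hr hl u hu ((bl Q u n)⁻¹ • (n - (Q n / bl Q u n) • u))
        (smul_mem _ _ (sub_mem hn (smul_mem _ _ hu))) hQu ?_ ?_
      · rw [Q_smul, Q_sub, Q_smul, hQu, map_smul, bl_comm n u, smul_eq_mul]
        field_simp
        ring
      · rw [map_smul, map_sub, map_smul, bl_self, hQu]
        simp [hun]
    · push Not at hn
      obtain ⟨l1, a, l2, c, rfl, hc, hca⟩ := span_split r hu hu0
      set r' := l1 ++ l2 with hr'
      have hp : (0 :: (l1 ++ a :: l2)).Perm (a :: 0 :: r') :=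
        (List.Perm.cons 0 List.perm_middle).trans (List.Perm.swap _ _ _)
      set o := a - c⁻¹ • u with ho
      have ha : a ∈ span F {v | v ∈ l1 ++ a :: l2} := subset_span (by simp)
      have hoU : o ∈ U := hspan (sub_mem ha (smul_mem _ _ hu))
      have hos : o ∈ span F {v | v ∈ r'} := by
        have : o = (-c⁻¹) • (u - c • a) := by
          rw [smul_sub, smul_smul, neg_mul, inv_mul_cancel₀ hc, ho]; simp; abel
        rw [this]; exact smul_mem _ _ hca
      have hr'r : ∀ v ∈ r', v ∈ l1 ++ a :: l2 := by
        intro v hv; simp [hr'] at hv ⊢; tauto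
      have hlr : r'.length = m := by simp [hr'] at hl ⊢; omega
      have hUall : ∀ v ∈ o :: a :: 0 :: r', v ∈ U := by
        intro v hv
        simp only [List.mem_cons] at hv
        rcases hv with rfl | rfl | rfl | hv
        · exact hoU
        · exact hspan ha
        · exact zero_mem _
        · exact hr v (hr'r v hv)
      have hQo : ∀ x ∈ (0 : V) :: r', Q (o - x) = Q (a - x) := by
        intro x hx
        have hxs : x ∈ span F {v | v ∈ l1 ++ a :: l2} := by
          rcases List.mem_cons.1 hx with rfl | hx
          · exact zero_mem _
          · exact subset_span (hr'r x hx)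
        have : o - x = (a - x) - c⁻¹ • u := by rw [ho]; abel
        rw [this, Q_sub, Q_smul, hQu, map_smul, bl_comm, hn _ (sub_mem ha hxs)]; simp
      have h1 := hE (o :: a :: 0 :: r') hUall (by simp [hlr])
      rw [eps_cons, eps_cons] at h1
      have h3 : Ψ (o :: 0 :: r') = 0 := by
        refine hD _ ?_ (by simp [hlr]) o r' (List.Perm.refl _) hos
        intro v hv; apply hUall; simp at hv ⊢; tauto
      rw [h3, eps_zero', sub_zero, sub_zero] at h1
      · refine hP _ _ hp ?_ (by simp [hlr]) h1
        intro v hv; apply hUall; simp at hv ⊢; tauto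
      · intro l' hs hlen
        have hsub : ∀ v ∈ l', v ∈ (0 : V) :: r' := fun v hv => hs.subset hv
        refine hG _ ?_ ?_ o a l' (List.Perm.refl _) (fun c hc => hQo c (hsub c hc))
        · intro v hv; apply hUall
          have := hsub v
          simp at hv this ⊢; tauto
        · simp [hlr] at hlen ⊢; omega
  · push Not at hiso
    have hzero : ∀ u ∈ span F {v | v ∈ r}, Q u = 0 → u = 0 := by
      intro u hu hQ
      by_contra h0
      exact hiso u hu h0 hQ
    rcases r with _ | ⟨a, _ | ⟨b, _ | ⟨c, r⟩⟩⟩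
    · simp at hl
    · exact hG _ hU0 hl0 0 a [] (List.Perm.refl _) (by simp)
    · have ha : a ∈ span F {v | v ∈ [a, b]} := subset_span (by simp)
      have hb : b ∈ span F {v | v ∈ [a, b]} := subset_span (by simp)
      set Dt := 4 * Q a * Q b - bl Q a b * bl Q a b with hDt
      by_cases hD0 : Dt = 0
      · by_cases hQa : Q a = 0
        · refine hD _ hU0 hl0 a [b] (List.Perm.swap _ _ _) ?_
          rw [hzero a ha hQa]; exact zero_mem _
        · have hu := hzero ((bl Q a b) • a - (2 * Q a) • b) (sub_mem (smul_mem _ _ ha) (smul_mem _ _ hb)) (by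
            rw [Q_sub, Q_smul, Q_smul, map_smul, map_smul, LinearMap.smul_apply, smul_eq_mul, smul_eq_mul]
            linear_combination Q a * hD0)
          have hb' : b = ((2 * Q a)⁻¹ * bl Q a b) • a := by
            have h3 : (2 * Q a) • b = (bl Q a b) • a := (sub_eq_zero.1 hu).symm
            rw [mul_smul, ← h3, smul_smul, inv_mul_cancel₀ (mul_ne_zero h2 hQa), one_smul]
          refine hD _ hU0 hl0 b [a] ?_ ?_
          · exact (List.Perm.cons 0 (List.Perm.swap _ _ _)).trans (List.Perm.swap _ _ _)
          · rw [hb']; exact smul_mem _ _ (subset_span (by simp))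
      · set x := (2 * Q a * Q b - Q b * bl Q a b) / Dt with hx
        set y := (2 * Q a * Q b - Q a * bl Q a b) / Dt with hy
        set o := x • a + y • b with ho
        have hoU : o ∈ U := hspan (add_mem (smul_mem _ _ ha) (smul_mem _ _ hb))
        have hoa : bl Q o a = Q a := by
          rw [ho, map_add, LinearMap.add_apply, map_smul, map_smul, LinearMap.smul_apply, LinearMap.smul_apply,
            bl_self, bl_comm b a, smul_eq_mul, smul_eq_mul, hx, hy]
          field_simp
          rw [hDt]; ring
        have hob : bl Q o b = Q b := by
          rw [ho, map_add, LinearMap.add_apply, map_smul, map_smul, LinearMap.smul_apply, LinearMap.smul_apply,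
            bl_self, smul_eq_mul, smul_eq_mul, hx, hy]
          field_simp
          rw [hDt]; ring
        have e0 : Q (0 - o) = Q o := by rw [zero_sub, Q_neg]
        have ea : Q (a - o) = Q o := by rw [Q_sub, bl_comm, hoa]; ring
        have eb : Q (b - o) = Q o := by rw [Q_sub, bl_comm, hob]; ring
        have hm : m = 1 := by simpa using hl.symm
        have h1 := hE [o, 0, a, b] (by
          intro v hv
          rcases List.mem_cons.1 hv with rfl | hv
          · exact hoU
          · exact hU0 v hv) (by simp [hm])
        have key : ∀ s t : V, s ∈ U → t ∈ U → Q (s - o) = Q (t - o) → Ψ [o, s, t] = 0 := by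
          intro s t hs ht hst
          refine hG _ ?_ (by simp [hm]) s t [o] ?_ (by simpa using hst)
          · intro v hv; simp at hv; rcases hv with rfl | rfl | rfl <;> assumption
          · exact (List.Perm.swap _ _ _).trans (List.Perm.cons _ (List.Perm.swap _ _ _))
        have haU := hspan ha
        have hbU := hspan hb
        simp only [eps_cons, eps_nil] at h1
        rw [key a b haU hbU (by rw [ea, eb]), key 0 b (zero_mem _) hbU (by rw [e0, eb]),
          key 0 a (zero_mem _) haU (by rw [e0, ea])] at h1
        simpa using h1
    · have ha : a ∈ span F {v | v ∈ a :: b :: c :: r} := subset_span (by simp)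
      have hb : b ∈ span F {v | v ∈ a :: b :: c :: r} := subset_span (by simp)
      have hc : c ∈ span F {v | v ∈ a :: b :: c :: r} := subset_span (by simp)
      obtain ⟨x, y, z, hne, hxyz⟩ := ternary (Q a) (Q b) (Q c) (bl Q a b) (bl Q a c) (bl Q b c)
      have hu := hzero (x • a + y • b + z • c)
        (add_mem (add_mem (smul_mem _ _ ha) (smul_mem _ _ hb)) (smul_mem _ _ hc)) (by
          simp only [Q_add, Q_smul, map_add, LinearMap.add_apply, map_smul, LinearMap.smul_apply, smul_eq_mul]
          linear_combination hxyz)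
      rcases hne with h | h | h
      · refine hD _ hU0 hl0 a (b :: c :: r) (List.Perm.swap _ _ _) ?_
        have : a = (-x⁻¹) • (y • b + z • c) := by
          have h3 : x • a = -(y • b + z • c) := by rw [eq_neg_iff_add_eq_zero, ← hu]; abel
          rw [neg_smul, ← smul_neg, ← h3, smul_smul, inv_mul_cancel₀ h, one_smul]
        rw [this]
        exact smul_mem _ _ (add_mem (smul_mem _ _ (subset_span (by simp))) (smul_mem _ _ (subset_span (by simp))))
      · refine hD _ hU0 hl0 b (a :: c :: r)
          ((List.Perm.cons 0 (List.Perm.swap _ _ _)).trans (List.Perm.swap _ _ _)) ?_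
        have : b = (-y⁻¹) • (x • a + z • c) := by
          have h3 : y • b = -(x • a + z • c) := by rw [eq_neg_iff_add_eq_zero, ← hu]; abel
          rw [neg_smul, ← smul_neg, ← h3, smul_smul, inv_mul_cancel₀ h, one_smul]
        rw [this]
        exact smul_mem _ _ (add_mem (smul_mem _ _ (subset_span (by simp))) (smul_mem _ _ (subset_span (by simp))))
      · refine hD _ hU0 hl0 c (a :: b :: r)
          ((List.perm_middle (l₁ := [0, a, b]) (a := c) (l₂ := r))) ?_
        have : c = (-z⁻¹) • (x • a + y • b) := by
          have h3 : z • c = -(x • a + y • b) := by rw [eq_neg_iff_add_eq_zero, ← hu]; abel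
          rw [neg_smul, ← smul_neg, ← h3, smul_smul, inv_mul_cancel₀ h, one_smul]
        rw [this]
        exact smul_mem _ _ (add_mem (smul_mem _ _ (subset_span (by simp))) (smul_mem _ _ (subset_span (by simp))))

variable {G : Subgroup (V ≃ₗ[F] V)} {Z Z' : Submodule F V} {S : Set V}
    {j m : ℕ} {Φ : List V → M} [FiniteDimensional F V]

lemma PhiData.concA (h : PhiData Q G Z Z' S j m Φ) (hS : ∀ v ∈ S, v ∈ perp Q Z)
    (hZ : Hyp Q Z (j + 1 + (m + 1))) {ρ : List V} (hρ : ∀ v ∈ ρ, v ∈ S) (hl : ρ.length = m + 2) : Φ ρ = 0 := by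
  by_cases hB : ∃ a ∈ ρ, ∃ b ∈ ρ, bl Q a b ≠ 0
  · obtain ⟨a, ha, b, hb, hab⟩ := hB
    refine h.F2 ρ hρ hl (Hyp.strict (le_adj Z ρ) (x := (a, (bl Q a b)⁻¹ • b)) ?_ (mem_adj _ ha)
      (smul_mem _ _ (mem_adj _ hb)) ?_ hZ)
    · refine ⟨h.iso a (hρ a ha), ?_, ?_, hS a (hρ a ha), smul_mem _ _ (hS b (hρ b hb))⟩
      · simp only [Q_smul, h.iso b (hρ b hb), mul_zero]
      · simp [hab]
    · have := finrank_adj ρ Z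
      omega
  · push Not at hB
    rcases ρ with _ | ⟨a, _ | ⟨b, r⟩⟩
    · simp at hl
    · simp at hl
    · refine h.goodpair hρ hl (List.Perm.refl _) fun v hv => ?_
      rw [hB a (by simp) v (by simp [hv]), hB b (by simp) v (by simp [hv])]

lemma PhiData.concB [Finite F] (h : PhiData Q G Z Z' S j m Φ) {τ : V → F} {l : V}
    (hS : ∀ v, v ∈ S ↔ v ∈ Z' ∧ Q v = 0 ∧ ∀ z ∈ Z, bl Q v z = τ z)
    (hl : l ∈ Z) (hlp : l ∈ perp Q Z) (hQl : Q l = 0) (hτ : τ l = 1)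
    {ρ : List V} (hρ : ∀ v ∈ ρ, v ∈ S) (hlen : ρ.length = m + 2) : Φ ρ = 0 := by
  rcases ρ with _ | ⟨v0, r⟩
  · simp at hlen
  have hv0 := hρ v0 (by simp)
  obtain ⟨hv0Z, hQv0, hv0τ⟩ := (hS v0).1 hv0
  have hv0l : bl Q v0 l = 1 := by rw [hv0τ l hl, hτ]
  set T := Z ⊔ span F {v0} with hT
  set U := Z' ⊓ perp Q T with hU
  set vv : V → V := fun w => v0 + w - Q w • l with hvv
  have hUw : ∀ w ∈ U, w ∈ Z' ∧ (∀ z ∈ Z, bl Q w z = 0) ∧ bl Q w v0 = 0 := by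
    rintro w ⟨h1, h2⟩
    rw [hT, SetLike.mem_coe, mem_perp_sup_span] at h2
    exact ⟨h1, h2.1, h2.2 v0 rfl⟩
  have hvvS : ∀ w ∈ U, vv w ∈ S := by
    intro w hw
    obtain ⟨h1, h2, h3⟩ := hUw w hw
    rw [hS]
    refine ⟨sub_mem (add_mem hv0Z h1) (smul_mem _ _ (h.le hl)), ?_, fun z hz => ?_⟩
    · simp only [hvv, Q_sub, Q_add, Q_smul, hQl, hQv0, map_add, LinearMap.add_apply, map_smul, hv0l, h2 l hl,
        bl_comm v0 w, h3, smul_eq_mul]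
      ring
    · simp only [hvv, map_sub, map_add, LinearMap.sub_apply, LinearMap.add_apply, map_smul, LinearMap.smul_apply,
        h2 z hz, hlp z hz, hv0τ z hz, smul_eq_mul]
      ring
  have hvvB : ∀ w ∈ U, ∀ w' ∈ U, bl Q (vv w) (vv w') = - Q (w - w') := by
    intro w hw w' hw'
    obtain ⟨h1, h2, h3⟩ := hUw w hw
    obtain ⟨h1', h2', h3'⟩ := hUw w' hw'
    simp only [hvv, map_sub, map_add, LinearMap.sub_apply, LinearMap.add_apply, map_smul, LinearMap.smul_apply,
        h2 l hl, h2' l hl, hv0l, Q_sub, bl_self, hQv0, hQl, bl_comm v0 w', h3', h3, bl_comm l v0, bl_comm l w', smul_eq_mul]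
    ring
  have hvv0 : vv 0 = v0 := by simp [hvv]
  have hinS : ∀ ws : List V, (∀ v ∈ ws, v ∈ U) → ∀ v ∈ ws.map vv, v ∈ S := by
    intro ws hws v hv
    obtain ⟨w, hw, rfl⟩ := List.mem_map.1 hv
    exact hvvS w (hws w hw)
  have hspan : ∀ r : List V, ∀ a ∈ span F {v | v ∈ r}, a ∈ adj Z (v0 :: r.map vv) := by
    intro r a ha
    refine (span_le.2 ?_ : span F {v | v ∈ r} ≤ adj Z (v0 :: r.map vv)) ha
    intro w hw
    have : w = vv w - v0 + Q w • l := by simp only [hvv]; abel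
    rw [this]
    exact add_mem (sub_mem (mem_adj _ (List.mem_cons_of_mem _ (List.mem_map_of_mem hw))) (mem_adj _ (by simp)))
      (smul_mem _ _ (le_adj _ _ hl))
  have hrank : ∀ r : List V, Module.finrank F (adj Z (v0 :: r)) ≤ Module.finrank F T + r.length := by
    intro r
    rw [adj_cons]
    exact finrank_adj r _
  have core := affine_core (Q := Q) h.two' U m (fun ws => Φ (ws.map vv)) ?_ ?_ ?_ ?_ ?_
  · have hr : ∀ v ∈ r, v - v0 - bl Q v v0 • l ∈ U ∧ vv (v - v0 - bl Q v v0 • l) = v := by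
      intro v hv
      obtain ⟨h1, h2, h3⟩ := (hS v).1 (hρ v (by simp [hv]))
      have hvl : bl Q v l = 1 := by rw [h3 l hl, hτ]
      refine ⟨⟨sub_mem (sub_mem h1 hv0Z) (smul_mem _ _ (h.le hl)), ?_⟩, ?_⟩
      · rw [hT, SetLike.mem_coe, mem_perp_sup_span]
        refine ⟨fun z hz => ?_, ?_⟩
        · simp [h3 z hz, hv0τ z hz, hlp z hz]
        · rintro s rfl
          simp [bl_self, hQv0, bl_comm l s, hv0l]
      · simp only [hvv]
        have : Q (v - v0 - bl Q v v0 • l) = - bl Q v v0 := by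
          simp only [Q_sub, Q_smul, hQl, hQv0, h2, map_sub, LinearMap.sub_apply, map_smul, hvl, hv0l, smul_eq_mul]
          ring
        rw [this, neg_smul]; abel
    have h1 := core (r.map fun v => v - v0 - bl Q v v0 • l) (by
      intro v hv
      obtain ⟨w, hw, rfl⟩ := List.mem_map.1 hv
      exact (hr w hw).1) (by simpa using hlen)
    simp only [List.map_cons, hvv0, List.map_map] at h1
    have h2 : List.map (vv ∘ fun v => v - v0 - bl Q v v0 • l) r = r := by
      conv_rhs => rw [← List.map_id r]
      exact List.map_congr_left fun v hv => (hr v hv).2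
    rwa [h2] at h1
  · intro ws hws hl
    rw [← eps_map]
    exact h.F1 _ (hinS ws hws) (by simpa using hl)
  · intro ws ws' hp hws hl h0
    exact h.perm (hp.map vv) (hinS _ hws) (by simpa using hl) h0
  · intro ws hws hl a r hp ha
    refine h.dep (hinS ws hws) (by simpa using hl) (hp.map vv) ?_
    simp only [List.map_cons, hvv0]
    refine sub_mem (add_mem (mem_adj _ (by simp)) (hspan r a ha)) (smul_mem _ _ (le_adj _ _ ‹_›))
  · intro ws hws hl a b r hp hc
    refine h.goodpair (hinS ws hws) (by simpa using hl) (hp.map vv) ?_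
    have hm : ∀ v ∈ a :: b :: r, v ∈ U := fun v hv => hws v (hp.symm.subset hv)
    intro v hv
    obtain ⟨w, hw, rfl⟩ := List.mem_map.1 hv
    rw [hvvB a (hm a (by simp)) w (hm w (by simp [hw])), hvvB b (hm b (by simp)) w (hm w (by simp [hw])), hc w hw]
  · intro r hr hlr u hu n hn hQu hQn hun
    have hrU : span F {v | v ∈ r} ≤ U := span_le.2 hr
    simp only [List.map_cons, hvv0]
    refine h.F2 _ ?_ (by simp [hlr]) ?_
    · have := hinS (0 :: r) (by
        intro v hv
        rcases List.mem_cons.1 hv with rfl | hv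
        · exact zero_mem _
        · exact hr v hv)
      simpa only [List.map_cons, hvv0] using this
    · refine Hyp.strict (T := T) (m := m) ?_ (x := (u, n)) ⟨hQu, hQn, hun, (hrU hu).2, (hrU hn).2⟩
        (hspan r u hu) (hspan r n hn) ?_ (h.hyp v0 hv0)
      · rw [adj_cons]; exact le_adj _ _
      · have := hrank (r.map vv)
        simp at this; omega
end P2
end OV

set_option linter.unusedSectionVars false
namespace OV
open Submodule
section R1
variable {F V Γ Y k : Type*} [Field F] [AddCommGroup V] [Module F V] [Group Γ] [DistribMulAction Γ V]
  [SMulCommClass Γ F V] [MulAction Γ Y] [Field k]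

/-- faithful isometric actions containing all reflections -/
structure GoodA (Q : QuadraticForm F V) (Γ : Type*) [Group Γ] [DistribMulAction Γ V] [SMulCommClass Γ F V] : Prop where
  isom : ∀ (g : Γ) v, Q (g • v) = Q v
  refl : ∀ a (ha : Q a ≠ 0), ∃ g : Γ, ∀ v, g • v = refl Q a ha v
  faithful : ∀ g h : Γ, (∀ v : V, g • v = h • v) → g = h
  two : (2 : F) ≠ 0

variable {Q : QuadraticForm F V}

variable (F V Γ) in
/-- image of the group -/
def img : Subgroup (V ≃ₗ[F] V) := (DistribMulAction.toModuleAut F V : Γ →* (V ≃ₗ[F] V)).range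
lemma mem_img (g : Γ) : DistribMulAction.toModuleAut F V g ∈ img F V Γ := ⟨g, rfl⟩

lemma GoodA.good (h : GoodA Q Γ) : Good Q (img F V Γ) where
  isom := by
    rintro _ ⟨g, rfl⟩ v
    exact h.isom g v
  refl a ha := by
    obtain ⟨g, hg⟩ := h.refl a ha
    refine ⟨g, LinearEquiv.ext fun v => ?_⟩
    exact hg v

lemma GoodA.bl (h : GoodA Q Γ) (g : Γ) (v w : V) : bl Q (g • v) (g • w) = bl Q v w :=
  h.good.bl (mem_img g) v w

lemma GoodA.bl' (h : GoodA Q Γ) (g : Γ) (v w : V) : OV.bl Q (g • v) w = OV.bl Q v (g⁻¹ • w) := by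
  rw [← h.bl g v, smul_inv_smul]

lemma GoodA.swap (hG : GoodA Q Γ) {Z Y : Submodule F V}
    [FiniteDimensional F Z] (hZ : Nd Q Z) (hY : Y ≤ Z) {d : V} (hd : d ∈ Z) (hdY : d ∈ perp Q Y) (hdn : d ∉ Y) :
    ∃ g : Γ, (∀ y ∈ Y, g • y = y) ∧ (∀ w ∈ perp Q Z, g • w = w) ∧
      (∀ h : Γ, (∀ z ∈ Z, h • z = z) → g * h = h * g) ∧ g • d = -d := by
  obtain ⟨_, ⟨g, rfl⟩, h1, h2, h3, h4⟩ := swap_lemma hG.good hZ hY hd hdY hdn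
  refine ⟨g, h1, h2, fun h hh => hG.faithful _ _ fun v => ?_, h4⟩
  rw [mul_smul, mul_smul]
  exact h3 _ (mem_img h) hh v

variable (Γ) in
/-- pointwise fixer of a subspace -/
def fx (Z : Submodule F V) : Subgroup Γ where
  carrier := {g | ∀ z ∈ Z, g • z = z}
  mul_mem' ha hb z hz := by rw [mul_smul, hb z hz, ha z hz]
  one_mem' z _ := one_smul _ _
  inv_mem' ha z hz := by rw [inv_smul_eq_iff, ha z hz]
lemma mem_fx {Z : Submodule F V} {g : Γ} : g ∈ fx Γ Z ↔ ∀ z ∈ Z, g • z = z := Iff.rfl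
lemma fx_anti {Z Z' : Submodule F V} (h : Z ≤ Z') : fx Γ Z' ≤ fx Γ Z := fun _ hg z hz => hg z (h hz)
lemma mem_fx_sup_span {Z : Submodule F V} {S : Set V} {g : Γ} :
    g ∈ fx Γ (Z ⊔ span F S) ↔ g ∈ fx Γ Z ∧ ∀ s ∈ S, g • s = s := by
  constructor
  · intro h
    exact ⟨fun z hz => h z (mem_sup_left hz), fun s hs => h s (mem_sup_right (subset_span hs))⟩
  · rintro ⟨h1, h2⟩ z hz
    have : Z ⊔ span F S ≤ LinearMap.eqLocus (DistribSMul.toLinearMap F V g) LinearMap.id := by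
      refine sup_le (fun z hz => h1 z hz) (span_le.2 fun s hs => h2 s hs)
    exact this hz
lemma stabL_fx (Z : Submodule F V) (σ : List V) : stabL (fx Γ Z) σ = fx Γ (adj Z σ) := by
  ext g
  rw [mem_stabL, adj, mem_fx_sup_span, smul_list_eq_self]
  rfl
lemma fx_bot : fx Γ (⊥ : Submodule F V) = ⊤ := by
  ext g; simp [mem_fx]

/-- the set of hyperbolic pairs -/
def XH (Q : QuadraticForm F V) (Z : Submodule F V) : Set (V × V) := {x | HP Q Z x}

lemma GoodA.perp_smul (hG : GoodA Q Γ) {Z : Submodule F V} {g : Γ} (hg : g ∈ fx Γ Z) {v : V} (hv : v ∈ perp Q Z) :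
    g • v ∈ perp Q Z := fun z hz => by
  rw [hG.bl', (fx Γ Z).inv_mem hg z hz, hv z hz]

lemma GoodA.XH_smul (hG : GoodA Q Γ) {Z : Submodule F V} : ∀ g ∈ fx Γ Z, ∀ x ∈ XH Q Z, g • x ∈ XH Q Z := by
  rintro g hg x ⟨h1, h2, h3, h4, h5⟩
  exact ⟨by rw [Prod.smul_fst, hG.isom, h1], by rw [Prod.smul_snd, hG.isom, h2],
    by rw [Prod.smul_fst, Prod.smul_snd, hG.bl, h3], hG.perp_smul hg h4, hG.perp_smul hg h5⟩

lemma XH_anti {Z Z' : Submodule F V} (h : Z ≤ Z') : XH Q Z' ⊆ XH Q Z := fun _ hx => HP.mono h hx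

/-- admissible simplices -/
def okV (Q : QuadraticForm F V) (Z : Submodule F V) (S : Set V) (σ : List V) (t : Option (V × V)) : Prop :=
  (∀ v ∈ σ, v ∈ S) ∧ ∀ x, t = some x → HP Q (adj Z σ) x

lemma Xs_okV {Z : Submodule F V} {S : Set V} {σ : List V} (hσ : ∀ v ∈ σ, v ∈ S) :
    Xs (okV Q Z S) σ = XH Q (adj Z σ) := by
  ext x
  simp only [Xs, okV, XH, Set.mem_ofPred_eq]
  constructor
  · rintro ⟨_, h⟩; exact h x rfl
  · intro h; refine ⟨hσ, ?_⟩; rintro y ⟨⟩; exact h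

lemma HP_smul (hG : GoodA Q Γ) {Z : Submodule F V} {g : Γ} (hg : g ∈ fx Γ Z) {σ : List V} {x : V × V}
    (h : HP Q (adj Z σ) x) : HP Q (adj Z (g • σ)) (g • x) := by
  obtain ⟨h1, h2, h3, h4, h5⟩ := h
  have key : ∀ v, v ∈ perp Q (adj Z σ) → g • v ∈ perp Q (adj Z (g • σ)) := by
    intro v hv
    rw [adj, mem_perp_sup_span] at hv ⊢
    refine ⟨hG.perp_smul hg hv.1, ?_⟩
    intro s hs
    obtain ⟨b, hb, rfl⟩ := (mem_smul_list _ _ _).1 hs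
    rw [hG.bl]; exact hv.2 b hb
  exact ⟨by rw [Prod.smul_fst, hG.isom, h1], by rw [Prod.smul_snd, hG.isom, h2],
    by rw [Prod.smul_fst, Prod.smul_snd, hG.bl, h3], key _ h4, key _ h5⟩

lemma okV_data (hG : GoodA Q Γ) {Z : Submodule F V} {S : Set V} (hS : ∀ g ∈ fx Γ Z, ∀ v ∈ S, g • v ∈ S) :
    OkData (fx Γ Z) (okV Q Z S) where
  none_of_some σ x h := ⟨h.1, fun y hy => by simp at hy⟩
  sub σ σ' t hs h := ⟨fun v hv => h.1 v (hs.subset hv), fun x hx => (h.2 x hx).mono (adj_mono le_rfl hs.subset)⟩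
  equi g hg σ t h := by
    refine ⟨fun v hv => ?_, ?_⟩
    · obtain ⟨b, hb, rfl⟩ := (mem_smul_list _ _ _).1 hv
      exact hS g hg b (h.1 b hb)
    · rintro x hx
      rcases t with _ | y
      · simp at hx
      · simp only [smul_opt_some, Option.some.injEq] at hx
        subst hx
        exact HP_smul hG hg (h.2 y rfl)

variable (Q Γ Y k) in
/-- claim (a) -/
def PA (q : ℕ) : Prop := ∀ Z : Submodule F V, Hyp Q Z (q + 1) → ∀ f : List Y → Option (V × V) → k,
  IsR (fx Γ Z) (XH Q Z) q f → D (XH Q Z) f = 0 → Cob (fx Γ Z) (XH Q Z) q f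

variable (Q Γ Y k) in
/-- claim (b) -/
def PB (q : ℕ) : Prop := ∀ (Z : Submodule F V) (g : ℕ), q ≤ g → Hyp Q Z g → ∀ f : List Y → Option (V × V) → k,
  IsR (fx Γ Z) (XH Q Z) q f → D (XH Q Z) f = 0 →
  (∀ Z', Z ≤ Z' → Nd Q Z' → Hyp Q Z' g → Cob (fx Γ Z') (XH Q Z') q (cut (XH Q Z') f)) → Cob (fx Γ Z) (XH Q Z) q f

lemma eps_cut {A : Type*} (X : Set (V × V)) (σ : List A) (c : List A → List Y → Option (V × V) → k) :
    eps σ (fun σ' => cut X (c σ')) = cut X (eps σ c) := eps_hom (cut X).toAddMonoidHom σ c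

lemma vert [FiniteDimensional F V] (hG : GoodA Q Γ) (h2k : (2 : k) ≠ 0) {Z : Submodule F V} {S : Set V}
    (hS : ∀ g ∈ fx Γ Z, ∀ v ∈ S, g • v ∈ S)
    {j m : ℕ} (hA : PA Γ Y k Q j) (hB : PB Γ Y k Q j)
    (hiso : ∀ v ∈ S, Q v = 0) (hpair : ∀ a ∈ S, ∀ b ∈ S, ∀ z ∈ Z, bl Q a z = bl Q b z)
    (hhyp : ∀ v ∈ S, Hyp Q (Z ⊔ span F {v}) (j + 1 + m))
    (hconc : ∀ Z', ∀ Φ : List V → ((List Y → Option (V × V) → k) ⧸ (CobS (fx Γ Z') (XH Q Z') j : Submodule k (List Y → Option (V × V) → k))),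
      PhiData Q (img F V Γ) Z Z' {v | v ∈ S ∧ v ∈ Z'} j m Φ → ∀ ρ : List V, (∀ v ∈ ρ, v ∈ S ∧ v ∈ Z') → ρ.length = m + 2 → Φ ρ = 0)
    {c : List V → List Y → Option (V × V) → k} (hc : IsK (fx Γ Z) (okV Q Z S) j (m + 2) c)
    (hd : dK (okV Q Z S) c = 0) (he : eK (okV Q Z S) c = 0) (σ : List V) (hσ : σ.length = m + 2)
    (hok : okV Q Z S σ none) : Cob (stabL (fx Γ Z) σ) (Xs (okV Q Z S) σ) j (c σ) := by
  have hcR : ∀ σ, (∀ v ∈ σ, v ∈ S) → IsR (fx Γ (adj Z σ)) (XH Q (adj Z σ)) j (c σ) ∧ D (XH Q (adj Z σ)) (c σ) = 0 := by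
    intro σ hσ
    have h1 := hc.isR (okV_data hG hS) σ
    rw [stabL_fx, Xs_okV hσ] at h1
    refine ⟨h1, ?_⟩
    have := congrFun hd σ
    rw [dK, Xs_okV hσ] at this
    exact this
  rw [stabL_fx, Xs_okV hok.1]
  obtain ⟨h1, h2⟩ := hcR σ hok.1
  have hhσ : Hyp Q (adj Z σ) j := by
    rcases σ with _ | ⟨v, σ⟩
    · simp at hσ
    · rw [adj_cons]
      have h3 := hhyp v (hok.1 v (by simp))
      rw [show j + 1 + m = j + (m + 1) by ring] at h3
      refine h3.drop (le_adj _ _) ?_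
      have := finrank_adj σ (Z ⊔ span F {v})
      simp at hσ
      omega
  refine hB _ j le_rfl hhσ _ h1 h2 fun Z' hZ' hnd _ => ?_
  rw [← mem_CobS, ← Submodule.Quotient.mk_eq_zero]
  let Φ : List V → ((List Y → Option (V × V) → k) ⧸ (CobS (fx Γ Z') (XH Q Z') j : Submodule k (List Y → Option (V × V) → k))) :=
    fun ρ => Submodule.Quotient.mk (cut (XH Q Z') (c ρ))
  have hle : ∀ ρ : List V, (∀ v ∈ ρ, v ∈ S ∧ v ∈ Z') → adj Z ρ ≤ Z' := fun ρ hρ =>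
    adj_le.2 ⟨(le_adj _ _).trans hZ', fun v hv => (hρ v hv).2⟩
  have hphi : PhiData Q (img F V Γ) Z Z' {v | v ∈ S ∧ v ∈ Z'} j m Φ := by
    refine ⟨hG.good, hnd, (le_adj _ _).trans hZ', fun v hv => hv.2, fun v hv => hiso v hv.1,
      fun a ha b hb => hpair a ha.1 b hb.1, fun v hv => hhyp v hv.1, ?_, ?_, ?_, ?_, hG.two⟩
    · intro ρ hρ hl
      have h3 : eps ρ Φ = Submodule.Quotient.mk (cut (XH Q Z') (eps ρ c)) := by
        rw [← eps_cut]
        exact eps_hom (Submodule.mkQ (CobS (fx Γ Z') (XH Q Z') j : Submodule k (List Y → Option (V × V) → k))).toAddMonoidHom ρ (fun σ' => cut (XH Q Z') (c σ'))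
      rw [h3]
      have h4 : cut (XH Q Z') (eps ρ c) = 0 := by
        funext l t
        have h5 : ∀ t, okV Q Z S ρ t → eps ρ c l t = 0 := fun t ht => by
          have := congrFun (congrFun (congrFun he ρ) l) t
          rw [eK_pos _ _ ht] at this
          rw [eps_apply, eps_apply]; exact this
        rcases t with _ | x
        · rw [cut_none]; exact h5 _ ⟨fun v hv => (hρ v hv).1, fun y hy => by simp at hy⟩
        · by_cases hx : x ∈ XH Q Z'
          · rw [cut_some _ _ hx]
            refine h5 _ ⟨fun v hv => (hρ v hv).1, ?_⟩
            rintro y ⟨⟩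
            exact HP.mono (hle ρ hρ) hx
          · rw [cut_some_not _ _ hx]; rfl
      rw [h4]; rfl
    · intro ρ hρ hl hh
      obtain ⟨h3, h4⟩ := hcR ρ (fun v hv => (hρ v hv).1)
      have h5 := (hA _ hh _ h3 h4).cut (fx_anti (hle ρ hρ)) (XH_anti (hle ρ hρ)) hG.XH_smul
      exact (Submodule.Quotient.mk_eq_zero _).2 h5
    · rintro _ ⟨g, rfl⟩ g1 g2 g3 ρ hρ hl
      have g3' : ∀ h ∈ fx Γ Z', g * h = h * g := fun h hh => hG.faithful _ _ fun v => by
        rw [mul_smul, mul_smul]; exact g3 _ (mem_img h) hh v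
      refine (Submodule.Quotient.eq _).2 ?_
      obtain ⟨h3, h4⟩ := hcR ρ (fun v hv => (hρ v hv).1)
      have h5 := h3.cut (fx_anti (hle ρ hρ)) (hG.XH_smul (Z := Z'))
      have h6 : D (XH Q Z') (cut (XH Q Z') (c ρ)) = 0 := by
        rw [cut_D (XH_anti (hle ρ hρ)), h4, map_zero]
      have h7 := prism_cob (θ := fun y => g⁻¹ • y) (fun h hh y => by
        show g⁻¹ • h • y = h • g⁻¹ • y
        rw [inv_smul_eq_iff, ← mul_smul, ← mul_smul, g3' h hh, mul_assoc, mul_inv_cancel, mul_one]) h5 h6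
      rw [mem_CobS]
      convert h7 using 1
      funext l t
      have hmap : (ρ.map fun v => g • v) = g • ρ := rfl
      have hl : ∀ t, g • t = t → c (ρ.map fun v => g • v) l t = c ρ (l.map fun y => g⁻¹ • y) t := by
        intro t ht
        have := hc.inv g g1 ρ (g⁻¹ • l) t
        rw [smul_inv_smul, ht] at this
        rw [hmap, this]; rfl
      show cut _ (c (ρ.map fun v => g • v)) l t - cut _ (c ρ) l t = _
      rcases t with _ | x
      · simp only [cut_none, hl none rfl]
      · by_cases hx : x ∈ XH Q Z'
        · simp only [cut_some _ _ hx]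
          rw [hl]
          rw [smul_opt_some]
          congr 1
          exact Prod.ext (g2 _ hx.2.2.2.1) (g2 _ hx.2.2.2.2)
        · simp only [cut_some_not _ _ hx]
    · intro x hx
      have : (2 : k) • x = 0 := by rw [two_smul]; exact hx
      exact (smul_eq_zero.1 this).resolve_left h2k
  exact hconc Z' Φ hphi σ (fun v hv => ⟨hok.1 v hv, hZ' (mem_adj _ hv)⟩) hσ
end R1
end OV

set_option linter.unusedSectionVars false
namespace OV
open Submodule
section R2
variable {F V Γ Y k : Type*} [Field F] [AddCommGroup V] [Module F V] [Group Γ] [DistribMulAction Γ V]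
  [SMulCommClass Γ F V] [MulAction Γ Y] [Field k] {Q : QuadraticForm F V}

lemma zigR [FiniteDimensional F V] (hG : GoodA Q Γ) (h2k : (2 : k) ≠ 0)
    (hfree : ∀ (g : Γ) (y : Y), g • y = y → g = 1) {Z : Submodule F V} {S : Set V}
    (hS : ∀ g ∈ fx Γ Z, ∀ v ∈ S, g • v ∈ S) {q : ℕ}
    (hA : ∀ j < q, PA Γ Y k Q j) (hB : ∀ j < q, PB Γ Y k Q j)
    (hiso : ∀ v ∈ S, Q v = 0) (hpair : ∀ a ∈ S, ∀ b ∈ S, ∀ z ∈ Z, bl Q a z = bl Q b z)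
    (hhyp : ∀ v ∈ S, Hyp Q (Z ⊔ span F {v}) q)
    (hconc : ∀ j m, j + 1 + m = q → ∀ Z', ∀ Φ : List V → ((List Y → Option (V × V) → k) ⧸ (CobS (fx Γ Z') (XH Q Z') j : Submodule k (List Y → Option (V × V) → k))),
      PhiData Q (img F V Γ) Z Z' {v | v ∈ S ∧ v ∈ Z'} j m Φ → ∀ ρ : List V, (∀ v ∈ ρ, v ∈ S ∧ v ∈ Z') → ρ.length = m + 2 → Φ ρ = 0)
    (hc1 : S.Nonempty) (hc2 : ∀ x, HP Q Z x → ∃ v ∈ S, bl Q x.1 v = 0 ∧ bl Q x.2 v = 0)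
    {f : List Y → Option (V × V) → k} (hf : IsR (fx Γ Z) (XH Q Z) q f) (hdf : D (XH Q Z) f = 0)
    (hv : ∀ v ∈ S, Cob (fx Γ (Z ⊔ span F {v})) (XH Q (Z ⊔ span F {v})) q (cut (XH Q (Z ⊔ span F {v})) f)) :
    Cob (fx Γ Z) (XH Q Z) q f := by
  have hok := okV_data hG hS
  have hX : Xs (okV Q Z S) [] = XH Q Z := by rw [Xs_okV (by simp), adj_nil]
  have hnil : okV Q Z S [] none := ⟨by simp, by simp⟩
  have hrow : RowEx (fx Γ Z) (okV Q Z S) Y k := by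
    refine coneEx hok hnil hfree ?_
    rintro (_ | x) ht
    · obtain ⟨v, hv⟩ := hc1
      refine ⟨v, fun σ hσ => ⟨?_, by simp⟩⟩
      intro w hw
      rcases List.mem_cons.1 hw with rfl | hw
      · exact hv
      · exact hσ.1 w hw
    · have hx := ht.2 x rfl
      rw [adj_nil] at hx
      obtain ⟨v, hv, h1, h2⟩ := hc2 x hx
      refine ⟨v, fun σ hσ => ⟨?_, ?_⟩⟩
      · intro w hw
        rcases List.mem_cons.1 hw with rfl | hw
        · exact hv
        · exact hσ.1 w hw
      · rintro _ ⟨⟩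
        obtain ⟨a1, a2, a3, a4, a5⟩ := hσ.2 x rfl
        refine ⟨a1, a2, a3, ?_, ?_⟩
        · rw [adj, mem_perp_sup_span] at a4 ⊢
          refine ⟨a4.1, fun s hs => ?_⟩
          rcases List.mem_cons.1 hs with rfl | hs
          · exact h1
          · exact a4.2 s hs
        · rw [adj, mem_perp_sup_span] at a5 ⊢
          refine ⟨a5.1, fun s hs => ?_⟩
          rcases List.mem_cons.1 hs with rfl | hs
          · exact h2
          · exact a5.2 s hs
  rw [← hX] at hf hdf ⊢
  refine zigzag hok hnil hrow q ?_ ?_ f hf hdf ?_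
  · intro c hq hc hd he
    have hq' : 0 < q := by omega
    obtain ⟨m, rfl⟩ : ∃ m, q = m + 1 := ⟨q - 1, by omega⟩
    have : c = 0 := by
      funext σ
      by_cases hσ : σ.length = m + 2 ∧ okV Q Z S σ none
      · exact vert hG h2k hS (hA 0 hq') (hB 0 hq') hiso hpair (m := m) (fun v hv => by
          rw [show 0 + 1 + m = m + 1 by ring]; exact hhyp v hv) (hconc 0 m (by ring)) hc hd he σ hσ.1 hσ.2
      · funext l t
        by_contra hne
        obtain ⟨b1, b2, _⟩ := hc.supp σ l t hne
        apply hσ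
        refine ⟨b2, ?_⟩
        rcases t with _ | x
        · exact b1
        · exact hok.none_of_some _ _ b1
    exact ⟨0, IsK.zero, dK_zero, by rw [this]; exact eK_zero⟩
  · intro j P c hP hjP hc hd he
    obtain ⟨m, rfl⟩ : ∃ m, P = m + 2 := ⟨P - 2, by omega⟩
    have hj : j + 1 < q := by omega
    refine W2 hok hc fun σ hσ hok' => ?_
    exact vert hG h2k hS (hA _ hj) (hB _ hj) hiso hpair (m := m) (fun v hv => by
          rw [show j + 1 + 1 + m = q by omega]; exact hhyp v hv) (hconc (j + 1) m (by omega)) hc hd he σ hσ hok'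
  · intro v hv'
    rw [stabL_fx, Xs_okV hv'.1, adj_single]
    exact hv v (hv'.1 v (by simp))

/-- radical vectors are isotropic -/
lemma rad_iso (h2 : (2 : F) ≠ 0) {Z : Submodule F V} {l : V} (hl : l ∈ Z) (hl2 : l ∈ perp Q Z) : Q l = 0 := by
  have := hl2 l hl
  rw [bl_self] at this
  exact (mul_eq_zero.1 this).resolve_left h2

lemma ex_dual (hV : perp Q ⊤ = ⊥) {l : V} (hl : l ≠ 0) : ∃ v, bl Q v l = 1 := by
  by_contra hne
  apply hl
  have : l ∈ perp Q ⊤ := fun z _ => by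
    by_contra hz
    apply hne
    refine ⟨(bl Q l z)⁻¹ • z, ?_⟩
    rw [map_smul, LinearMap.smul_apply, bl_comm z l, smul_eq_mul, inv_mul_cancel₀ hz]
  rw [hV] at this
  simpa using this

lemma rad_lt [FiniteDimensional F V] {Z : Submodule F V} {l v : V} (hl : l ∈ Z) (hl2 : l ∈ perp Q Z) (hv : bl Q v l ≠ 0) :
    Module.finrank F ↥((Z ⊔ span F {v}) ⊓ perp Q (Z ⊔ span F {v})) < Module.finrank F ↥(Z ⊓ perp Q Z) := by
  apply finrank_lt_finrank_of_lt
  refine lt_of_le_of_ne ?_ ?_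
  · rintro w ⟨hw1, hw2⟩
    obtain ⟨z, hz, y, hy, rfl⟩ := mem_sup.1 hw1
    obtain ⟨c, rfl⟩ := mem_span_singleton.1 hy
    have h1 := hw2 l (mem_sup_left hl)
    have h2 : bl Q z l = 0 := by rw [bl_comm]; exact hl2 z hz
    simp only [map_add, LinearMap.add_apply, h2, map_smul, LinearMap.smul_apply, smul_eq_mul, zero_add] at h1
    have h3 : c = 0 := (mul_eq_zero.1 h1).resolve_right hv
    subst h3
    simp only [zero_smul, add_zero] at hw2 ⊢
    exact ⟨hz, perp_anti le_sup_left hw2⟩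
  · intro heq
    have : l ∈ Z ⊓ perp Q Z := ⟨hl, hl2⟩
    rw [← heq] at this
    have := this.2 v (mem_sup_single _ _)
    rw [bl_comm] at this
    exact hv this

/-- isotropic vectors with a prescribed pairing, orthogonal to a hyperbolic pair -/
lemma fix_vec {Z : Submodule F V} {l v : V} (hlp : l ∈ perp Q Z) (hQl : Q l = 0)
    (hvl : bl Q v l = 1) (hl : l ∈ Z) {x : V × V} (hx : HP Q Z x) :
    ∃ w, Q w = 0 ∧ (∀ z ∈ Z, bl Q w z = bl Q v z) ∧ bl Q x.1 w = 0 ∧ bl Q x.2 w = 0 := by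
  obtain ⟨x1, x2⟩ := x
  obtain ⟨h1, h2, h3, h4, h5⟩ := hx
  simp only at h1 h2 h3 h4 h5 ⊢
  set u := v - bl Q v x2 • x1 - bl Q v x1 • x2 with hu
  have hx1x1 : bl Q x1 x1 = 0 := by rw [bl_self, h1, mul_zero]
  have hx2x2 : bl Q x2 x2 = 0 := by rw [bl_self, h2, mul_zero]
  have hul : bl Q u l = 1 := by
    simp [hu, hvl, h4 l hl, h5 l hl]
  have hlx1 : bl Q x1 l = 0 := h4 l hl
  have hlx2 : bl Q x2 l = 0 := h5 l hl
  refine ⟨u - Q u • l, ?_, ?_, ?_, ?_⟩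
  · rw [Q_sub, Q_smul, hQl, map_smul, hul]; simp
  · intro z hz
    simp [hu, h4 z hz, h5 z hz, hlp z hz]
  · simp [hu, hlx1, hx1x1, h3, bl_comm x1 v]
  · simp [hu, hlx2, hx2x2, h3, bl_comm x2 v, bl_comm x2 x1]

lemma PB_step [FiniteDimensional F V] [Finite F] (hV : perp Q ⊤ = ⊥) (hG : GoodA Q Γ) (h2k : (2 : k) ≠ 0)
    (hfree : ∀ (g : Γ) (y : Y), g • y = y → g = 1) {q : ℕ}
    (hA : ∀ j < q, PA Γ Y k Q j) (hB : ∀ j < q, PB Γ Y k Q j) : PB Γ Y k Q q := by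
  intro Z g hg
  induction hr : Module.finrank F ↥(Z ⊓ perp Q Z) using Nat.strong_induction_on generalizing Z with
  | _ r ih =>
    intro hZ f hf hdf hcob
    by_cases hnd : Nd Q Z
    · have := hcob Z le_rfl hnd hZ
      rwa [hf.cut_self] at this
    · obtain ⟨l, ⟨hl, hlp⟩, hl0⟩ := Submodule.exists_mem_ne_zero_of_ne_bot hnd
      have hQl := rad_iso hG.two hl hlp
      obtain ⟨v, hvl⟩ := ex_dual hV hl0
      refine zigR hG h2k hfree (S := {w | Q w = 0 ∧ ∀ z ∈ Z, bl Q w z = bl Q v z}) ?_ hA hB (fun w hw => hw.1)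
        (fun a ha b hb z hz => by rw [ha.2 z hz, hb.2 z hz]) ?_ ?_ ?_ ?_ hf hdf ?_
      · rintro γ hγ w ⟨h1, h2⟩
        refine ⟨by rw [hG.isom, h1], fun z hz => ?_⟩
        rw [hG.bl', (fx Γ Z).inv_mem hγ z hz, h2 z hz]
      · rintro w ⟨h1, h2⟩
        refine Hyp.le hg (hZ.L2 hl hlp hQl ?_)
        rw [h2 l hl, hvl]; exact one_ne_zero
      · intro j m hjm Z' Φ hΦ ρ hρ hlen
        refine hΦ.concB (τ := fun z => bl Q v z) (l := l) (fun w => ?_) hl hlp hQl hvl hρ hlen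
        simp only [Set.mem_ofPred_eq]
        tauto
      · refine ⟨v - Q v • l, ?_, ?_⟩
        · rw [Q_sub, Q_smul, hQl, map_smul, hvl]; simp
        · intro z hz
          simp [hlp z hz]
      · intro x hx
        obtain ⟨w, h1, h2, h3, h4⟩ := fix_vec hlp hQl hvl hl hx
        exact ⟨w, ⟨h1, h2⟩, h3, h4⟩
      · rintro w ⟨h1, h2⟩
        have hwl : bl Q w l ≠ 0 := by rw [h2 l hl, hvl]; exact one_ne_zero
        refine ih _ (by rw [← hr]; exact rad_lt hl hlp hwl) _ rfl (hZ.L2 hl hlp hQl hwl) _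
          (hf.cut (fx_anti le_sup_left) hG.XH_smul) ?_ ?_
        · rw [cut_D (XH_anti le_sup_left), hdf, map_zero]
        · intro Z' hZ' hnd' hhyp'
          rw [cut_cut (XH_anti hZ')]
          exact hcob Z' (le_sup_left.trans hZ') hnd' hhyp'
end R2
end OV

set_option linter.unusedSectionVars false
namespace OV
open Submodule

lemma Pr_equiv2 {A B M : Type*} [AddCommGroup M] (θ : A → A) (θ' : B → B) (γ : A → B) (h : ∀ y, θ' (γ y) = γ (θ y)) (l : List A) :
    ∀ (f : List B → M), Pr θ' f (l.map γ) = Pr θ (fun l' => f (l'.map γ)) l := by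
  induction l with
  | nil => intro f; simp
  | cons a l ih =>
    intro f
    have h2 : θ' ∘ γ = γ ∘ θ := funext h
    simp only [List.map_cons, Pr_cons, ih]
    simp [h, h2]

section R3
variable {F V Γ Y k : Type*} [Field F] [AddCommGroup V] [Module F V] [Group Γ] [DistribMulAction Γ V]
  [SMulCommClass Γ F V] [MulAction Γ Y] [Field k] {Q : QuadraticForm F V}

/-- the swap of two hyperbolic pairs -/
def IsSw (Q : QuadraticForm F V) (x₀ x : V × V) (s : Γ) : Prop := ∀ v : V, s • v =
  v - (2⁻¹ * bl Q (x.1 - x₀.1 + (x.2 - x₀.2)) v) • (x.1 - x₀.1 + (x.2 - x₀.2))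
    + (2⁻¹ * bl Q (x.1 - x₀.1 - (x.2 - x₀.2)) v) • (x.1 - x₀.1 - (x.2 - x₀.2))

lemma sw_ex (hG : GoodA Q Γ) {x₀ x : V × V} (h0 : HP Q ⊥ x₀) (hx : HP Q ⊥ x)
    (h11 : bl Q x.1 x₀.1 = 0) (h12 : bl Q x.1 x₀.2 = 0) (h21 : bl Q x.2 x₀.1 = 0) (h22 : bl Q x.2 x₀.2 = 0) :
    ∃ s : Γ, IsSw Q x₀ x s ∧ s • x = x₀ ∧ s • x₀ = x := by
  obtain ⟨a, b⟩ := x₀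
  obtain ⟨e, f⟩ := x
  obtain ⟨p1, p2, p3, -, -⟩ := h0
  obtain ⟨q1, q2, q3, -, -⟩ := hx
  simp only at h11 h12 h21 h22 p1 p2 p3 q1 q2 q3
  have ee : bl Q e e = 0 := by rw [bl_self, q1, mul_zero]
  have ff : bl Q f f = 0 := by rw [bl_self, q2, mul_zero]
  have aa : bl Q a a = 0 := by rw [bl_self, p1, mul_zero]
  have bb : bl Q b b = 0 := by rw [bl_self, p2, mul_zero]
  have fe : bl Q f e = 1 := by rw [bl_comm]; exact q3
  have ba : bl Q b a = 1 := by rw [bl_comm]; exact p3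
  have ae : bl Q a e = 0 := by rw [bl_comm]; exact h11
  have be : bl Q b e = 0 := by rw [bl_comm]; exact h12
  have af : bl Q a f = 0 := by rw [bl_comm]; exact h21
  have bf : bl Q b f = 0 := by rw [bl_comm]; exact h22
  have Q1 : Q (e - a + (f - b)) = 2 := by
    rw [Q_add, Q_sub, Q_sub]
    simp [p1, p2, q1, q2, h11, h22, q3, p3, h12, af]; norm_num
  have Q2 : Q (e - a - (f - b)) = -2 := by
    rw [Q_sub, Q_sub, Q_sub]
    simp [p1, p2, q1, q2, h11, h22, q3, p3, h12, af]; norm_num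
  have h12' : bl Q (e - a + (f - b)) (e - a - (f - b)) = 0 := by
    simp [ee, ff, aa, bb, fe, ba, ae, be, af, bf, h11, h12, h21, h22, p3, q3]
  have h2 := hG.two
  obtain ⟨g1, hg1⟩ := hG.refl _ (show Q (e - a + (f - b)) ≠ 0 by rw [Q1]; exact h2)
  obtain ⟨g2, hg2⟩ := hG.refl _ (show Q (e - a - (f - b)) ≠ 0 by rw [Q2]; exact neg_ne_zero.2 h2)
  have hs : IsSw Q (a, b) (e, f) (g1 * g2) := by
    intro v
    rw [mul_smul, hg1, hg2, refl_apply, refl_apply, Q1, Q2]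
    show _ = v - (2⁻¹ * bl Q (e - a + (f - b)) v) • (e - a + (f - b)) + (2⁻¹ * bl Q (e - a - (f - b)) v) • (e - a - (f - b))
    generalize e - a + (f - b) = u1 at *
    generalize e - a - (f - b) = u2 at *
    rw [map_sub (bl Q u1), map_smul, h12']
    simp only [smul_zero, sub_zero, inv_neg, neg_mul, neg_smul, sub_neg_eq_add]
    abel
  refine ⟨g1 * g2, hs, Prod.ext ?_ ?_, Prod.ext ?_ ?_⟩
  all_goals
    simp only [Prod.smul_fst, Prod.smul_snd, hs _]
    simp only [map_sub, map_add, LinearMap.sub_apply, LinearMap.add_apply, ee, ff, aa, bb, fe, ba, ae, be, af, bf, h11, h12, h21, h22, p3, q3]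
    match_scalars <;> field_simp <;> norm_num

lemma IsSw.fix {Z : Submodule F V} {x₀ x : V × V} (h0 : HP Q Z x₀) (hx : HP Q Z x) {s : Γ} (hs : IsSw Q x₀ x s) :
    s ∈ fx Γ Z := by
  intro z hz
  rw [hs]
  simp [h0.2.2.2.1 z hz, h0.2.2.2.2 z hz, hx.2.2.2.1 z hz, hx.2.2.2.2 z hz]

lemma IsSw.conj (hG : GoodA Q Γ) {x₀ x : V × V} {h : Γ} (hh : h • x₀ = x₀) {s s' : Γ} (hs : IsSw Q x₀ x s)
    (hs' : IsSw Q x₀ (h • x) s') : s' * h = h * s := by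
  refine hG.faithful _ _ fun v => ?_
  have a1 : h • x₀.1 = x₀.1 := congrArg Prod.fst hh
  have a2 : h • x₀.2 = x₀.2 := congrArg Prod.snd hh
  have e1 : (h • x).1 - x₀.1 + ((h • x).2 - x₀.2) = h • (x.1 - x₀.1 + (x.2 - x₀.2)) := by
    rw [smul_add, smul_sub, smul_sub, a1, a2]; rfl
  have e2 : (h • x).1 - x₀.1 - ((h • x).2 - x₀.2) = h • (x.1 - x₀.1 - (x.2 - x₀.2)) := by
    rw [smul_sub, smul_sub, smul_sub, a1, a2]; rfl
  rw [mul_smul, mul_smul, hs', hs, e1, e2, hG.bl, hG.bl]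
  generalize x.1 - x₀.1 + (x.2 - x₀.2) = u1
  generalize x.1 - x₀.1 - (x.2 - x₀.2) = u2
  rw [smul_add, smul_sub, smul_comm h, smul_comm h]

lemma E2 (hG : GoodA Q Γ) (h2k : (2 : k) ≠ 0) {Z Z' : Submodule F V} (hZ : Z ≤ Z') {x₀ : V × V} (h0 : HP Q Z x₀)
    (h01 : x₀.1 ∈ Z') (h02 : x₀.2 ∈ Z') {q : ℕ} {f : List Y → Option (V × V) → k}
    (hf : IsR (fx Γ Z) (XH Q Z) (q + 1) f) (hd : D (XH Q Z) f = 0) :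
    Cob (fx Γ Z') (XH Q Z') (q + 1) (cut (XH Q Z') f) := by
  classical
  have hsw : ∀ x : V × V, ∃ s : Γ, x ∈ XH Q Z' → (IsSw Q x₀ x s ∧ s • x = x₀ ∧ s • x₀ = x) := by
    intro x
    by_cases hx : x ∈ XH Q Z'
    · obtain ⟨s, hs⟩ := sw_ex (Γ := Γ) hG (h0.mono bot_le) (HP.mono bot_le hx) (hx.2.2.2.1 _ h01) (hx.2.2.2.1 _ h02)
        (hx.2.2.2.2 _ h01) (hx.2.2.2.2 _ h02)
      exact ⟨s, fun _ => hs⟩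
    · exact ⟨1, fun h => absurd h hx⟩
  choose s hs using hsw
  have hx0 : ∀ h ∈ fx Γ Z', h • x₀ = x₀ := fun h hh => Prod.ext (hh _ h01) (hh _ h02)
  have hclosed : ∀ x ∈ XH Q Z, ∀ l, eps l (fun l' => f l' (some x)) = f l none := by
    intro x hx l
    have := congrFun (congrFun hd l) (some x)
    rw [D_some _ _ hx] at this
    exact (sub_eq_zero.1 this).symm
  let a : List Y → Option (V × V) → k := fun l t => if t = none then f l (some x₀) else 0
  have ha : IsR (fx Γ Z') (XH Q Z') q a := by
    refine ⟨fun h hh l t => ?_, fun t => ?_, fun l t hne => ?_⟩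
    · rcases t with _ | x
      · simp only [a, smul_opt_none, if_true]
        have := hf.inv h (fx_anti hZ hh) l (some x₀)
        rwa [smul_opt_some, hx0 h hh] at this
      · simp [a]
    · simp only [a]; split_ifs <;> simp [hf.nil]
    · rcases t with _ | x
      · refine ⟨by simp, ?_⟩
        have := (hf.supp l (some x₀) (by simpa [a] using hne)).2
        simpa using this
      · simp [a] at hne
  let β : V × V → List Y → k := fun x l => f l (some x) - f l (some x₀)
  have hβinv : ∀ h ∈ fx Γ Z', ∀ x l, β (h • x) (h • l) = β x l := by
    intro h hh x l
    have h1 := hf.inv h (fx_anti hZ hh) l (some x₀)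
    have h2 := hf.inv h (fx_anti hZ hh) l (some x)
    rw [smul_opt_some, hx0 h hh] at h1
    rw [smul_opt_some] at h2
    simp only [β, h1, h2]
  have hβs : ∀ x ∈ XH Q Z', ∀ l : List Y, β x (s x • l) = - β x l := by
    intro x hx l
    obtain ⟨a1, a2, a3⟩ := hs x hx
    have hsz := a1.fix h0 (XH_anti hZ hx)
    have h1 := hf.inv _ hsz l (some x₀)
    have h2 := hf.inv _ hsz l (some x)
    rw [smul_opt_some, a3] at h1
    rw [smul_opt_some, a2] at h2
    simp only [β, h1, h2]
    ring
  have hβd : ∀ x ∈ XH Q Z', ∀ l : List Y, eps l (β x) = 0 := by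
    intro x hx l
    simp only [β]
    rw [eps_sub, hclosed x (XH_anti hZ hx), hclosed x₀ h0, sub_self]
  have hβl : ∀ x l, β x l ≠ 0 → l.length = q + 1 := by
    intro x l hne
    by_cases h1 : f l (some x) = 0
    · have h2 : f l (some x₀) ≠ 0 := fun h => hne (by simp [β, h1, h])
      simpa using (hf.supp _ _ h2).2
    · simpa using (hf.supp _ _ h1).2
  let b : List Y → Option (V × V) → k := fun l t =>
    match t with
    | none => 0
    | some x => if x ∈ XH Q Z' then 2⁻¹ * Pr (fun y => s x • y) (β x) l else 0
  have hb : IsR (fx Γ Z') (XH Q Z') q b := by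
    refine ⟨fun h hh l t => ?_, fun t => ?_, fun l t hne => ?_⟩
    · rcases t with _ | x
      · rfl
      · simp only [b, smul_opt_some, ← setinv_iff hG.XH_smul hh x]
        by_cases hx : x ∈ XH Q Z'
        · rw [if_pos hx, if_pos hx]
          congr 1
          have hx' := hG.XH_smul h hh x hx
          rw [smul_list_def, Pr_equiv2 (fun y => s x • y) (fun y => s (h • x) • y) (fun y => h • y)]
          · congr 1
            funext l'
            exact hβinv h hh x l'
          · intro y
            show s (h • x) • h • y = h • s x • y
            rw [← mul_smul, ← mul_smul, (hs x hx).1.conj hG (hx0 h hh) (hs _ hx').1]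
        · rw [if_neg hx, if_neg hx]
    · rcases t with _ | x <;> simp [b]
    · rcases t with _ | x
      · exact absurd rfl hne
      · by_cases hx : x ∈ XH Q Z'
        · refine ⟨by rintro y ⟨⟩; exact hx, ?_⟩
          simp only [Option.isNone_some, Bool.false_eq_true, if_false, add_zero]
          by_contra hl
          apply hne
          simp only [b, if_pos hx]
          rw [Pr_congr _ l _ (fun _ => 0), Pr_zero, mul_zero]
          intro l' hl'
          by_contra hne'
          have := hβl x l' hne'
          omega
        · simp [b, hx] at hne
  refine ⟨a + b, ha.add hb, ?_⟩
  rw [D_add]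
  funext l t
  rcases t with _ | x
  · simp only [Pi.add_apply, D_none, cut_none]
    rw [show (fun l' => a l' none) = fun l' => f l' (some x₀) from rfl, hclosed x₀ h0,
      show (fun l' => b l' none) = fun l' => 0 from rfl, eps_zero, add_zero]
  · by_cases hx : x ∈ XH Q Z'
    · simp only [Pi.add_apply, D_some _ _ hx, cut_some _ _ hx]
      have e1 : (fun l' => a l' (some x)) = fun l' => 0 := by funext l'; simp [a]
      have e2 : (fun l' => b l' (some x)) = fun l' => (2⁻¹ : k) • Pr (fun y => s x • y) (β x) l' := by
        funext l'; simp [b, hx]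
      rw [e1, e2, eps_zero, eps_smul]
      have hp := prism' (fun y => s x • y) l (β x)
      simp only [hβd x hx, Pr_zero, add_zero] at hp
      have h3 := hβs x hx l
      rw [smul_list_def] at h3
      rw [hp, h3]
      simp only [a, b, if_true, smul_eq_mul, β]
      field_simp
      ring
    · simp [D_some_not _ _ hx, cut_some_not _ _ hx]

lemma PA_step [FiniteDimensional F V] [Finite F] (hG : GoodA Q Γ) (h2k : (2 : k) ≠ 0)
    (hfree : ∀ (g : Γ) (y : Y), g • y = y → g = 1) {q : ℕ}
    (hA : ∀ j < q, PA Γ Y k Q j) (hB : ∀ j ≤ q, PB Γ Y k Q j) : PA Γ Y k Q q := by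
  rcases q with _ | q
  · rintro Z ⟨x, hx, -⟩ f hf hd
    have hx : x ∈ XH Q Z := hx
    show f = 0
    have h1 : ∀ l x, f l (some x) = 0 := by
      intro l x
      by_contra hne
      have h2 := (hf.supp _ _ hne).2
      have : l = [] := by simpa using h2
      subst this
      exact hne (hf.nil _)
    funext l t
    rcases t with _ | y
    · have := congrFun (congrFun hd l) (some x)
      rw [D_some _ _ hx] at this
      simp only [h1, eps_zero, sub_zero] at this
      exact this
    · exact h1 l y
  · intro Z hZ f hf hd
    refine hB (q + 1) le_rfl Z (q + 2) (by omega) hZ f hf hd fun Z₁ hZ₁ hnd hhyp => ?_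
    have hf1 := hf.cut (fx_anti hZ₁) (hG.XH_smul (Z := Z₁))
    have hd1 : D (XH Q Z₁) (cut (XH Q Z₁) f) = 0 := by
      rw [cut_D (XH_anti hZ₁), hd, map_zero]
    generalize cut (XH Q Z₁) f = f₁ at hf1 hd1
    refine zigR hG h2k hfree (S := {w | w ≠ 0 ∧ Q w = 0 ∧ w ∈ perp Q Z₁}) ?_ hA (fun j hj => hB j hj.le)
      (fun w hw => hw.2.1) (fun a ha b hb z hz => by rw [ha.2.2 z hz, hb.2.2 z hz]) ?_ ?_ ?_ ?_ hf1 hd1 ?_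
    · rintro γ hγ w ⟨h0, h1, h2⟩
      exact ⟨(smul_ne_zero_iff_ne γ).2 h0, by rw [hG.isom, h1], hG.perp_smul hγ h2⟩
    · rintro w -
      exact hhyp.L1 w
    · intro j m hjm Z' Φ hΦ ρ hρ hlen
      refine hΦ.concA (fun w hw => hw.1.2.2) ?_ hρ hlen
      rw [show j + 1 + (m + 1) = q + 2 by omega]
      exact hhyp
    · obtain ⟨x, hx, -⟩ := hhyp
      refine ⟨x.1, ?_, hx.1, hx.2.2.2.1⟩
      intro h
      have := hx.2.2.1
      simp [h] at this
    · intro x hx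
      obtain ⟨y, hy, -⟩ := hhyp.L3 hx
      refine ⟨y.1, ⟨?_, hy.1, perp_anti le_sup_left hy.2.2.2.1⟩, ?_, ?_⟩
      · intro h
        have := hy.2.2.1
        simp [h] at this
      · rw [bl_comm]; exact hy.2.2.2.1 _ hx.mem_left
      · rw [bl_comm]; exact hy.2.2.2.1 _ hx.mem_right
    · rintro v ⟨h0, h1, h2⟩
      refine hB (q + 1) le_rfl _ (q + 1) le_rfl (hhyp.L1 v) _ (hf1.cut (fx_anti le_sup_left) hG.XH_smul) ?_ ?_
      · rw [cut_D (XH_anti le_sup_left), hd1, map_zero]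
      · intro Z' hZ' hnd' _
        rw [cut_cut (XH_anti hZ')]
        have hvZ' : v ∈ Z' := hZ' (mem_sup_single _ _)
        have hle : Z₁ ≤ Z' := le_sup_left.trans hZ'
        have hvZ : v ∉ Z₁ := fun h => h0 (hnd.eq_zero h h2)
        obtain ⟨d, hd', e1, e2⟩ := hnd'.sep hvZ' hvZ
        refine E2 hG h2k hle (x₀ := (v, d - Q d • v)) ⟨h1, ?_, ?_, h2, ?_⟩ hvZ' ?_ hf1 hd1
        · show Q (d - Q d • v) = 0
          rw [Q_sub, Q_smul, h1, map_smul, e2]; simp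
        · show bl Q v (d - Q d • v) = 1
          rw [map_sub, map_smul, bl_self, h1, bl_comm, e2]; simp
        · refine sub_mem (fun z hz => e1 z ⟨hz, hle hz⟩) (smul_mem _ _ h2)
        · exact sub_mem hd' (smul_mem _ _ hvZ')

theorem PA_all [FiniteDimensional F V] [Finite F] (hV : perp Q ⊤ = ⊥) (hG : GoodA Q Γ) (h2k : (2 : k) ≠ 0)
    (hfree : ∀ (g : Γ) (y : Y), g • y = y → g = 1) (q : ℕ) : PA Γ Y k Q q := by
  have : PA Γ Y k Q q ∧ PB Γ Y k Q q := by
    induction q using Nat.strong_induction_on with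
    | _ q ih =>
      have hB : PB Γ Y k Q q := PB_step hV hG h2k hfree (fun j hj => (ih j hj).1) (fun j hj => (ih j hj).2)
      refine ⟨PA_step hG h2k hfree (fun j hj => (ih j hj).1) (fun j hj => ?_), hB⟩
      rcases hj.lt_or_eq with h | rfl
      · exact (ih j h).2
      · exact hB
  exact this.1
end R3
end OV

set_option linter.unusedSectionVars false
namespace OV
open Submodule
section S1
variable {Γ Y k : Type*} [Group Γ] [MulAction Γ Y] [Field k]

/-- invariant homogeneous cochains of degree `q` -/
structure IsC (H : Subgroup Γ) (q : ℕ) (f : List Y → k) : Prop where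
  inv : ∀ h ∈ H, ∀ l, f (h • l) = f l
  supp : ∀ l, f l ≠ 0 → l.length = q + 1

/-- coboundaries of cochains of degree `q` -/
def CobC (H : Subgroup Γ) (q : ℕ) (f : List Y → k) : Prop := ∃ g : List Y → k, IsC H q g ∧ ∀ l, eps l g = f l

variable {H H' : Subgroup Γ} {q : ℕ} {f f' : List Y → k}

lemma IsC.zero' (hf : IsC H q f) {l : List Y} (h : l.length ≠ q + 1) : f l = 0 := by
  by_contra hne; exact h (hf.supp l hne)
lemma IsC.mono (h : H' ≤ H) (hf : IsC H q f) : IsC H' q f := ⟨fun g hg => hf.inv g (h hg), hf.supp⟩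
lemma IsC.add (hf : IsC H q f) (hf' : IsC H q f') : IsC H q (fun l => f l + f' l) where
  inv h hh l := by simp only [hf.inv h hh, hf'.inv h hh]
  supp l hl := by
    by_contra hne
    exact hl (by rw [hf.zero' hne, hf'.zero' hne, add_zero])
lemma IsC.smul (c : k) (hf : IsC H q f) : IsC H q (fun l => c * f l) where
  inv h hh l := by simp only [hf.inv h hh]
  supp l hl := hf.supp l (right_ne_zero_of_mul hl)
lemma IsC.sub (hf : IsC H q f) (hf' : IsC H q f') : IsC H q (fun l => f l - f' l) where
  inv h hh l := by simp only [hf.inv h hh, hf'.inv h hh]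
  supp l hl := by
    by_contra hne
    exact hl (by rw [hf.zero' hne, hf'.zero' hne, sub_zero])
lemma CobC.mono (h : H' ≤ H) (hf : CobC H q f) : CobC H' q f := by
  obtain ⟨g, h1, h2⟩ := hf
  exact ⟨g, h1.mono h, h2⟩
lemma CobC.add (hf : CobC H q f) (hf' : CobC H q f') : CobC H q (fun l => f l + f' l) := by
  obtain ⟨g, h1, h2⟩ := hf
  obtain ⟨g', h1', h2'⟩ := hf'
  exact ⟨_, h1.add h1', fun l => by rw [eps_add, h2, h2']⟩
lemma CobC.sub (hf : CobC H q f) (hf' : CobC H q f') : CobC H q (fun l => f l - f' l) := by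
  obtain ⟨g, h1, h2⟩ := hf
  obtain ⟨g', h1', h2'⟩ := hf'
  exact ⟨_, h1.sub h1', fun l => by rw [eps_sub, h2, h2']⟩

noncomputable def ev (f : List Y → k) : (List Y →₀ k) →ₗ[k] k := Finsupp.linearCombination k f
/-- boundary operator -/
noncomputable def bd : (List Y →₀ k) →ₗ[k] (List Y →₀ k) :=
  Finsupp.linearCombination k (fun l => eps l (fun l' => Finsupp.single l' 1))
lemma ev_single (f : List Y → k) (l : List Y) : ev f (Finsupp.single l 1) = f l := by simp [ev]
lemma bd_single (l : List Y) : bd (Finsupp.single l (1 : k)) = eps l (fun l' => Finsupp.single l' 1) := by simp [bd]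
lemma map_eps (ψ : (List Y →₀ k) →ₗ[k] k) (l : List Y) :
    ψ (bd (Finsupp.single l 1)) = eps l (fun l' => ψ (Finsupp.single l' 1)) := by
  rw [bd_single]
  exact (eps_hom ψ.toAddMonoidHom l _).symm
lemma ev_bd (f : List Y → k) (c : List Y →₀ k) : ev f (bd c) = ev (fun l => eps l f) c := by
  have : (ev f).comp bd = ev (fun l => eps l f) := by
    refine Finsupp.lhom_ext' fun l => LinearMap.ext_ring ?_
    simp only [LinearMap.comp_apply, Finsupp.lsingle_apply]
    rw [map_eps, ev_single]
    congr 1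
    funext l'; rw [ev_single]
  exact LinearMap.congr_fun this c

variable (Y k) in
/-- augmentation part -/
noncomputable def aug (H : Subgroup Γ) : Submodule k (List Y →₀ k) :=
  span k {c | ∃ g ∈ H, ∃ l : List Y, c = Finsupp.single (g • l) 1 - Finsupp.single l 1}
lemma aug_mono (h : H' ≤ H) : aug Y k H' ≤ aug Y k H := by
  refine span_mono ?_
  rintro _ ⟨g, hg, l, rfl⟩
  exact ⟨g, h hg, l, rfl⟩
lemma ev_aug (hf : ∀ h ∈ H, ∀ l, f (h • l) = f l) {c : List Y →₀ k} (hc : c ∈ aug Y k H) : ev f c = 0 := by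
  have : aug Y k H ≤ LinearMap.ker (ev f) := by
    refine span_le.2 ?_
    rintro _ ⟨g, hg, l, rfl⟩
    simp [ev_single, hf g hg]
  exact this hc
lemma aug_inv {ψ : (List Y →₀ k) →ₗ[k] k} (h : ∀ c ∈ aug Y k H, ψ c = 0) (g : Γ) (hg : g ∈ H) (l : List Y) :
    ψ (Finsupp.single (g • l) 1) = ψ (Finsupp.single l 1) := by
  have := h _ (subset_span ⟨g, hg, l, rfl⟩)
  rwa [map_sub, sub_eq_zero] at this

lemma CobC.ev_zero (hf : CobC H q f) {c : List Y →₀ k} (hc : bd c ∈ aug Y k H) : ev f c = 0 := by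
  obtain ⟨g, h1, h2⟩ := hf
  have : f = fun l => eps l g := funext fun l => (h2 l).symm
  rw [this, ← ev_bd]
  exact ev_aug h1.inv hc

lemma cob_of_ev (hs : ∀ l, f l ≠ 0 → l.length = q + 2) (h : ∀ c : List Y →₀ k, bd c ∈ aug Y k H → ev f c = 0) :
    CobC H q f := by
  have h1 : ev f ∈ LinearMap.range ((mkQ (aug Y k H)).comp (bd (Y := Y) (k := k))).dualMap := by
    rw [LinearMap.range_dualMap_eq_dualAnnihilator_ker, mem_dualAnnihilator]
    intro c hc
    refine h c ?_
    rw [LinearMap.mem_ker, LinearMap.comp_apply, mkQ_apply, Submodule.Quotient.mk_eq_zero] at hc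
    exact hc
  obtain ⟨ψ, hψ⟩ := h1
  let ψ' : (List Y →₀ k) →ₗ[k] k := ψ.comp (mkQ (aug Y k H))
  have h2 : ∀ c, ψ' (bd c) = ev f c := fun c => LinearMap.congr_fun hψ c
  have h3 : ∀ c ∈ aug Y k H, ψ' c = 0 := fun c hc => by
    show ψ (Submodule.Quotient.mk c) = 0
    rw [(Submodule.Quotient.mk_eq_zero _).2 hc, map_zero]
  classical
  refine ⟨fun l => if l.length = q + 1 then ψ' (Finsupp.single l 1) else 0, ⟨fun g hg l => ?_, fun l hl => ?_⟩, fun l => ?_⟩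
  · simp only [smul_list_length, aug_inv h3 g hg]
  · by_contra hne; simp [hne] at hl
  · by_cases hl : l.length = q + 2
    · rw [eps_congr l (g := fun l' => ψ' (Finsupp.single l' 1)), ← map_eps, h2, ev_single]
      intro l' hl1 hl2
      rw [if_pos]; omega
    · have hf0 : f l = 0 := by by_contra hne; exact hl (hs l hne)
      rw [hf0]
      apply eps_zero'
      intro l' hl1 hl2
      rw [if_neg]; omega

lemma aug_union {S : ℕ → Subgroup Γ} (hS : Monotone S) (hH : ∀ g ∈ H, ∃ n, g ∈ S n) (n₀ : ℕ) {c : List Y →₀ k}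
    (hc : c ∈ aug Y k H) : ∃ n, n₀ ≤ n ∧ c ∈ aug Y k (S n) := by
  induction hc using span_induction with
  | mem c hc =>
    obtain ⟨g, hg, l, rfl⟩ := hc
    obtain ⟨n, hn⟩ := hH g hg
    exact ⟨max n₀ n, le_max_left _ _, subset_span ⟨g, hS (le_max_right _ _) hn, l, rfl⟩⟩
  | zero => exact ⟨n₀, le_rfl, zero_mem _⟩
  | add x y _ _ hx hy =>
    obtain ⟨n, h1, h2⟩ := hx
    obtain ⟨m, h3, h4⟩ := hy
    exact ⟨max n m, h1.trans (le_max_left _ _), add_mem (aug_mono (hS (le_max_left _ _)) h2)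
      (aug_mono (hS (le_max_right _ _)) h4)⟩
  | smul a x _ hx =>
    obtain ⟨n, h1, h2⟩ := hx
    exact ⟨n, h1, smul_mem _ _ h2⟩

lemma cob_union {S : ℕ → Subgroup Γ} (hS : Monotone S) (hH : ∀ g ∈ H, ∃ n, g ∈ S n) (n₀ : ℕ)
    (hs : ∀ l, f l ≠ 0 → l.length = q + 2) (h : ∀ n, n₀ ≤ n → CobC (S n) q f) : CobC H q f := by
  refine cob_of_ev hs fun c hc => ?_
  obtain ⟨n, h1, h2⟩ := aug_union hS hH n₀ hc
  exact (h n h1).ev_zero h2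

/-- pullback along a prism -/
lemma cobC_prism {θ : Y → Y} (hθ : ∀ h ∈ H, ∀ y, θ (h • y) = h • θ y) (hf : IsC H (q + 1) f)
    (hd : ∀ l, eps l f = 0) : CobC H q (fun l => f (l.map θ) - f l) := by
  refine ⟨Pr θ f, ⟨fun h hh l => ?_, fun l hl => ?_⟩, fun l => ?_⟩
  · rw [smul_list_def, Pr_equiv θ (fun y => h • y) (hθ h hh)]
    congr 1
    funext l'
    exact hf.inv h hh l'
  · by_contra hne
    apply hl
    rw [Pr_congr _ l _ (fun _ => 0), Pr_zero]
    intro l' hl'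
    exact hf.zero' (by omega)
  · have := prism' θ l f
    simp only [hd, Pr_zero, add_zero] at this
    exact this
end S1

section Rc
variable {F V Γ Y k : Type*} [Field F] [AddCommGroup V] [Module F V] [Group Γ] [DistribMulAction Γ V]
  [SMulCommClass Γ F V] [MulAction Γ Y] [Field k] {Q : QuadraticForm F V}

/-- surjectivity part of stability, absolute form -/
lemma stab_step [FiniteDimensional F V] [Finite F] (hV : perp Q ⊤ = ⊥) (hG : GoodA Q Γ) (h2k : (2 : k) ≠ 0)
    (hfree : ∀ (g : Γ) (y : Y), g • y = y → g = 1) {q : ℕ} (hhyp : Hyp Q (⊥ : Submodule F V) (q + 2)) {x₀ : V × V}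
    (hx₀ : HP Q ⊥ x₀) {f : List Y → k} (hf : IsC (fx Γ (span F (prs x₀))) q f) (hd : ∀ l, eps l f = 0) :
    ∃ f' u : List Y → k, IsC (⊤ : Subgroup Γ) q f' ∧ (∀ l, eps l f' = 0) ∧
      (∀ h ∈ fx Γ (span F (prs x₀)), ∀ l, u (h • l) = u l) ∧ (∀ l, u l ≠ 0 → l.length = q) ∧ u [] = 0 ∧
      ∀ l, f l - f' l = eps l u := by
  classical
  let φ : List Y → Option (V × V) → k := fun l t =>
    match t with
    | none => 0
    | some x => if h : ∃ γ : Γ, x = γ • x₀ then f (h.choose⁻¹ • l) else 0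
  have key : ∀ (γ : Γ) l, φ l (some (γ • x₀)) = f (γ⁻¹ • l) := by
    intro γ l
    have hex : ∃ γ' : Γ, γ • x₀ = γ' • x₀ := ⟨γ, rfl⟩
    simp only [φ, dif_pos hex]
    have hch := hex.choose_spec
    generalize hex.choose = γ' at hch
    have hm : γ'⁻¹ * γ ∈ fx Γ (span F (prs x₀)) := by
      have h1 : (γ'⁻¹ * γ) • x₀ = x₀ := by rw [mul_smul, hch, inv_smul_smul]
      have := (mem_fx_sup_span (F := F) (Z := (⊥ : Submodule F V)) (S := prs x₀) (g := γ'⁻¹ * γ)).2 ⟨fun z hz => by simp [(mem_bot F).1 hz], by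
        rintro s (rfl | rfl)
        · exact congrArg Prod.fst h1
        · exact congrArg Prod.snd h1⟩
      rwa [bot_sup_eq] at this
    rw [← hf.inv _ hm (γ⁻¹ • l), ← mul_smul, mul_assoc, mul_inv_cancel, mul_one]
  have hφ0 : ∀ x, (¬ ∃ γ : Γ, x = γ • x₀) → ∀ l, φ l (some x) = 0 := by
    intro x hx l
    simp only [φ, dif_neg hx]
  have hR : IsR (fx Γ (⊥ : Submodule F V)) (XH Q ⊥) (q + 1) φ := by
    refine ⟨fun h _ l t => ?_, fun t => ?_, fun l t hne => ?_⟩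
    · rcases t with _ | x
      · rfl
      · rw [smul_opt_some]
        by_cases hx : ∃ γ : Γ, x = γ • x₀
        · obtain ⟨γ, rfl⟩ := hx
          rw [← mul_smul, key, key, ← mul_smul]
          congr 2; group
        · rw [hφ0 x hx, hφ0]
          rintro ⟨γ, hγ⟩
          exact hx ⟨h⁻¹ * γ, by rw [mul_smul, ← hγ, inv_smul_smul]⟩
    · rcases t with _ | x
      · rfl
      · by_cases hx : ∃ γ : Γ, x = γ • x₀
        · obtain ⟨γ, rfl⟩ := hx
          rw [key]; exact hf.zero' (by simp)
        · rw [hφ0 x hx]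
    · rcases t with _ | x
      · exact absurd rfl hne
      · by_cases hx : ∃ γ : Γ, x = γ • x₀
        · obtain ⟨γ, rfl⟩ := hx
          rw [key] at hne
          refine ⟨?_, by simpa using hf.supp _ hne⟩
          rintro _ ⟨⟩
          exact hG.XH_smul γ (by rw [fx_bot]; trivial) _ hx₀
        · rw [hφ0 x hx] at hne; exact absurd rfl hne
  have hD : D (XH Q ⊥) φ = 0 := by
    funext l t
    rcases t with _ | x
    · exact eps_zero l
    · by_cases hm : x ∈ XH Q ⊥
      · rw [D_some _ _ hm]
        by_cases hx : ∃ γ : Γ, x = γ • x₀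
        · obtain ⟨γ, rfl⟩ := hx
          simp only [key]
          have := hd (γ⁻¹ • l)
          rw [smul_list_def, eps_map] at this
          show 0 - _ = (0 : k)
          rw [zero_sub, neg_eq_zero]
          exact this
        · simp only [hφ0 x hx, eps_zero]
          exact sub_zero _
      · rw [D_some_not _ _ hm]; rfl
  obtain ⟨g, hg1, hg2⟩ := PA_all hV hG h2k hfree (q + 1) ⊥ hhyp φ hR hD
  refine ⟨fun l => g l none, fun l => - g l (some x₀), ⟨fun h _ l => ?_, fun l hl => ?_⟩, fun l => ?_, fun h hh l => ?_,
    fun l hl => ?_, ?_, fun l => ?_⟩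
  · exact hg1.inv h (by rw [fx_bot]; trivial) l none
  · simpa using (hg1.supp l none hl).2
  · exact congrFun (congrFun hg2 l) none
  · have h1 : h • x₀ = x₀ := Prod.ext (hh _ (subset_span (by simp [prs]))) (hh _ (subset_span (by simp [prs])))
    have := hg1.inv h (by rw [fx_bot]; trivial) l (some x₀)
    rw [smul_opt_some, h1] at this
    simp only [this]
  · simpa using (hg1.supp l (some x₀) (neg_ne_zero.1 hl)).2
  · simp only [hg1.nil, neg_zero]
  · have := congrFun (congrFun hg2 l) (some x₀)
    rw [D_some _ _ (show x₀ ∈ XH Q ⊥ from hx₀)] at this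
    have k1 := key 1 l
    rw [one_smul, inv_one, one_smul] at k1
    rw [eps_neg, ← k1, ← this]
    ring
end Rc
end OV

set_option linter.unusedSectionVars false
namespace OV
open Submodule
section S2
variable {F V Γ Y k : Type*} [Field F] [AddCommGroup V] [Module F V] [Group Γ] [DistribMulAction Γ V]
  [SMulCommClass Γ F V] [MulAction Γ Y] [Field k]

/-- infinite-dimensional hyperbolic setup -/
structure InfD (Q : QuadraticForm F V) (Γ : Type*) [Group Γ] [DistribMulAction Γ V] [SMulCommClass Γ F V]
    (E : ℕ → Submodule F V) : Prop where
  good : GoodA Q Γ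
  fd : ∀ n, FiniteDimensional F (E n)
  nd : ∀ n, Nd Q (E n)
  mono : Monotone E
  cover : ∀ v, ∃ n, v ∈ E n
  fixes : ∀ g : Γ, ∃ n, ∀ w ∈ perp Q (E n), g • w = w
  full : ∀ (φ : V ≃ₗ[F] V) (n : ℕ), (∀ v, Q (φ v) = Q v) → (∀ w ∈ perp Q (E n), φ w = w) → ∃ g : Γ, ∀ v, g • v = φ v
  hyp : ∀ n, ∃ x, HP Q (E n) x

variable {Q : QuadraticForm F V} {E : ℕ → Submodule F V}

lemma InfD.covers (hE : InfD Q Γ E) (A : Submodule F V) [FiniteDimensional F A] : ∃ n, A ≤ E n := by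
  have hA : A.FG := (fg_iff_finiteDimensional A).2 inferInstance
  obtain ⟨s, rfl⟩ := hA
  have : ∀ s : Finset V, ∃ n, span F (s : Set V) ≤ E n := by
    intro s
    classical
    induction s using Finset.induction_on with
    | empty => exact ⟨0, by simp⟩
    | insert a s _ ih =>
      obtain ⟨n, hn⟩ := ih
      obtain ⟨m, hm⟩ := hE.cover a
      refine ⟨max n m, ?_⟩
      rw [Finset.coe_insert, span_insert]
      exact sup_le (span_le.2 (by simpa using hE.mono (le_max_right n m) hm)) (hn.trans (hE.mono (le_max_left n m)))
  exact this s

lemma InfD.perp_top (hE : InfD Q Γ E) : perp Q (⊤ : Submodule F V) = ⊥ := by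
  refine eq_bot_iff.2 fun v hv => ?_
  obtain ⟨n, hn⟩ := hE.cover v
  exact (mem_bot F).2 ((hE.nd n).eq_zero hn (perp_anti le_top hv))

/-- fresh vector -/
lemma HP.not_mem {Z : Submodule F V} {x : V × V} (hx : HP Q Z x) {v : V} (hv : v ∈ Z) {c : F} (h : c • x.1 = v) : c = 0 := by
  have h1 := hx.2.2.2.2 v hv
  rw [← h, map_smul, bl_comm, hx.2.2.1, smul_eq_mul, mul_one] at h1
  exact h1

lemma InfD.TR0 (hE : InfD Q Γ E) {A : Submodule F V} {n : ℕ} (hA : A ≤ E n) {o o' : V} (ho : o ∈ E n) (ho' : o' ∈ E n)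
    (hoA : o ∉ A) (hQ : Q o = Q o') (hp : ∀ a ∈ A, bl Q o a = bl Q o' a) {x : V × V} (hx : HP Q (E n) x) :
    ∃ g ∈ fx Γ A, g • o = o' + x.1 := by
  have h2 := hE.good.two
  obtain ⟨m, hm⟩ := hE.cover x.1
  obtain ⟨M, hnM, hmM⟩ : ∃ M, n ≤ M ∧ m ≤ M := ⟨max n m, le_max_left _ _, le_max_right _ _⟩
  have := hE.fd M
  have hxM : x.1 ∈ E M := hE.mono hmM hm
  have hoM : o ∈ E M := hE.mono hnM ho
  have ho'M : o' ∈ E M := hE.mono hnM ho'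
  have hAM : A ≤ E M := hA.trans (hE.mono hnM)
  have hxo : bl Q x.1 o = 0 := hx.2.2.2.1 o ho
  have hxo' : bl Q x.1 o' = 0 := hx.2.2.2.1 o' ho'
  obtain ⟨g, hg1, -, -, hg2⟩ := hE.good.swap (Z := E M) (Y := A ⊔ span F {o + (o' + x.1)}) (d := o - (o' + x.1)) (hE.nd M)
    (sup_le hAM (span_le.2 (by simpa using add_mem hoM (add_mem ho'M hxM)))) (sub_mem hoM (add_mem ho'M hxM))
    (by
      rw [mem_perp_sup_span]
      refine ⟨fun a ha => ?_, ?_⟩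
      · have := hx.2.2.2.1 a (hA ha)
        simp [hp a ha, this]
      · rintro s rfl
        have e1 : bl Q o o = bl Q o' o' := by rw [bl_self, bl_self, hQ]
        have e2 : bl Q x.1 x.1 = 0 := by rw [bl_self, hx.1, mul_zero]
        simp only [map_add, map_sub, LinearMap.add_apply, LinearMap.sub_apply, hxo, hxo', bl_comm o x.1, bl_comm o' x.1,
          bl_comm o' o, e1, e2]
        ring)
    (by
      intro hmem
      obtain ⟨a, ha, s, hs, h⟩ := mem_sup.1 hmem
      obtain ⟨c, rfl⟩ := mem_span_singleton.1 hs
      have h1 : (1 + c) • x.1 = o - o' - a - c • (o + o') := by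
        have : a = o - (o' + x.1) - c • (o + (o' + x.1)) := by rw [← h]; abel
        rw [this]; module
      have h3 := hx.not_mem (sub_mem (sub_mem (sub_mem ho ho') (hA ha)) (smul_mem _ c (add_mem ho ho'))) h1
      have hc : c = -1 := by linear_combination h3
      subst hc
      apply hoA
      have h4 : (2 : F) • o = a := by
        rw [h3, zero_smul] at h1
        have : a = o - o' - (-1 : F) • (o + o') := by
          have := h1.symm
          rw [sub_right_comm, sub_eq_zero] at this
          exact this.symm
        rw [this]; module
      have : o = (2 : F)⁻¹ • a := by rw [← h4, smul_smul, inv_mul_cancel₀ h2, one_smul]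
      rw [this]; exact smul_mem _ _ ha)
  refine ⟨g, fun a ha => hg1 a (mem_sup_left ha), ?_⟩
  have h3 := hg1 (o + (o' + x.1)) (mem_sup_single _ _)
  generalize o' + x.1 = w at *
  have h4 : (2 : F) • (g • o) = (2 : F) • w := by
    have e1 : (2 : F) • (g • o) = g • (o + w) + g • (o - w) := by
      rw [← smul_add, ← smul_comm]; congr 1; module
    rw [e1, h3, hg2]; module
  exact smul_right_injective V h2 h4

lemma InfD.TR (hE : InfD Q Γ E) {A : Submodule F V} [FiniteDimensional F A] {o o' : V}
    (hoA : o ∉ A) (hoA' : o' ∉ A) (hQ : Q o = Q o') (hp : ∀ a ∈ A, bl Q o a = bl Q o' a) :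
    ∃ g ∈ fx Γ A, g • o = o' := by
  obtain ⟨n, hn⟩ := hE.covers (A ⊔ span F {o} ⊔ span F {o'})
  have hA : A ≤ E n := (le_sup_left.trans le_sup_left).trans hn
  have ho : o ∈ E n := hn (mem_sup_left (mem_sup_single _ _))
  have ho' : o' ∈ E n := hn (mem_sup_single _ _)
  obtain ⟨x, hx⟩ := hE.hyp n
  obtain ⟨g, hg, h1⟩ := hE.TR0 hA ho ho' hoA hQ hp hx
  obtain ⟨g', hg', h1'⟩ := hE.TR0 hA ho' ho' hoA' rfl (fun _ _ => rfl) hx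
  refine ⟨g'⁻¹ * g, (fx Γ A).mul_mem ((fx Γ A).inv_mem hg') hg, ?_⟩
  rw [mul_smul, h1, ← h1', inv_smul_smul]

/-- simplices: vectors with the prescribed pairing, independent over `Z` -/
def okI (Q : QuadraticForm F V) (Z : Submodule F V) (v' : V) : List V → Prop
  | [] => True
  | (v :: σ) => (Q v = Q v' ∧ ∀ z ∈ Z, bl Q v z = bl Q v' z) ∧ v ∉ adj Z σ ∧ okI Q Z v' σ

lemma okI.mem {Z : Submodule F V} {v' : V} : ∀ {σ : List V}, okI Q Z v' σ → ∀ v ∈ σ, Q v = Q v' ∧ ∀ z ∈ Z, bl Q v z = bl Q v' z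
  | [], _, v, hv => by simp at hv
  | (w :: σ), h, v, hv => by
    rcases List.mem_cons.1 hv with rfl | hv
    · exact h.1
    · exact h.2.2.mem v hv

lemma okI.sub {Z : Submodule F V} {v' : V} {σ σ' : List V} (hs : σ'.Sublist σ) (h : okI Q Z v' σ) : okI Q Z v' σ' := by
  induction hs with
  | slnil => trivial
  | cons a _ ih => exact ih h.2.2
  | cons_cons a hs ih => exact ⟨h.1, fun hm => h.2.1 (adj_mono le_rfl hs.subset hm), ih h.2.2⟩

lemma smul_mem_adj {Z : Submodule F V} {g : Γ} (hg : g ∈ fx Γ Z) {σ : List V} {v : V} (h : v ∈ adj Z σ) : g • v ∈ adj Z (g • σ) := by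
  have : adj Z σ ≤ (adj Z (g • σ)).comap (DistribSMul.toLinearMap F V g) := by
    refine sup_le (fun z hz => ?_) (span_le.2 fun s hs => ?_)
    · show g • z ∈ adj Z (g • σ)
      rw [hg z hz]; exact mem_sup_left hz
    · exact mem_sup_right (subset_span ((mem_smul_list _ _ _).2 ⟨s, hs, rfl⟩))
  exact this h

lemma okI.smul (hG : GoodA Q Γ) {Z : Submodule F V} {v' : V} {g : Γ} (hg : g ∈ fx Γ Z) : ∀ {σ : List V}, okI Q Z v' σ → okI Q Z v' (g • σ)
  | [], _ => trivial
  | (v :: σ), h => by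
    refine ⟨⟨by rw [hG.isom]; exact h.1.1, fun z hz => ?_⟩, fun hm => h.2.1 ?_, okI.smul hG hg h.2.2⟩
    · rw [hG.bl', (fx Γ Z).inv_mem hg z hz]; exact h.1.2 z hz
    · have hm' : g • v ∈ adj Z (g • σ) := hm
      have := smul_mem_adj ((fx Γ Z).inv_mem hg) hm'
      rwa [inv_smul_smul, inv_smul_smul] at this

/-- cone points -/
lemma InfD.cone (hE : InfD Q Γ E) {Z : Submodule F V} [FiniteDimensional F Z] {v' : V} (S : Finset (List V)) :
    ∃ v, ∀ σ ∈ S, okI Q Z v' σ → okI Q Z v' (v :: σ) := by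
  have : ∃ n, v' ∈ E n ∧ ∀ σ ∈ S, adj Z σ ≤ E n := by
    classical
    induction S using Finset.induction_on with
    | empty =>
      obtain ⟨n, hn⟩ := hE.cover v'
      exact ⟨n, hn, by simp⟩
    | insert σ S _ ih =>
      obtain ⟨n, hn, h⟩ := ih
      have : FiniteDimensional F (adj Z σ) := by
        unfold adj
        have : FiniteDimensional F (span F {s | s ∈ σ}) := FiniteDimensional.span_of_finite F σ.finite_toSet
        infer_instance
      obtain ⟨m, hm⟩ := hE.covers (adj Z σ)
      refine ⟨max n m, hE.mono (le_max_left _ _) hn, fun τ hτ => ?_⟩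
      rcases Finset.mem_insert.1 hτ with rfl | hτ
      · exact hm.trans (hE.mono (le_max_right _ _))
      · exact (h τ hτ).trans (hE.mono (le_max_left _ _))
  obtain ⟨n, hn, h⟩ := this
  obtain ⟨x, hx⟩ := hE.hyp n
  refine ⟨v' + x.1, fun σ hσ hok => ⟨⟨?_, fun z hz => ?_⟩, fun hm => ?_, hok⟩⟩
  · rw [Q_add, hx.1, bl_comm, hx.2.2.2.1 v' hn]; simp
  · have := hx.2.2.2.1 z (h σ hσ (mem_sup_left hz))
    simp [this]
  · have h1 := sub_mem (h σ hσ hm) hn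
    have := hx.not_mem h1 (c := 1) (by simp)
    exact one_ne_zero this

instance fd_adj (Z : Submodule F V) [FiniteDimensional F Z] (σ : List V) : FiniteDimensional F (adj Z σ) := by
  unfold adj
  have : FiniteDimensional F (span F {s | s ∈ σ}) := FiniteDimensional.span_of_finite F σ.finite_toSet
  infer_instance

/-- generic vectors -/
def GenI (Q : QuadraticForm F V) (Z : Submodule F V) (v' : V) (σ : List V) (o : V) : Prop :=
  (Q o = Q v' ∧ ∀ z ∈ Z, bl Q o z = bl Q v' z) ∧ o ∉ adj Z σ ∧ ∀ s ∈ σ, bl Q o s = 0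

lemma InfD.gen (hE : InfD Q Γ E) {Z : Submodule F V} [FiniteDimensional F Z] {v' : V} {σ : List V} (hσ : okI Q Z v' σ) :
    ∃ o, GenI Q Z v' σ o := by
  have : ∃ φ : V →ₗ[F] F, (∀ z ∈ Z, φ z = bl Q v' z) ∧ ∀ s ∈ σ, φ s = 0 := by
    induction σ with
    | nil => exact ⟨bl Q v', fun _ _ => rfl, by simp⟩
    | cons v σ ih =>
      obtain ⟨φ, h1, h2⟩ := ih hσ.2.2
      obtain ⟨χ, h3, h4⟩ := Submodule.exists_le_ker_of_notMem hσ.2.1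
      refine ⟨φ - (φ v / χ v) • χ, fun z hz => ?_, fun s hs => ?_⟩
      · have : χ z = 0 := h4 (mem_sup_left hz)
        simp [this, h1 z hz]
      · rcases List.mem_cons.1 hs with rfl | hs
        · simp [h3]
        · have : χ s = 0 := h4 (mem_sup_right (subset_span hs))
          simp [this, h2 s hs]
  obtain ⟨φ, h1, h2⟩ := this
  obtain ⟨n, hn⟩ := hE.covers (adj Z σ)
  have := hE.fd n
  obtain ⟨o, ho, h3⟩ := (hE.nd n).rep φ
  obtain ⟨x, hx⟩ := hE.hyp n
  have key : ∀ w ∈ E n, bl Q (o + (x.1 + (Q v' - Q o) • x.2)) w = φ w := by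
    intro w hw
    simp [hx.2.2.2.1 w hw, hx.2.2.2.2 w hw, h3 w hw]
  refine ⟨o + (x.1 + (Q v' - Q o) • x.2), ⟨?_, fun z hz => ?_⟩, fun hm => ?_, fun s hs => ?_⟩
  · rw [Q_add, Q_add, Q_smul, hx.1, hx.2.1, map_smul, hx.2.2.1, map_add, map_smul, bl_comm o, bl_comm o,
      hx.2.2.2.1 o ho, hx.2.2.2.2 o ho]
    simp
  · rw [key z (hn (mem_sup_left hz)), h1 z hz]
  · have h4 := hx.2.2.2.2 _ (hn hm)
    have h5 : bl Q x.2 x.2 = 0 := by rw [bl_self, hx.2.1, mul_zero]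
    rw [map_add, map_add, map_smul, hx.2.2.2.2 o ho, bl_comm, hx.2.2.1, h5] at h4
    simp at h4
  · rw [key s (hn (mem_sup_right (subset_span hs))), h2 s hs]

lemma GenI.sub {Z : Submodule F V} {v' : V} {σ σ' : List V} {o : V} (hs : σ' ⊆ σ) (h : GenI Q Z v' σ o) : GenI Q Z v' σ' o :=
  ⟨h.1, fun hm => h.2.1 (adj_mono le_rfl hs hm), fun s h1 => h.2.2 s (hs h1)⟩
lemma GenI.smul (hG : GoodA Q Γ) {Z : Submodule F V} {v' : V} {σ : List V} {o : V} {g : Γ} (hg : g ∈ fx Γ Z)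
    (h : GenI Q Z v' σ o) : GenI Q Z v' (g • σ) (g • o) := by
  refine ⟨⟨by rw [hG.isom]; exact h.1.1, fun z hz => ?_⟩, fun hm => h.2.1 ?_, fun s hs => ?_⟩
  · rw [hG.bl', (fx Γ Z).inv_mem hg z hz]; exact h.1.2 z hz
  · have := smul_mem_adj ((fx Γ Z).inv_mem hg) hm
    simpa using this
  · obtain ⟨b, hb, rfl⟩ := (mem_smul_list _ _ _).1 hs
    rw [hG.bl]; exact h.2.2 b hb
lemma InfD.gen_trans (hE : InfD Q Γ E) {Z : Submodule F V} [FiniteDimensional F Z] {v' : V} {σ : List V} {o o' : V}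
    (h : GenI Q Z v' σ o) (h' : GenI Q Z v' σ o') : ∃ g ∈ fx Γ (adj Z σ), g • o = o' := by
  refine hE.TR h.2.1 h'.2.1 (h.1.1.trans h'.1.1.symm) fun a ha => ?_
  have : o - o' ∈ perp Q (adj Z σ) := by
    rw [adj, mem_perp_sup_span]
    refine ⟨fun z hz => ?_, fun s hs => ?_⟩
    · simp [h.1.2 z hz, h'.1.2 z hz]
    · simp [h.2.2 s hs, h'.2.2 s hs]
  have := this a ha
  rw [map_sub, LinearMap.sub_apply, sub_eq_zero] at this
  exact this
end S2
end OV

set_option linter.unusedSectionVars false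
namespace OV
open Submodule
section S3
variable {A Y k : Type*} [Field k]

lemma factor_fun {W₁ W₂ : Type*} [AddCommGroup W₁] [Module k W₁] [AddCommGroup W₂] [Module k W₂]
    (f : W₁ →ₗ[k] W₂) (φ : W₁ →ₗ[k] k) (h : ∀ x, f x = 0 → φ x = 0) : ∃ ψ : W₂ →ₗ[k] k, ∀ x, ψ (f x) = φ x := by
  have h1 : φ ∈ LinearMap.range f.dualMap := by
    rw [LinearMap.range_dualMap_eq_dualAnnihilator_ker, mem_dualAnnihilator]
    exact fun x hx => h x hx
  obtain ⟨ψ, hψ⟩ := h1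
  exact ⟨ψ, fun x => LinearMap.congr_fun hψ x⟩

open Classical in
lemma row_gen {ok : List A → Prop} (hsub : ∀ σ σ' : List A, σ'.Sublist σ → ok σ → ok σ')
    (hgen : ∀ S : Finset (List A), ∃ v, ∀ σ ∈ S, ok σ → ok (v :: σ)) {p : ℕ} {c : List A → k}
    (hc : ∀ σ, c σ ≠ 0 → ok σ ∧ σ.length = p + 1) (he : ∀ σ, ok σ → eps σ c = 0) :
    ∃ c' : List A → k, (∀ σ, c' σ ≠ 0 → ok σ ∧ σ.length = p) ∧ ∀ σ, ok σ → eps σ c' = c σ := by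
  obtain ⟨M, hM⟩ : ∃ M : Submodule k (List A →₀ k), M = Finsupp.supported k k {σ | ok σ ∧ σ.length = p + 1} := ⟨_, rfl⟩
  have h1 : ∃ ψ : (List A →₀ k) →ₗ[k] k, ∀ x : M, ψ (bd x.1) = ev c x.1 := by
    refine factor_fun (W₁ := ↥M) (W₂ := List A →₀ k) ((bd (Y := A) (k := k)).comp M.subtype) ((ev c).comp M.subtype) ?_
    rintro ⟨z, hz⟩ hz0
    have hbd : bd z = 0 := hz0
    show ev c z = 0
    have hz' : ∀ σ ∈ z.support, ok σ ∧ σ.length = p + 1 := fun σ hσ => by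
      rw [hM] at hz
      exact hz hσ
    obtain ⟨v, hv⟩ := hgen z.support
    -- cone operator
    have e1 : ∀ x : List A →₀ k, ev (fun σ => eps (v :: σ) c) x = ev c x - ev (fun σ => c (v :: σ)) (bd x) := by
      intro x
      rw [ev_bd]
      have : ev (fun σ => eps (v :: σ) c) = ev c - ev (fun l => eps l fun σ => c (v :: σ)) := by
        refine Finsupp.lhom_ext' fun l => LinearMap.ext_ring ?_
        simp only [LinearMap.comp_apply, Finsupp.lsingle_apply, LinearMap.sub_apply, ev_single]
        rw [eps_cons]
      rw [this]; rfl
    have e2 := e1 z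
    rw [hbd, map_zero, sub_zero] at e2
    rw [← e2]
    unfold ev
    rw [Finsupp.linearCombination_apply, Finsupp.sum]
    refine Finset.sum_eq_zero fun σ hσ => ?_
    rw [he _ (hv σ hσ (hz' σ hσ).1), smul_zero]
  obtain ⟨ψ, hψ⟩ := h1
  refine ⟨fun σ => if ok σ ∧ σ.length = p then ψ (Finsupp.single σ 1) else 0, fun σ hσ => ?_, fun σ hσ => ?_⟩
  · by_contra hne; simp only [if_neg hne] at hσ; exact hσ rfl
  · by_cases hl : σ.length = p + 1
    · rw [eps_congr σ (g := fun σ' => ψ (Finsupp.single σ' 1)), ← map_eps]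
      · have hm : Finsupp.single σ (1 : k) ∈ M := hM ▸ Finsupp.single_mem_supported k _ ⟨hσ, hl⟩
        have := hψ ⟨_, hm⟩
        have e3 : ψ (bd (Finsupp.single σ 1)) = ev c (Finsupp.single σ 1) := this
        rw [e3, ev_single]
      · intro σ' hs hl'
        rw [if_pos ⟨hsub _ _ hs hσ, by omega⟩]
    · have : c σ = 0 := by
        by_contra hne; exact hl (hc σ hne).2
      rw [this]
      apply eps_zero'
      intro σ' hs hl'
      rw [if_neg]; rintro ⟨_, h⟩; omega

variable {Γ T : Type*} [Group Γ] [MulAction Γ A] [MulAction Γ Y] [MulAction Γ T]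

/-- translation on functions -/
@[reducible] def fnAct : MulAction Γ (List A → k) where
  smul g f := fun l => f (g⁻¹ • l)
  one_smul f := by
    funext l
    show f ((1 : Γ)⁻¹ • l) = f l
    simp
  mul_smul g h f := by
    funext l
    show f ((g * h)⁻¹ • l) = f (h⁻¹ • g⁻¹ • l)
    simp [mul_smul]

/-- admissibility without a pair -/
def okN (T : Type*) (ok : List A → Prop) (σ : List A) (t : Option T) : Prop := ok σ ∧ t = none

lemma rowEx_gen {H : Subgroup Γ} {ok : List A → Prop}
    (hsub : ∀ σ σ' : List A, σ'.Sublist σ → ok σ → ok σ')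
    (hequi : ∀ h ∈ H, ∀ σ, ok σ → ok (h • σ))
    (hfree : ∀ (g : Γ) (y : Y), g • y = y → g = 1)
    (hgen : ∀ S : Finset (List A), ∃ v, ∀ σ ∈ S, ok σ → ok (v :: σ)) : RowEx H (okN T ok) Y k where
  inj q c hc he := by
    funext σ l t
    by_contra hne
    obtain ⟨⟨a1, rfl⟩, a2, a3⟩ := hc.supp _ _ _ hne
    obtain rfl : σ = [] := by simpa using a2
    obtain ⟨v, hv⟩ := hgen {[]}
    have h3 := congrFun (congrFun (congrFun he [v]) l) none
    rw [eK_pos _ _ ⟨hv [] (by simp) a1, rfl⟩] at h3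
    apply hne
    simpa [eps_cons] using h3
  ex q p c hc he := by
    let _ : MulAction Γ (List A → k) := fnAct
    have ok_iff : ∀ h ∈ H, ∀ σ, ok σ ↔ ok (h • σ) := fun h hh σ =>
      ⟨hequi h hh σ, fun h1 => by simpa using hequi h⁻¹ (H.inv_mem hh) _ h1⟩
    have key := equivariant_choice H (A := List Y) (B := List A → k)
      (fun l b => (∀ σ, b σ ≠ 0 → ok σ ∧ σ.length = p) ∧ (l = [] → b = 0) ∧ (l.length ≠ q + 1 → b = 0) ∧
        ∀ σ, ok σ → eps σ b = c σ l none) ?_ ?_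
    · obtain ⟨φ, h1, h2⟩ := key
      classical
      refine ⟨fun σ l t => if t = none then φ l σ else 0, ⟨fun h hh σ l t => ?_, fun σ t => ?_, fun σ l t hne => ?_⟩, ?_⟩
      · simp only [smul_opt_eq_none, h2 h hh]
        have : (h • φ l) (h • σ) = φ l σ := by
          show φ l (h⁻¹ • h • σ) = _
          simp
        rw [this]
      · simp [(h1 []).2.1 rfl]
      · by_cases ht : t = none
        · subst ht
          simp only [if_true] at hne
          obtain ⟨b1, b2⟩ := (h1 l).1 σ hne
          refine ⟨⟨b1, rfl⟩, b2, ?_⟩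
          by_contra hl
          rw [(h1 l).2.2.1 (by simpa using hl)] at hne
          exact hne rfl
        · simp [ht] at hne
      · funext σ l t
        by_cases hok : okN T ok σ t
        · obtain ⟨b1, rfl⟩ := hok
          rw [eK_pos _ _ ⟨b1, rfl⟩]
          simp only [if_true]
          exact (h1 l).2.2.2 σ b1
        · rw [eK_neg _ _ hok]
          by_contra hne
          exact hok (hc.supp _ _ _ (fun h => hne h.symm)).1
    · rintro g hg l b ⟨h1, h2, h3, h4⟩
      refine ⟨fun σ hσ => ?_, fun hl => ?_, fun hl => ?_, fun σ hσ => ?_⟩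
      · have := h1 (g⁻¹ • σ) hσ
        refine ⟨?_, by simpa using this.2⟩
        have h5 := hequi g hg _ this.1
        rwa [smul_inv_smul] at h5
      · have : l = [] := by
          rcases l with _ | ⟨a, l⟩
          · rfl
          · simp at hl
        rw [h2 this]; rfl
      · rw [h3 (by simpa using hl)]; rfl
      · have h5 := h4 (g⁻¹ • σ) (hequi _ (H.inv_mem hg) _ hσ)
        have h6 := hc.inv g hg (g⁻¹ • σ) l none
        rw [smul_inv_smul] at h6
        rw [eps_smul_list] at h5
        rw [show (none : Option T) = g • none from rfl, h6, ← h5]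
        rfl
    · intro l
      rcases l with _ | ⟨y, l⟩
      · refine ⟨0, ⟨fun σ h => absurd rfl h, fun _ => rfl, fun _ => rfl, fun σ _ => ?_⟩, fun g _ _ => rfl⟩
        rw [hc.nil]; exact eps_zero σ
      · obtain ⟨b, hb1, hb2⟩ := row_gen hsub hgen (p := p) (c := fun σ => c σ (y :: l) none)
          (fun σ hσ => ⟨(hc.supp _ _ _ hσ).1.1, (hc.supp _ _ _ hσ).2.1⟩) (fun σ hσ => by
            have := congrFun (congrFun (congrFun he σ) (y :: l)) none
            rwa [eK_pos _ _ ⟨hσ, rfl⟩] at this)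
        have triv : ∀ b : List A → k, ∀ g ∈ H, g • (y :: l) = y :: l → g • b = b := by
          intro b g _ h
          rw [smul_list_cons, List.cons.injEq] at h
          rw [hfree g y h.1, one_smul]
        by_cases hl : (y :: l).length = q + 1
        · exact ⟨b, ⟨hb1, fun h => by simp at h, fun h => absurd hl h, hb2⟩, triv b⟩
        · refine ⟨0, ⟨fun σ h => absurd rfl h, fun _ => rfl, fun _ => rfl, fun σ _ => ?_⟩, triv 0⟩
          rw [show c σ (y :: l) none = 0 by
            by_contra hne
            exact hl (by simpa using (hc.supp _ _ _ hne).2.2)]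
          exact eps_zero σ

/-- extend by zero -/
def ex0 (T : Type*) (f : List Y → k) : List Y → Option T → k := fun l t => match t with
  | none => f l
  | some _ => 0

lemma ex0_isR {H : Subgroup Γ} {q : ℕ} {f : List Y → k} (hf : IsC H q f) : IsR H (∅ : Set T) q (ex0 T f) where
  inv h hh l t := by
    rcases t with _ | x
    · exact hf.inv h hh l
    · rfl
  nil t := by
    rcases t with _ | x
    · exact hf.zero' (by simp)
    · rfl
  supp l t h := by
    rcases t with _ | x
    · exact ⟨by simp, by simpa using hf.supp l h⟩
    · exact absurd rfl h
lemma D_empty (g : List Y → Option T → k) : D (∅ : Set T) g = ex0 T (fun l => eps l (fun l' => g l' none)) := by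
  funext l t
  rcases t with _ | x
  · rfl
  · rw [D_some_not _ _ (by simp)]; rfl
lemma cob_iff {H : Subgroup Γ} {q : ℕ} {f : List Y → k} : Cob H (∅ : Set T) (q + 1) (ex0 T f) ↔ CobC H q f := by
  constructor
  · rintro ⟨g, h1, h2⟩
    refine ⟨fun l => g l none, ⟨fun h hh l => h1.inv h hh l none, fun l hl => by simpa using (h1.supp l none hl).2⟩, fun l => ?_⟩
    exact congrFun (congrFun h2 l) none
  · rintro ⟨g, h1, h2⟩
    refine ⟨ex0 T g, ex0_isR h1, ?_⟩
    rw [D_empty]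
    funext l t
    rcases t with _ | x
    · exact h2 l
    · rfl
lemma eq_ex0 {H : Subgroup Γ} {q : ℕ} {f : List Y → Option T → k} (hf : IsR H (∅ : Set T) q f) : f = ex0 T (fun l => f l none) := by
  funext l t
  rcases t with _ | x
  · rfl
  · by_contra hne
    exact (hf.supp l _ hne).1 x rfl
end S3
end OV

set_option linter.unusedSectionVars false
namespace OV
open Submodule
section S4
variable {F V Γ Y k : Type*} [Field F] [AddCommGroup V] [Module F V] [Group Γ] [DistribMulAction Γ V]
  [SMulCommClass Γ F V] [MulAction Γ Y] [Field k] {Q : QuadraticForm F V} {E : ℕ → Submodule F V}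

variable (V Γ Y k F) in
/-- vanishing in degree `j + 1` -/
def SP (j : ℕ) : Prop := ∀ Z : Submodule F V, FiniteDimensional F Z → ∀ f : List Y → k, IsC (fx Γ Z) (j + 1) f →
  (∀ l, eps l f = 0) → CobC (fx Γ Z) j f

lemma Xs_okN {A : Type*} (ok : List A → Prop) (T : Type*) (σ : List A) : Xs (okN T ok) σ = ∅ := by
  ext x
  simp [Xs, okN]

lemma CobC.conj {g : Γ} {Z Z' : Submodule F V} (h : ∀ z ∈ Z, g • z ∈ Z') {q : ℕ} {f : List Y → k}
    (hf : ∀ l, f (g • l) = f l) (hc : CobC (fx Γ Z) q f) : CobC (fx Γ Z') q f := by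
  obtain ⟨w, h1, h2⟩ := hc
  refine ⟨fun l => w (g⁻¹ • l), ⟨fun γ hγ l => ?_, fun l hl => by simpa using h1.supp _ hl⟩, fun l => ?_⟩
  · have : g⁻¹ * γ * g ∈ fx Γ Z := fun z hz => by
      rw [mul_smul, mul_smul, hγ _ (h z hz), inv_smul_smul]
    rw [← h1.inv _ this (g⁻¹ • l), mul_smul, smul_inv_smul, mul_smul]
  · have := h2 (g⁻¹ • l)
    rw [eps_smul_list] at this
    rw [this]
    have := hf (g⁻¹ • l)
    rw [smul_inv_smul] at this
    exact this.symm

lemma InfD.det (hE : InfD Q Γ E) (hfree : ∀ (g : Γ) (y : Y), g • y = y → g = 1) {q : ℕ}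
    (hS : ∀ j < q, SP F V Γ Y k j) {Z : Submodule F V} [FiniteDimensional F Z] {v' : V} (hv' : v' ∉ Z)
    {f : List Y → k} (hf : IsC (fx Γ Z) (q + 1) f) (hd : ∀ l, eps l f = 0)
    (hc : CobC (fx Γ (Z ⊔ span F {v'})) q f) : CobC (fx Γ Z) q f := by
  classical
  have hok : OkData (fx Γ Z) (okN Y (okI Q Z v')) :=
    ⟨fun σ x h => by simp [okN] at h, fun σ σ' t hs h => ⟨h.1.sub hs, h.2⟩,
      fun h hh σ t ht => ⟨ht.1.smul hE.good hh, by rw [ht.2]; rfl⟩⟩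
  have hnil : okN Y (okI Q Z v') [] none := ⟨trivial, rfl⟩
  have hrow : RowEx (fx Γ Z) (okN Y (okI Q Z v')) Y k :=
    rowEx_gen (fun σ σ' hs h => h.sub hs) (fun h hh σ hσ => hσ.smul hE.good hh) hfree
      (fun S => hE.cone S)
  rw [← cob_iff (T := Y), ← Xs_okN (okI Q Z v') Y []]
  have hd' : D (Xs (okN Y (okI Q Z v')) []) (ex0 Y f) = 0 := by
    rw [Xs_okN, D_empty]
    funext l t
    rcases t with _ | x
    · exact hd l
    · rfl
  refine zigzag hok hnil hrow (q + 1) ?_ ?_ _ (by rw [Xs_okN]; exact ex0_isR hf) hd' ?_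
  · intro c _ hcK hdc hec
    have hcR := fun σ => hcK.isR hok σ
    -- constancy
    have hconst : ∀ σ y y', c σ [y] none = c σ [y'] none := by
      intro σ y y'
      have := congrFun (congrFun (congrFun hdc σ) [y', y]) none
      simp only [dK, D_none] at this
      rw [eps_cons, eps_cons, eps_nil] at this
      simp at this
      exact sub_eq_zero.1 this
    have hconst' : ∀ σ (g : Γ) l, c σ (g • l) none = c σ l none := by
      intro σ g l
      rcases l with _ | ⟨y, _ | ⟨y', l⟩⟩
      · rfl
      · exact hconst σ _ _
      · rw [show c σ (y :: y' :: l) none = 0 by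
          by_contra hne
          simpa using (hcK.supp _ _ _ hne).2.2]
        by_contra hne
        simpa using (hcK.supp _ _ _ hne).2.2
    have hgenc : ∀ σ o o', GenI Q Z v' σ o → GenI Q Z v' σ o' → ∀ l, c (o :: σ) l none = c (o' :: σ) l none := by
      intro σ o o' ho ho' l
      obtain ⟨g, hg, rfl⟩ := hE.gen_trans ho ho'
      have hgσ : g • σ = σ := by
        rw [← stabL_fx, mem_stabL] at hg
        exact hg.2
      have := hcK.inv g (fx_anti (le_adj Z σ) hg) (o :: σ) l none
      rw [smul_list_cons, hgσ, smul_opt_none, hconst'] at this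
      exact this.symm
    have hex : ∀ σ : List V, ∃ o, okI Q Z v' σ → GenI Q Z v' σ o := by
      intro σ
      by_cases h : okI Q Z v' σ
      · obtain ⟨o, ho⟩ := hE.gen h
        exact ⟨o, fun _ => ho⟩
      · exact ⟨0, fun h' => absurd h' h⟩
    choose o ho using hex
    have okiff : ∀ h ∈ fx Γ Z, ∀ σ, okI Q Z v' (h • σ) ↔ okI Q Z v' σ := fun h hh σ =>
      ⟨fun h1 => by simpa using h1.smul hE.good ((fx Γ Z).inv_mem hh), fun h1 => h1.smul hE.good hh⟩
    refine ⟨fun σ l t => if okI Q Z v' σ ∧ t = none then c (o σ :: σ) l none else 0, ⟨fun h hh σ l t => ?_, fun σ t => ?_, fun σ l t hne => ?_⟩, ?_, ?_⟩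
    · simp only [okiff h hh, smul_opt_eq_none]
      by_cases hσ : okI Q Z v' σ ∧ t = none
      · rw [if_pos hσ, if_pos hσ, hgenc _ _ (h • o σ) (ho _ (hσ.1.smul hE.good hh)) ((ho σ hσ.1).smul hE.good hh)]
        exact hcK.inv h hh (o σ :: σ) l none
      · rw [if_neg hσ, if_neg hσ]
    · simp [hcK.nil]
    · by_cases hσ : okI Q Z v' σ ∧ t = none
      · simp only [if_pos hσ] at hne
        obtain ⟨b1, b2, b3⟩ := hcK.supp _ _ _ hne
        obtain ⟨hσ, rfl⟩ := hσ
        exact ⟨⟨hσ, rfl⟩, by simpa using b2, b3⟩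
      · simp only [if_neg hσ] at hne
        exact absurd rfl hne
    · funext σ
      simp only [dK, Xs_okN, D_empty]
      funext l t
      rcases t with _ | x
      · show eps l _ = 0
        by_cases hσ : okI Q Z v' σ
        · simp only [hσ, true_and, if_true]
          have := congrFun (congrFun (congrFun hdc (o σ :: σ)) l) none
          exact this
        · simp only [hσ, false_and, if_false]
          exact eps_zero l
      · rfl
    · funext σ l t
      by_cases hσ : okN Y (okI Q Z v') σ t
      · rw [eK_pos _ _ hσ]
        obtain ⟨hσ, rfl⟩ := hσ
        have hcons : okI Q Z v' (o σ :: σ) := ⟨(ho σ hσ).1, (ho σ hσ).2.1, hσ⟩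
        have h1 := congrFun (congrFun (congrFun hec (o σ :: σ)) l) none
        rw [eK_pos _ _ ⟨hcons, rfl⟩, eps_cons] at h1
        rw [sub_eq_zero.1 h1]
        refine eps_congr σ fun σ' hs _ => ?_
        have hσ' := hσ.sub hs
        simp only [hσ', true_and, if_true]
        exact hgenc σ' _ _ (ho σ' hσ') ((ho σ hσ).sub hs.subset) l
      · rw [eK_neg _ _ hσ]
        by_contra hne
        exact hσ (hcK.supp _ _ _ (fun h => hne h.symm)).1
  · intro j P c hP hjP hcK hdc _
    refine W2 hok hcK fun σ hσ hok' => ?_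
    have hR := hcK.isR hok σ
    have hD : ∀ l, eps l (fun l' => c σ l' none) = 0 := fun l => congrFun (congrFun (congrFun hdc σ) l) none
    rw [Xs_okN, stabL_fx] at hR ⊢
    rw [eq_ex0 hR]
    rw [cob_iff]
    refine hS j (by omega) _ inferInstance _ ⟨fun h hh l => hR.inv h hh l none, fun l hl => by simpa using (hR.supp l none hl).2⟩ hD
  · intro v hv
    rw [Xs_okN, stabL_fx, adj_single]
    have : cut (∅ : Set Y) (ex0 Y f) = ex0 Y f := by
      funext l t
      rcases t with _ | x
      · rw [cut_none]
      · rw [cut_some_not _ _ (by simp)]; rfl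
    rw [this, cob_iff]
    obtain ⟨⟨h1, h2⟩, h3, -⟩ := hv.1
    rw [adj_nil] at h3
    obtain ⟨g, hg, hgv⟩ := hE.TR hv' h3 h1.symm (fun a ha => (h2 a ha).symm)
    refine hc.conj (g := g) ?_ (hf.inv g hg)
    intro z hz
    obtain ⟨a, ha, s, hs, rfl⟩ := mem_sup.1 hz
    obtain ⟨r, rfl⟩ := mem_span_singleton.1 hs
    rw [smul_add, hg a ha, smul_comm, hgv]
    exact add_mem (mem_sup_left ha) (mem_sup_right (smul_mem _ _ (mem_span_singleton_self v)))

lemma InfD.det' (hE : InfD Q Γ E) (hfree : ∀ (g : Γ) (y : Y), g • y = y → g = 1) {q : ℕ}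
    (hS : ∀ j < q, SP F V Γ Y k j) {Z' : Submodule F V} [FiniteDimensional F Z'] {f : List Y → k}
    (hd : ∀ l, eps l f = 0)
    (hc : CobC (fx Γ Z') q f) : ∀ (n : ℕ) (Z : Submodule F V), Z ≤ Z' → Module.finrank F Z' - Module.finrank F Z ≤ n →
      IsC (fx Γ Z) (q + 1) f → CobC (fx Γ Z) q f := by
  intro n
  induction n with
  | zero =>
    intro Z hZ hn _
    have : Z = Z' := eq_of_le_of_finrank_le hZ (by omega)
    rw [this]; exact hc
  | succ n ih =>
    intro Z hZ hn hf
    by_cases heq : Z = Z'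
    · rw [heq]; exact hc
    · obtain ⟨v, hv, hvn⟩ := SetLike.exists_of_lt (lt_of_le_of_ne hZ heq)
      have : FiniteDimensional F Z := finiteDimensional_of_le hZ
      have hlt : Z < Z ⊔ span F {v} := by
        refine lt_of_le_of_ne le_sup_left fun h => hvn ?_
        rw [h]; exact mem_sup_single _ _
      have h1 := finrank_lt_finrank_of_lt hlt
      have hle : Z ⊔ span F {v} ≤ Z' := sup_le hZ (span_le.2 (by simpa using hv))
      have h2 := finrank_mono hle
      refine hE.det hfree hS hvn hf hd (ih _ hle (by omega) (hf.mono (fx_anti le_sup_left)))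
end S4
end OV

set_option linter.unusedSectionVars false
set_option linter.unusedVariables false
namespace OV
open Submodule
section S5
variable {F V Γ Y k : Type*} [Field F] [AddCommGroup V] [Module F V] [Group Γ] [DistribMulAction Γ V]
  [SMulCommClass Γ F V] [MulAction Γ Y] [Field k] {Q : QuadraticForm F V} {E : ℕ → Submodule F V}

lemma Nd.inter {N A : Submodule F V} [FiniteDimensional F A] (hN : Nd Q N) (hA : Nd Q A) (h : A ≤ N) :
    Nd Q (N ⊓ perp Q A) := by
  refine eq_bot_iff.2 ?_
  rintro v ⟨hv, hv2⟩
  rw [mem_bot]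
  refine hN.eq_zero hv.1 fun n hn => ?_
  obtain ⟨a, ha, h1⟩ := hA.proj n
  have e : n = a + (n - a) := by abel
  rw [e, map_add, hv.2 a ha, hv2 (n - a) ⟨sub_mem hn (h ha), h1⟩, add_zero]

lemma Nd.perp_inter {N A : Submodule F V} [FiniteDimensional F A] [FiniteDimensional F N] (hN : Nd Q N) (hA : Nd Q A)
    (h : A ≤ N) : perp Q (N ⊓ perp Q A) ≤ perp Q N ⊔ A := by
  intro v hv
  obtain ⟨n, hn, h1⟩ := hN.proj v
  obtain ⟨a, ha, h2⟩ := hA.proj n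
  have hmem : n - a ∈ N ⊓ perp Q A := ⟨sub_mem hn (h ha), h2⟩
  have h3 : n - a = 0 := by
    refine (hN.inter hA h).eq_zero hmem fun w hw => ?_
    have e : n - a = v - (v - n) - a := by abel
    rw [e, map_sub, map_sub, LinearMap.sub_apply, LinearMap.sub_apply, hv w hw, h1 w hw.1, bl_comm, hw.2 a ha]
    simp
  have e : v = (v - n) + n := by abel
  rw [e]
  refine add_mem (mem_sup_left h1) ?_
  rw [sub_eq_zero.1 h3]; exact mem_sup_right ha

/-- the projection to the Levi part -/
def prl (Q : QuadraticForm F V) (u v' : V) (h : Γ) : V →ₗ[F] V :=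
  let w : V →ₗ[F] V := LinearMap.id - (((bl Q).flip v').smulRight u) - (((bl Q).flip u).smulRight v')
  let hw : V →ₗ[F] V := (DistribSMul.toLinearMap F V h).comp w
  hw + ((bl Q).flip u).smulRight v' + ((((bl Q).flip v') - ((bl Q).flip v').comp hw)).smulRight u

lemma prl_apply (u v' : V) (h : Γ) (v : V) : prl Q u v' h v =
    h • (v - bl Q v v' • u - bl Q v u • v') + bl Q v u • v' +
      (bl Q v v' - bl Q (h • (v - bl Q v v' • u - bl Q v u • v')) v') • u := by
  simp [prl]

lemma prl_u {u v' : V} (hu : Q u = 0) (hv' : Q v' = 0) (h1 : bl Q v' u = 1) (h : Γ) : prl Q u v' h u = u := by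
  rw [prl_apply, bl_comm u v', h1, bl_self, hu]
  simp
lemma prl_v {u v' : V} (hu : Q u = 0) (hv' : Q v' = 0) (h1 : bl Q v' u = 1) (h : Γ) : prl Q u v' h v' = v' := by
  rw [prl_apply, h1, bl_self, hv']
  simp
lemma prl_perp {u v' : V} (hu : Q u = 0) (hv' : Q v' = 0) (h1 : bl Q v' u = 1) (h : Γ) {w : V} (hwu : bl Q w u = 0) (hwv : bl Q w v' = 0) :
    prl Q u v' h w = h • w - bl Q (h • w) v' • u := by
  rw [prl_apply, hwu, hwv]
  simp [sub_eq_add_neg]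
lemma decomp {u v' : V} (hu : Q u = 0) (hv' : Q v' = 0) (h1 : bl Q v' u = 1) (v : V) : ∃ (a b : F) (w : V), v = a • u + b • v' + w ∧ bl Q w u = 0 ∧ bl Q w v' = 0 := by
  refine ⟨bl Q v v', bl Q v u, v - bl Q v v' • u - bl Q v u • v', by abel, ?_, ?_⟩
  · simp [h1, bl_self, hu]
  · simp [bl_comm u v', h1, bl_self, hv']
lemma prl_orth {u v' : V} (hu : Q u = 0) (hv' : Q v' = 0) (h1 : bl Q v' u = 1) (hG : GoodA Q Γ) {h : Γ} (hh : h • u = u) {w : V} (hwu : bl Q w u = 0) (hwv : bl Q w v' = 0) :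
    bl Q (prl Q u v' h w) u = 0 ∧ bl Q (prl Q u v' h w) v' = 0 := by
  rw [prl_perp hu hv' h1 h hwu hwv]
  have e : bl Q (h • w) u = 0 := by
    have := hG.bl h w u
    rw [hh] at this; rw [this, hwu]
  constructor
  · simp [e, bl_self, hu]
  · simp [bl_comm u v', h1]
lemma prl_mul {u v' : V} (hu : Q u = 0) (hv' : Q v' = 0) (h1 : bl Q v' u = 1) (hG : GoodA Q Γ) {h h' : Γ} (hh : h • u = u) (hh' : h' • u = u) (v : V) :
    prl Q u v' h (prl Q u v' h' v) = prl Q u v' (h * h') v := by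
  obtain ⟨a, b, w, rfl, hwu, hwv⟩ := decomp hu hv' h1 v
  simp only [map_add, map_smul, prl_u hu hv' h1, prl_v hu hv' h1]
  congr 1
  obtain ⟨o1, o2⟩ := prl_orth hu hv' h1 hG hh' hwu hwv
  rw [prl_perp hu hv' h1 h o1 o2, prl_perp hu hv' h1 h' hwu hwv, prl_perp hu hv' h1 (h * h') hwu hwv]
  rw [smul_sub, smul_comm h (bl Q (h' • w) v') u, hh, mul_smul]
  generalize h • h' • w = x
  generalize bl Q (h' • w) v' = c
  simp only [map_sub, map_smul, LinearMap.sub_apply, LinearMap.smul_apply, bl_comm u v', h1, smul_eq_mul, mul_one]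
  module
lemma prl_one {u v' : V} (hu : Q u = 0) (hv' : Q v' = 0) (h1 : bl Q v' u = 1) (v : V) : prl Q u v' (1 : Γ) v = v := by
  obtain ⟨a, b, w, rfl, hwu, hwv⟩ := decomp hu hv' h1 v
  simp only [map_add, map_smul, prl_u hu hv' h1, prl_v hu hv' h1, prl_perp hu hv' h1 (1 : Γ) hwu hwv]
  simp [hwv]
lemma prl_isom {u v' : V} (hu : Q u = 0) (hv' : Q v' = 0) (h1 : bl Q v' u = 1) (hG : GoodA Q Γ) {h : Γ} (hh : h • u = u) (v : V) : Q (prl Q u v' h v) = Q v := by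
  obtain ⟨a, b, w, rfl, hwu, hwv⟩ := decomp hu hv' h1 v
  obtain ⟨o1, o2⟩ := prl_orth hu hv' h1 hG hh hwu hwv
  have e : bl Q (h • w) u = 0 := by
    have := hG.bl h w u
    rw [hh] at this; rw [this, hwu]
  have e2 : Q (prl Q u v' h w) = Q w := by
    rw [prl_perp hu hv' h1 h hwu hwv, Q_sub, Q_smul, hu, hG.isom, map_smul (bl Q (h • w)) _ u, e]
    simp
  simp only [map_add, map_smul, prl_u hu hv' h1, prl_v hu hv' h1]
  rw [Q_add, Q_add _ w, e2]
  simp only [map_add, map_smul, LinearMap.add_apply, LinearMap.smul_apply, bl_comm u, bl_comm v' (prl Q u v' h w), bl_comm v' w, o1, o2, hwu, hwv]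
lemma prl_fix {u v' : V} (hu : Q u = 0) (hv' : Q v' = 0) (h1 : bl Q v' u = 1) {h : Γ} {w : V} (hwu : bl Q w u = 0) (hwv : bl Q w v' = 0) (hw : h • w = w) : prl Q u v' h w = w := by
  rw [prl_perp hu hv' h1 h hwu hwv, hw, hwv]; simp
lemma prl_self {u v' : V} (hu : Q u = 0) (hv' : Q v' = 0) (h1 : bl Q v' u = 1) (hG : GoodA Q Γ) {h : Γ} (hh : h • u = u) (hh' : h • v' = v') (v : V) : prl Q u v' h v = h • v := by
  obtain ⟨a, b, w, rfl, hwu, hwv⟩ := decomp hu hv' h1 v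
  have e : bl Q (h • w) v' = 0 := by
    have := hG.bl h w v'
    rw [hh'] at this; rw [this, hwv]
  simp only [map_add, map_smul, prl_u hu hv' h1, prl_v hu hv' h1, smul_add, smul_comm h, hh, hh',
    prl_perp hu hv' h1 h hwu hwv, e]
  simp

lemma InfD.prl_ex {u v' : V} (hu : Q u = 0) (hv' : Q v' = 0) (h1 : bl Q v' u = 1) (hE : InfD Q Γ E) (h : Γ) (hh : h • u = u) : ∃ g : Γ, ∀ v, g • v = prl Q u v' h v := by
  have hG := hE.good
  have hi : h⁻¹ • u = u := by rw [inv_smul_eq_iff, hh]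
  let φ : V ≃ₗ[F] V := LinearEquiv.ofLinearMap (prl Q u v' h) (prl Q u v' h⁻¹)
    (LinearMap.ext fun v => by simp [prl_mul hu hv' h1 hG hh hi, prl_one hu hv' h1])
    (LinearMap.ext fun v => by simp [prl_mul hu hv' h1 hG hi hh, prl_one hu hv' h1])
  obtain ⟨n, hn⟩ := hE.fixes h
  obtain ⟨a, ha⟩ := hE.cover u
  obtain ⟨b, hb⟩ := hE.cover v'
  obtain ⟨M, hM⟩ : ∃ M, n ≤ M ∧ a ≤ M ∧ b ≤ M := ⟨max n (max a b), by omega⟩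
  refine hE.full φ M (prl_isom hu hv' h1 hG hh) fun w hw => ?_
  exact prl_fix hu hv' h1 (hw u (hE.mono hM.2.1 ha)) (hw v' (hE.mono hM.2.2 hb)) (hn w (perp_anti (hE.mono hM.1) hw))

/-- twisted equivariant self maps of a free set -/
lemma ex_theta (hfree : ∀ (g : Γ) (y : Y), g • y = y → g = 1) (H : Subgroup Γ) (pr : Γ → Γ)
    (hpr : ∀ g ∈ H, ∀ h ∈ H, pr (g * h) = pr g * pr h) :
    ∃ θ : Y → Y, ∀ h ∈ H, ∀ y, θ (h • y) = pr h • θ y := by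
  classical
  let r : Y → Y := fun y => Quotient.out (s := MulAction.orbitRel H Y) (Quotient.mk (MulAction.orbitRel H Y) y)
  have hr : ∀ y, ∃ h ∈ H, h • r y = y := by
    intro y
    have : MulAction.orbitRel H Y (r y) y := Quotient.exact (Quotient.out_eq (s := MulAction.orbitRel H Y) _)
    have := (MulAction.orbitRel H Y).symm this
    obtain ⟨h, hh⟩ := MulAction.orbitRel_apply.1 this
    exact ⟨h, h.2, hh⟩
  have hr2 : ∀ h ∈ H, ∀ y, r (h • y) = r y := by
    intro h hh y
    have : Quotient.mk (MulAction.orbitRel H Y) (h • y) = Quotient.mk (MulAction.orbitRel H Y) y :=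
      Quotient.sound (MulAction.orbitRel_apply.2 ⟨⟨h, hh⟩, rfl⟩)
    show Quotient.out _ = Quotient.out _
    rw [this]
  choose η hη hη2 using hr
  refine ⟨fun y => pr (η y) • r y, fun h hh y => ?_⟩
  have : η (h • y) = h * η y := by
    have e : ((η (h • y))⁻¹ * (h * η y)) • r y = r y := by
      have e1 := hη2 (h • y)
      rw [hr2 h hh] at e1
      rw [mul_smul, mul_smul, hη2, inv_smul_eq_iff, e1]
    exact inv_mul_eq_one.1 (hfree _ _ e)
  simp only [this, hr2 h hh, hpr h hh _ (hη y), mul_smul]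

/-- averaging over a finite subspace -/
lemma InfD.avg (hE : InfD Q Γ E) [Finite F] (hk : (Nat.card F : k) = 0) {N : Submodule F V} [FiniteDimensional F N]
    (hN : Nd Q N) (hN0 : N ≠ ⊥) {q : ℕ} {f : List Y → k} (hf : IsC (fx Γ (perp Q N)) (q + 1) f)
    (h : ∀ u ∈ N, u ≠ 0 → CobC (fx Γ (perp Q N ⊔ span F {u})) q f) : CobC (fx Γ (perp Q N)) q f := by
  classical
  let _ : MulAction Γ (List Y → k) := fnAct
  have hsm : ∀ (g : Γ) (b : List Y → k) (l), (g • b) l = b (g⁻¹ • l) := fun _ _ _ => rfl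
  have hinv : ∀ g ∈ fx Γ (perp Q N), ∀ v, v ∈ N → g • v ∈ N := fun g hg v hv => by
    rw [← hN.perp_perp hE.perp_top]
    exact hE.good.perp_smul hg (le_perp_perp N hv)
  have hinv' : ∀ g ∈ fx Γ (perp Q N), ∀ v, (v ∈ N ∧ v ≠ 0) ↔ (g • v ∈ N ∧ g • v ≠ 0) := fun g hg v => by
    have : g • v ∈ N ↔ v ∈ N := ⟨fun h => by simpa using hinv g⁻¹ (inv_mem hg) _ h, hinv g hg v⟩
    rw [this, Ne, Ne, smul_eq_zero_iff_eq]
  obtain ⟨φ, h1, h2⟩ := equivariant_choice (fx Γ (perp Q N)) (A := V) (B := List Y → k)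
    (fun v b => if v ∈ N ∧ v ≠ 0 then (∀ l, b l ≠ 0 → l.length = q + 1) ∧ ∀ l, eps l b = f l else b = 0) (by
      intro g hg v b hb
      simp only [← hinv' g hg v]
      split_ifs at hb ⊢
      · refine ⟨fun l hl => by simpa using hb.1 _ hl, fun l => ?_⟩
        have := hb.2 (g⁻¹ • l)
        rw [eps_smul_list, hf.inv _ (inv_mem hg)] at this
        exact this
      · rw [hb]; rfl) (by
      intro v
      by_cases hv : v ∈ N ∧ v ≠ 0
      · simp only [hv, ne_eq, not_false_eq_true, and_self, if_true]
        obtain ⟨b, hb, hb2⟩ := h v hv.1 hv.2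
        refine ⟨b, ⟨hb.supp, hb2⟩, fun g hg hgv => ?_⟩
        funext l
        rw [hsm]
        exact hb.inv _ (inv_mem (mem_fx_sup_span.2 ⟨hg, by simpa using hgv⟩)) l
      · simp only [if_neg hv]
        exact ⟨0, rfl, fun g hg _ => rfl⟩)
  have hfin : Finite N := Module.finite_of_finite F
  have hfinS : ({v : V | v ∈ N ∧ v ≠ 0}).Finite := (Set.toFinite (N : Set V)).subset fun v hv => hv.1
  set S : Finset V := hfinS.toFinset with hS
  have hmem : ∀ v, v ∈ S ↔ (v ∈ N ∧ v ≠ 0) := fun v => by simp [hS]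
  have hcard : (S.card : k) = -1 := by
    have e1 : S.card + 1 = Nat.card N := by
      have : insert 0 S = (Set.toFinite (N : Set V)).toFinset := by
        ext v
        simp only [Finset.mem_insert, hmem, Set.Finite.mem_toFinset, SetLike.mem_coe]
        constructor
        · rintro (rfl | h)
          · exact zero_mem _
          · exact h.1
        · intro h; by_cases hv : v = 0
          · exact Or.inl hv
          · exact Or.inr ⟨h, hv⟩
      rw [← Finset.card_insert_of_notMem (a := (0 : V)) (s := S) (by simp [hmem]), this]
      exact (Nat.card_eq_card_finite_toFinset (Set.toFinite (N : Set V))).symm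
    have e2 : Nat.card N = Nat.card F ^ Module.finrank F N := Module.natCard_eq_pow_finrank
    have e3 : Module.finrank F N ≠ 0 := fun h => hN0 (finrank_eq_zero.1 h)
    have e4 : ((S.card + 1 : ℕ) : k) = 0 := by rw [e1, e2, Nat.cast_pow, hk, zero_pow e3]
    push_cast at e4
    exact eq_neg_of_add_eq_zero_left e4
  have h1' : ∀ v ∈ S, (∀ l, φ v l ≠ 0 → l.length = q + 1) ∧ ∀ l, eps l (φ v) = f l := fun v hv => by
    have := h1 v
    rwa [if_pos ((hmem v).1 hv)] at this
  refine ⟨fun l => - ∑ v ∈ S, φ v l, ⟨fun g hg l => ?_, fun l hl => ?_⟩, fun l => ?_⟩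
  · congr 1
    refine Finset.sum_nbij' (fun v => g⁻¹ • v) (fun v => g • v) ?_ ?_ ?_ ?_ ?_
    · intro v hv; rw [hmem] at hv ⊢; exact (hinv' _ (inv_mem hg) v).1 hv
    · intro v hv; rw [hmem] at hv ⊢; exact (hinv' _ hg v).1 hv
    · intro v _; exact smul_inv_smul _ _
    · intro v _; exact inv_smul_smul _ _
    · intro v _
      rw [h2 _ (inv_mem hg), hsm, inv_inv]
  · by_contra hne
    refine hl ?_
    rw [Finset.sum_eq_zero, neg_zero]
    intro v hv
    by_contra h
    exact hne ((h1' v hv).1 l h)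
  · rw [eps_neg]
    have : eps l (fun l' => ∑ v ∈ S, φ v l') = ∑ v ∈ S, eps l (φ v) := by
      clear_value S
      clear hmem hcard h1' hS
      induction S using Finset.induction_on with
      | empty => simp [eps_zero]
      | insert a s ha ih => simp only [Finset.sum_insert ha, eps_add, ih]
    rw [this, Finset.sum_congr rfl fun v hv => (h1' v hv).2 l, Finset.sum_const, nsmul_eq_mul, hcard]
    ring

set_option maxHeartbeats 1000000 in
lemma InfD.T (hE : InfD Q Γ E) (hfree : ∀ (g : Γ) (y : Y), g • y = y → g = 1) [Finite F] (hk : (Nat.card F : k) = 0)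
    {q : ℕ} (hS : ∀ j < q, SP F V Γ Y k j) {f : List Y → k} (hd : ∀ l, eps l f = 0) : ∀ (n : ℕ) (N Z : Submodule F V),
      FiniteDimensional F Z → FiniteDimensional F N → Nd Q N → N ≤ perp Q Z → Module.finrank F N = n →
      IsC (fx Γ Z) (q + 1) f → CobC (fx Γ (perp Q N)) q f := by
  intro n
  induction n using Nat.strong_induction_on with
  | _ n ih =>
  intro N Z hZ hfN hN hNZ hn hf
  have hZN : Z ≤ perp Q N := (le_perp_perp Z).trans (perp_anti hNZ)
  by_cases hN0 : N = ⊥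
  · subst hN0
    have htriv : ∀ h ∈ fx Γ (perp Q (⊥ : Submodule F V)), h = 1 := fun h hh =>
      hE.good.faithful _ _ fun v => by
        rw [one_smul]
        exact hh v fun z hz => by rw [(mem_bot F).1 hz, map_zero]
    rcases isEmpty_or_nonempty Y with hY | ⟨⟨y₀⟩⟩
    · refine ⟨fun _ => 0, ⟨fun _ _ _ => rfl, fun l hl => absurd rfl hl⟩, fun l => ?_⟩
      rw [eps_zero]
      rcases l with _ | ⟨y, l⟩
      · exact (hf.zero' (by simp)).symm
      · exact (hY.false y).elim
    · refine ⟨fun l => f (y₀ :: l), ⟨fun h hh l => by rw [htriv h hh, one_smul], fun l hl => by simpa using hf.supp _ hl⟩, fun l => ?_⟩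
      have := hd (y₀ :: l)
      rw [eps_cons] at this
      exact (sub_eq_zero.1 this).symm
  refine hE.avg hk hN hN0 (hf.mono (fx_anti hZN)) fun u huN hu0 => ?_
  by_cases huQ : Q u = 0
  · obtain ⟨v, hv, h1⟩ : ∃ v ∈ N, bl Q v u = 1 := by
      obtain ⟨d', h1, -, h2⟩ := hN.sep (Y := ⊥) huN (by simpa using hu0)
      exact ⟨d', h1, h2⟩
    obtain ⟨v', hv'N, hv'Q, h1⟩ : ∃ v' ∈ N, Q v' = 0 ∧ bl Q v' u = 1 := by
      refine ⟨v - Q v • u, sub_mem hv (smul_mem _ _ huN), ?_, ?_⟩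
      · rw [Q_sub, Q_smul, huQ, map_smul, h1]; simp
      · rw [map_sub, LinearMap.sub_apply, h1, map_smul, LinearMap.smul_apply, bl_self, huQ]; simp
    have hv'u : v' ∉ Z ⊔ span F {u} := by
      intro hm
      obtain ⟨z, hz, s, hs, e⟩ := mem_sup.1 hm
      obtain ⟨c, rfl⟩ := mem_span_singleton.1 hs
      rw [← e, map_add, LinearMap.add_apply, map_smul, LinearMap.smul_apply, bl_self, huQ, bl_comm, hNZ huN z hz] at h1
      simp at h1
    set A : Submodule F V := span F {u} ⊔ span F {v'} with hAdef
    have huA : u ∈ A := mem_sup_left (mem_span_singleton_self u)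
    have hvA : v' ∈ A := mem_sup_right (mem_span_singleton_self v')
    have hA : Nd Q A := by
      refine eq_bot_iff.2 ?_
      rintro v ⟨hv, hv2⟩
      obtain ⟨s, hs, t, ht, rfl⟩ := mem_sup.1 hv
      obtain ⟨a, rfl⟩ := mem_span_singleton.1 hs
      obtain ⟨b, rfl⟩ := mem_span_singleton.1 ht
      have e1 := hv2 u huA
      have e2 := hv2 v' hvA
      simp only [map_add, map_smul, LinearMap.add_apply, LinearMap.smul_apply, bl_self, huQ, hv'Q, bl_comm u v', h1] at e1 e2
      simp at e1 e2
      simp [e1, e2]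
    have hAN : A ≤ N := sup_le (span_le.2 (by simpa using huN)) (span_le.2 (by simpa using hv'N))
    have hpr : ∀ h : Γ, ∃ g : Γ, h • u = u → ∀ v, g • v = prl Q u v' h v := fun h => by
      by_cases hh : h • u = u
      · obtain ⟨g, hg⟩ := hE.prl_ex huQ hv'Q h1 h hh
        exact ⟨g, fun _ => hg⟩
      · exact ⟨1, fun h' => absurd h' hh⟩
    choose pr hpr using hpr
    have hfu : ∀ {W : Submodule F V} {h : Γ}, h ∈ fx Γ (W ⊔ span F {u}) → h • u = u := fun hh => hh u (mem_sup_single _ _)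
    obtain ⟨θ, hθ⟩ := ex_theta (Y := Y) hfree (fx Γ (Z ⊔ span F {u})) pr (by
      intro g hg h hh
      refine hE.good.faithful _ _ fun v => ?_
      have e : (g * h) • u = u := by rw [mul_smul, hfu hh, hfu hg]
      rw [hpr _ e, mul_smul, hpr _ (hfu hh), hpr _ (hfu hg), prl_mul huQ hv'Q h1 hE.good (hfu hg) (hfu hh)])
    have hprfix : ∀ (W : Submodule F V), W ≤ perp Q N → ∀ h ∈ fx Γ (W ⊔ span F {u}), pr h ∈ fx Γ (W ⊔ A) := by
      intro W hW h hh z hz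
      rw [hpr _ (hfu hh)]
      obtain ⟨w, hw, r, hr, rfl⟩ := mem_sup.1 hz
      obtain ⟨s, hs, t, ht, rfl⟩ := mem_sup.1 hr
      obtain ⟨a, rfl⟩ := mem_span_singleton.1 hs
      obtain ⟨b, rfl⟩ := mem_span_singleton.1 ht
      rw [map_add, map_add, map_smul, map_smul, prl_u huQ hv'Q h1, prl_v huQ hv'Q h1,
        prl_fix huQ hv'Q h1 (hW hw u huN) (hW hw v' hv'N) (hh w (mem_sup_left hw))]
    have hθl : ∀ h ∈ fx Γ (Z ⊔ span F {u}), ∀ l : List Y, (h • l).map θ = pr h • l.map θ := by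
      intro h hh l
      rw [smul_list_def, smul_list_def, List.map_map, List.map_map]
      exact List.map_congr_left fun y _ => hθ h hh y
    have hle : fx Γ (perp Q N ⊔ span F {u}) ≤ fx Γ (Z ⊔ span F {u}) := fx_anti (sup_le_sup_right hZN _)
    have hc1 : CobC (fx Γ (Z ⊔ span F {u})) q (fun l => f (l.map θ) - f l) := by
      refine hE.det hfree hS hv'u ?_ ?_ ?_
      · refine IsC.sub ⟨fun h hh l => ?_, fun l hl => by simpa using hf.supp _ hl⟩ (hf.mono (fx_anti le_sup_left))
        rw [hθl h hh]
        exact hf.inv _ (fx_anti le_sup_left (hprfix Z hZN h hh)) _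
      · intro l
        rw [eps_sub, hd, ← eps_map, hd, sub_zero]
      · refine cobC_prism (fun h hh y => ?_) (hf.mono (fx_anti (le_sup_left.trans le_sup_left))) hd
        rw [hθ h (fx_anti le_sup_left hh)]
        congr 1
        refine hE.good.faithful _ _ fun v => ?_
        have e : h • u = u := hh u (mem_sup_left (mem_sup_single _ _))
        rw [hpr _ e, prl_self huQ hv'Q h1 hE.good e (hh v' (mem_sup_single _ _))]
    have hlt : N ⊓ perp Q A < N := by
      refine lt_of_le_of_ne inf_le_left fun h => ?_
      have := (inf_eq_left.1 h) huN v' hvA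
      rw [bl_comm, h1] at this
      exact one_ne_zero this
    have hc2 : CobC (fx Γ (perp Q (N ⊓ perp Q A))) q f := by
      refine ih _ (hn ▸ finrank_lt_finrank_of_lt hlt) (N ⊓ perp Q A) (Z ⊔ A) inferInstance (finiteDimensional_of_le inf_le_left)
        (hN.inter hA hAN) ?_ rfl (hf.mono (fx_anti le_sup_left))
      rintro v ⟨hv, hv2⟩ z hz
      obtain ⟨w, hw, s, hs, rfl⟩ := mem_sup.1 hz
      rw [map_add, hNZ hv w hw, hv2 s hs, add_zero]
    have hc3 : CobC (fx Γ (perp Q N ⊔ span F {u})) q (fun l => f (l.map θ)) := by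
      obtain ⟨g, hg, hg2⟩ := hc2
      refine ⟨fun l => g (l.map θ), ⟨fun h hh l => ?_, fun l hl => by simpa using hg.supp _ hl⟩, fun l => ?_⟩
      · simp only [hθl h (hle hh)]
        exact hg.inv _ (fx_anti (hN.perp_inter hA hAN) (hprfix _ le_rfl h hh)) _
      · rw [← eps_map, hg2]
    have := hc3.sub (hc1.mono hle)
    simpa using this
  · set A : Submodule F V := span F {u} with hAdef
    have huA : u ∈ A := mem_span_singleton_self u
    have h2Q : bl Q u u ≠ 0 := by rw [bl_self]; exact mul_ne_zero hE.good.two huQ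
    have hA : Nd Q A := by
      refine eq_bot_iff.2 ?_
      rintro v ⟨hv, hv2⟩
      obtain ⟨a, rfl⟩ := mem_span_singleton.1 hv
      have e1 := hv2 u huA
      rw [map_smul, LinearMap.smul_apply, smul_eq_mul] at e1
      rw [(mul_eq_zero.1 e1).resolve_right h2Q]; simp
    have hAN : A ≤ N := span_le.2 (by simpa using huN)
    have hlt : N ⊓ perp Q A < N := by
      refine lt_of_le_of_ne inf_le_left fun h => ?_
      exact h2Q ((inf_eq_left.1 h) huN u huA)
    exact (ih _ (hn ▸ finrank_lt_finrank_of_lt hlt) (N ⊓ perp Q A) Z hZ (finiteDimensional_of_le inf_le_left)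
        (hN.inter hA hAN) (inf_le_left.trans hNZ) rfl hf).mono (fx_anti (hN.perp_inter hA hAN))

theorem InfD.SP (hE : InfD Q Γ E) (hfree : ∀ (g : Γ) (y : Y), g • y = y → g = 1) [Finite F] (hk : (Nat.card F : k) = 0)
    (q : ℕ) : SP F V Γ Y k q := by
  induction q using Nat.strong_induction_on with
  | _ q ih =>
  intro Z hZ f hf hd
  obtain ⟨m, hm⟩ := hE.covers Z
  have := hE.fd m
  refine hE.det' hfree ih (Z' := E m) hd ?_ _ Z hm le_rfl hf
  have hfm := hf.mono (fx_anti hm)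
  refine cob_union (S := fun n => fx Γ (E m ⊔ perp Q (E n))) ?_ ?_ m hf.supp fun n hn => ?_
  · intro a b hab
    exact fx_anti (sup_le_sup_left (perp_anti (hE.mono hab)) _)
  · intro g hg
    obtain ⟨n, hn⟩ := hE.fixes g
    refine ⟨n, fun z hz => ?_⟩
    obtain ⟨a, ha, b, hb, rfl⟩ := mem_sup.1 hz
    rw [smul_add, hg a ha, hn b hb]
  · have := hE.fd n
    refine (hE.T hfree hk ih hd _ (E n ⊓ perp Q (E m)) (E m) inferInstance (finiteDimensional_of_le inf_le_left)
      ((hE.nd n).inter (hE.nd m) (hE.mono hn)) inf_le_right rfl hfm).mono (fx_anti ?_)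
    rw [sup_comm]
    exact (hE.nd n).perp_inter (hE.nd m) (hE.mono hn)
end S5
end OV

set_option linter.unusedSectionVars false
namespace OV
open Submodule
section S6
variable {G k : Type*} [Group G] [Field k]

/-- partial products -/
def par : List G → G → List G
  | [], g => [g]
  | (h :: l), g => g :: par l (g * h)
/-- successive quotients -/
def dif : List G → List G
  | [] => []
  | [_] => []
  | (g :: g' :: l) => (g⁻¹ * g') :: dif (g' :: l)
def cs : List G → (List G → k) → k
  | [], _ => 0
  | [_], b => - b []
  | (h :: h' :: t), b => - b ((h * h') :: t) - cs (h' :: t) (fun m => b (h :: m))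

lemma par_length : ∀ (l : List G) (g : G), (par l g).length = l.length + 1
  | [], g => rfl
  | (h :: l), g => by simp [par, par_length l]
lemma dif_length : ∀ (l : List G) (g : G), (dif (g :: l)).length = l.length
  | [], g => rfl
  | (h :: l), g => by simp [dif, dif_length l]
lemma dif_par : ∀ (l : List G) (g : G), dif (par l g) = l
  | [], g => rfl
  | [h], g => by simp [par, dif]
  | (h :: h' :: l), g => by
    have := dif_par (h' :: l) (g * h)
    simp only [par, dif] at this ⊢
    rw [this]; simp
lemma par_dif : ∀ (l : List G) (g : G), par (dif (g :: l)) g = g :: l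
  | [], g => rfl
  | (h :: l), g => by
    have := par_dif l h
    simp [dif, par, this]
lemma dif_smul (x : G) : ∀ l : List G, dif (x • l) = dif l
  | [] => rfl
  | [_] => rfl
  | (g :: g' :: l) => by
    have := dif_smul x (g' :: l)
    simp only [smul_list_cons, dif, smul_eq_mul] at this ⊢
    rw [this]; simp [mul_assoc]
lemma smul_par (x : G) : ∀ (l : List G) (g : G), x • par l g = par l (x * g)
  | [], g => rfl
  | (h :: l), g => by
    simp only [par, smul_list_cons, smul_eq_mul, smul_par x l, mul_assoc]

lemma eps_par_aux : ∀ (t : List G) (h g : G) (f : List G → k),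
    eps (par t (g * h)) (fun m => f (g :: m)) = - cs (h :: t) (fun m => f (par m g))
  | [], h, g, f => by simp [par, cs, eps_cons]
  | (h' :: t), h, g, f => by
    have ih := eps_par_aux t h' (g * h) (fun m => f (g :: m))
    simp only [par, cs, eps_cons] at ih ⊢
    rw [ih, mul_assoc]
    ring
lemma eps_par (t : List G) (h g : G) (f : List G → k) :
    eps (par (h :: t) g) f = f (par t (g * h)) + cs (h :: t) (fun m => f (par m g)) := by
  rw [par, eps_cons, eps_par_aux]; ring

lemma contract_succ {n : ℕ} (j : Fin (n + 1)) (v : Fin (n + 2) → G) :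
    Fin.contractNth j.succ (· * ·) v = Fin.cons (v 0) (Fin.contractNth j (· * ·) (Fin.tail v)) := by
  funext i
  refine Fin.cases ?_ (fun i => ?_) i
  · simp [Fin.contractNth]
  · simp only [Fin.contractNth, Fin.cons_succ, Fin.val_succ, Fin.tail, Nat.add_lt_add_iff_right, Nat.add_right_cancel_iff]
    rfl
lemma contract_zero {n : ℕ} (v : Fin (n + 2) → G) :
    Fin.contractNth 0 (· * ·) v = Fin.cons (v 0 * v 1) (Fin.tail (Fin.tail v)) := by
  funext i
  refine Fin.cases ?_ (fun i => ?_) i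
  · simp [Fin.contractNth]
  · simp [Fin.contractNth, Fin.tail]

lemma cs_ofFn : ∀ (n : ℕ) (v : Fin (n + 1) → G) (b : List G → k),
    cs (List.ofFn v) b = ∑ j : Fin (n + 1), ((-1 : ℤ) ^ ((j : ℕ) + 1)) • b (List.ofFn (Fin.contractNth j (· * ·) v))
  | 0, v, b => by simp [cs]
  | (n + 1), v, b => by
    have ih := cs_ofFn n (Fin.tail v) (fun m => b (v 0 :: m))
    rw [Fin.sum_univ_succ, contract_zero]
    have e : List.ofFn v = v 0 :: v 1 :: List.ofFn (Fin.tail (Fin.tail v)) := by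
      rw [List.ofFn_succ, List.ofFn_succ]; rfl
    have e2 : List.ofFn (Fin.tail v) = v 1 :: List.ofFn (Fin.tail (Fin.tail v)) := by
      rw [List.ofFn_succ]; rfl
    rw [e, cs, ← e2, ih]
    simp only [contract_succ, List.ofFn_cons]
    rw [sub_eq_add_neg, ← Finset.sum_neg_distrib]
    congr 1
    · simp
    · refine Finset.sum_congr rfl fun j _ => ?_
      rw [Fin.val_succ, pow_succ _ ((j : ℕ) + 1), mul_neg_one, neg_smul]
end S6

open GroupHomologyBar in
theorem bar_vanish {G : Type} [Group G] (ℓ : ℕ) [Fact ℓ.Prime] (q : ℕ)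
    (H : ∀ f : List G → ZMod ℓ, IsC (⊤ : Subgroup G) (q + 1) f → (∀ l, eps l f = 0) → CobC (⊤ : Subgroup G) q f) :
    Subsingleton (Homology G (ZMod ℓ) (q + 1)) := by
  classical
  rw [Submodule.Quotient.subsingleton_iff, eq_top_iff]
  rintro ⟨z, hz⟩ -
  show z ∈ LinearMap.range (d G (ZMod ℓ) (q + 1))
  by_contra hn
  let R : Submodule (ZMod ℓ) (chains G (ZMod ℓ) (q + 1)) :=
    AddSubgroup.toZModSubmodule ℓ (LinearMap.range (d G (ZMod ℓ) (q + 1))).toAddSubgroup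
  have hR : ∀ x, x ∈ R ↔ x ∈ LinearMap.range (d G (ZMod ℓ) (q + 1)) := fun x => Iff.rfl
  obtain ⟨φ, hφz, hφ⟩ := Submodule.exists_le_ker_of_notMem (p := R) (v := z) (by rwa [hR])
  have hcl : ∀ v : Fin (q + 2) → G, φ (d G (ZMod ℓ) (q + 1) (Finsupp.single v 1)) = 0 := fun v =>
    hφ ((hR _).2 ⟨_, rfl⟩)
  let FL : List G → ZMod ℓ := fun l => if h : l.length = q + 1 then φ (Finsupp.single (fun i => l.get (i.cast h.symm)) 1) else 0
  have hFL : ∀ v : Fin (q + 1) → G, FL (List.ofFn v) = φ (Finsupp.single v 1) := by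
    intro v
    have h : (List.ofFn v).length = q + 1 := List.length_ofFn
    simp only [FL, h, dif_pos]
    congr 2
    funext i
    rw [List.get_ofFn]; rfl
  have hFLs : ∀ l, FL l ≠ 0 → l.length = q + 1 := by
    intro l hl
    by_contra h
    exact hl (dif_neg h)
  have hFL2 : ∀ v : Fin (q + 2) → G, FL (List.ofFn (Fin.tail v)) + cs (List.ofFn v) FL = 0 := by
    intro v
    have := hcl v
    rw [d_single, map_add, map_sum] at this
    rw [cs_ofFn, hFL, ← this]
    congr 1
    refine Finset.sum_congr rfl fun j _ => ?_
    rw [map_zsmul, hFL]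
  let f : List G → ZMod ℓ := fun l => if l = [] then 0 else FL (dif l)
  have hfp : ∀ m g, f (par m g) = FL m := by
    intro m g
    have : par m g ≠ [] := fun h => by simpa [h] using par_length m g
    simp only [f, if_neg this, dif_par]
  have hfC : IsC (⊤ : Subgroup G) (q + 1) f := by
    refine ⟨fun x _ l => ?_, fun l hl => ?_⟩
    · rcases l with _ | ⟨g, l⟩
      · rfl
      · have : x • (g :: l) ≠ [] := by simp
        simp only [f, if_neg this, dif_smul]
        simp
    · rcases l with _ | ⟨g, l⟩
      · simp [f] at hl
      · have : FL (dif (g :: l)) ≠ 0 := by simpa [f] using hl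
        have := hFLs _ this
        rw [dif_length] at this
        simp [this]
  have hfd : ∀ l, eps l f = 0 := by
    intro l
    by_cases hl : l.length = q + 3
    · rcases l with _ | ⟨g, l⟩
      · simp at hl
      · rw [← par_dif l g]
        have hlen := dif_length l g
        generalize dif (g :: l) = m at *
        have hm : m.length = q + 2 := by simp at hl; omega
        obtain ⟨v, rfl⟩ : ∃ v : Fin (q + 2) → G, m = List.ofFn v := by
          refine ⟨fun i => m.get (i.cast hm.symm), ?_⟩
          refine List.ext_getElem (by rw [List.length_ofFn, hm]) fun i h1 h2 => ?_
          rw [List.getElem_ofFn]; rfl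
        rw [List.ofFn_succ, eps_par, hfp]
        simp only [hfp]
        have := hFL2 v
        rw [List.ofFn_succ (f := v)] at this
        exact this
    · refine eps_zero' l fun l' _ h => hfC.zero' ?_
      omega
  obtain ⟨g, hg, hg2⟩ := H f hfC hfd
  let b : (Fin q → G) → ZMod ℓ := fun v => g (par (List.ofFn v) 1)
  have hb : ∀ v : Fin (q + 1) → G, φ (Finsupp.single v 1) =
      b (Fin.tail v) + ∑ j : Fin (q + 1), ((-1 : ℤ) ^ ((j : ℕ) + 1)) • b (Fin.contractNth j (· * ·) v) := by
    intro v
    rw [← hFL, ← hfp _ 1, ← hg2, ← cs_ofFn q v (fun m => g (par m 1)), List.ofFn_succ, eps_par]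
    congr 1
    have := hg.inv (1 * v 0) trivial (par (List.ofFn (Fin.tail v)) 1)
    rw [smul_par, mul_one] at this
    exact this
  let Ψ : chains G (ZMod ℓ) q →ₗ[ZMod ℓ] ZMod ℓ := Finsupp.linearCombination (ZMod ℓ) b
  have hΨ : ∀ v a, Ψ (Finsupp.single v a) = a * b v := fun v a => by simp [Ψ]
  have key : ∀ c, φ c = Ψ (d G (ZMod ℓ) q c) := by
    intro c
    induction c using Finsupp.induction_linear with
    | zero => simp
    | add x y hx hy => rw [map_add, hx, hy, map_add, map_add]
    | single v a =>
      have : Finsupp.single v a = a • Finsupp.single v (1 : ZMod ℓ) := by simp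
      rw [d_single, this, map_smul, hb, map_add, map_sum, hΨ, smul_eq_mul, mul_add, Finset.mul_sum]
      congr 1
      refine Finset.sum_congr rfl fun j _ => ?_
      rw [map_zsmul, hΨ, mul_smul_comm]
  apply hφz
  rw [key z, LinearMap.mem_ker.1 hz, map_zero]
end OV

set_option linter.unusedSectionVars false
namespace OV
open Submodule
section S7
variable {F V Γ Y k : Type*} [Field F] [AddCommGroup V] [Module F V] [Group Γ] [DistribMulAction Γ V]
  [SMulCommClass Γ F V] [MulAction Γ Y] [Field k] {Q : QuadraticForm F V} {E : ℕ → Submodule F V}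

/-- restricted action -/
@[reducible] def resAct (hG : GoodA Q Γ) {W : Submodule F V} (hW : perp Q (perp Q W) = W) :
    DistribMulAction ↥(fx Γ (perp Q W)) ↥W where
  smul g w := ⟨g.1 • w.1, by
    have := hG.perp_smul g.2 (v := w.1) (by rw [hW]; exact w.2)
    rwa [hW] at this⟩
  one_smul w := Subtype.ext (one_smul Γ w.1)
  mul_smul g h w := Subtype.ext (mul_smul g.1 h.1 w.1)
  smul_zero g := Subtype.ext (smul_zero g.1)
  smul_add g w w' := Subtype.ext (smul_add g.1 w.1 w'.1)

lemma perp_decomp {Z : Submodule F V} {x : V × V} (hx : HP Q Z x) :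
    perp Q Z ≤ perp Q (Z ⊔ span F (prs x)) ⊔ span F (prs x) := by
  intro v hv
  obtain ⟨h1, h2, h3, h4, h5⟩ := hx
  have e : v = (v - bl Q v x.2 • x.1 - bl Q v x.1 • x.2) + (bl Q v x.2 • x.1 + bl Q v x.1 • x.2) := by abel
  rw [e]
  refine add_mem (mem_sup_left ?_) (mem_sup_right (add_mem (smul_mem _ _ (subset_span ?_)) (smul_mem _ _ (subset_span ?_))))
  · rw [mem_perp_sup_span]
    refine ⟨sub_mem (sub_mem hv (smul_mem _ _ h4)) (smul_mem _ _ h5), ?_⟩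
    intro s hs
    rcases hs with rfl | rfl
    · simp [bl_self, h1, bl_comm x.2 x.1, h3]
    · simp [bl_self, h2, h3]
  · simp [prs]
  · simp [prs]

lemma InfD.stepN (hE : InfD Q Γ E) (hfree : ∀ (g : Γ) (y : Y), g • y = y → g = 1) [Finite F] (h2k : (2 : k) ≠ 0)
    {x : ℕ → V × V} (hx : ∀ n, HP Q (E n) (x n)) (hEs : ∀ n, E (n + 1) = E n ⊔ span F (prs (x n))) {q n : ℕ} (hq : q + 2 ≤ n)
    {f : List Y → k} (hf : IsC (fx Γ (perp Q (E n))) (q + 1) f) (hd : ∀ l, eps l f = 0) :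
    ∃ f' : List Y → k, IsC (fx Γ (perp Q (E (n + 1)))) (q + 1) f' ∧ (∀ l, eps l f' = 0) ∧
      CobC (fx Γ (perp Q (E n))) q (fun l => f l - f' l) := by
  have hfd := hE.fd (n + 1)
  have hG := hE.good
  have hnd := hE.nd (n + 1)
  have hpp := hnd.perp_perp hE.perp_top
  set W := E (n + 1) with hW
  let _ : DistribMulAction ↥(fx Γ (perp Q W)) ↥W := resAct hG hpp
  have hact : ∀ (g : fx Γ (perp Q W)) (w : W), ((g • w : W) : V) = g.1 • (w : V) := fun _ _ => rfl
  have hsc : SMulCommClass ↥(fx Γ (perp Q W)) F ↥W := ⟨fun g c w => Subtype.ext (by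
    rw [hact, coe_smul, coe_smul, hact, smul_comm])⟩
  let Q' : QuadraticForm F W := Q.comp W.subtype
  have hQ' : ∀ w : W, Q' w = Q (w : V) := fun _ => rfl
  have hbl : ∀ a b : W, bl Q' a b = bl Q (a : V) (b : V) := fun a b => rfl
  have hV' : perp Q' ⊤ = ⊥ := by
    refine eq_bot_iff.2 fun v hv => ?_
    rw [mem_bot]
    refine Subtype.ext (hnd.eq_zero v.2 fun w hw => ?_)
    exact hv ⟨w, hw⟩ trivial
  have hG' : GoodA Q' ↥(fx Γ (perp Q W)) := by
    refine ⟨fun g v => hG.isom g.1 v.1, fun a ha => ?_, fun g h hgh => ?_, hG.two⟩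
    · have ha' : Q (a : V) ≠ 0 := ha
      obtain ⟨g, hg⟩ := hG.refl (a : V) ha'
      refine ⟨⟨g, fun w hw => ?_⟩, fun v => Subtype.ext ?_⟩
      · rw [hg, refl_fix]
        rw [bl_comm]; exact hw a a.2
      · rw [hact, refl_apply]
        show g • (v : V) = _
        rw [hg, refl_apply]
        rfl
    · refine Subtype.ext (hG.faithful _ _ fun v => ?_)
      obtain ⟨z, hz, h1⟩ := hnd.proj v
      have e : v = z + (v - z) := by abel
      have e2 := congrArg Subtype.val (hgh ⟨z, hz⟩)
      rw [hact, hact] at e2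
      rw [e, smul_add, smul_add, e2, g.2 _ h1, h.2 _ h1]
  have hxm : ∀ i, i ≤ n → (x i).1 ∈ W ∧ (x i).2 ∈ W := by
    intro i hi
    have h1 : E (i + 1) ≤ W := hE.mono (by omega)
    have h2 : span F (prs (x i)) ≤ E (i + 1) := by rw [hEs]; exact le_sup_right
    exact ⟨h1 (h2 (subset_span (by simp [prs]))), h1 (h2 (subset_span (by simp [prs])))⟩
  let X : ∀ i, i ≤ n → W × W := fun i hi => (⟨(x i).1, (hxm i hi).1⟩, ⟨(x i).2, (hxm i hi).2⟩)
  have hX : ∀ i hi, HP Q' ((E i).comap W.subtype) (X i hi) := by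
    intro i hi
    obtain ⟨h1, h2, h3, h4, h5⟩ := hx i
    exact ⟨h1, h2, h3, fun z hz => h4 z.1 hz, fun z hz => h5 z.1 hz⟩
  have hHyp : ∀ j i, i + j = n + 1 → Hyp Q' ((E i).comap W.subtype) j := by
    intro j
    induction j with
    | zero => intro i _; trivial
    | succ j ih =>
      intro i hi
      have hi0 : i ≤ n := by omega
      refine ⟨X i hi0, hX i hi0, (ih (i + 1) (by omega)).mono (sup_le (comap_mono (hE.mono (by omega))) (span_le.2 ?_))⟩
      have h2 : span F (prs (x i)) ≤ E (i + 1) := by rw [hEs]; exact le_sup_right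
      rintro s (rfl | rfl)
      · exact h2 (subset_span (by simp [prs, X]))
      · exact h2 (subset_span (by simp [prs, X]))
  have hhyp : Hyp Q' (⊥ : Submodule F W) (q + 1 + 2) := ((hHyp (n + 1) 0 (by omega)).mono bot_le).le (by omega)
  have hfree' : ∀ (g : fx Γ (perp Q W)) (y : Y), g • y = y → g = 1 := fun g y h => Subtype.ext (hfree g.1 y h)
  have hsl : ∀ (g : fx Γ (perp Q W)) (l : List Y), g • l = g.1 • l := fun _ _ => rfl
  have hmem1 : ∀ h : fx Γ (perp Q W), h ∈ fx ↥(fx Γ (perp Q W)) (span F (prs (X n le_rfl))) → h.1 ∈ fx Γ (perp Q (E n)) := by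
    intro h hh v hv
    have h1 := perp_decomp (hx n) hv
    rw [← hEs, ← hW] at h1
    have h2 : h.1 ∈ fx Γ (perp Q W ⊔ span F (prs (x n))) := by
      rw [mem_fx_sup_span]
      refine ⟨h.2, ?_⟩
      rintro s (rfl | rfl)
      · exact congrArg Subtype.val (hh (X n le_rfl).1 (subset_span (by simp [prs])))
      · exact congrArg Subtype.val (hh (X n le_rfl).2 (subset_span (by simp [prs])))
    exact h2 v h1
  obtain ⟨f', u, h1, h2, h3, h4, -, h6⟩ := stab_step (q := q + 1) hV' hG' h2k hfree' hhyp (HP.mono bot_le (hX n le_rfl))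
    (f := f) ⟨fun h hh l => hf.inv h.1 (hmem1 h hh) l, hf.supp⟩ hd
  refine ⟨f', ⟨fun h hh l => h1.inv ⟨h, hh⟩ trivial l, h1.supp⟩, h2, u, ⟨fun h hh l => ?_, h4⟩, fun l => (h6 l).symm⟩
  have hh' : h ∈ fx Γ (perp Q W) := fx_anti (perp_anti (hE.mono (Nat.le_succ n))) hh
  refine h3 ⟨h, hh'⟩ ?_ l
  have : span F (prs (X n le_rfl)) ≤ LinearMap.eqLocus (DistribSMul.toLinearMap F W (⟨h, hh'⟩ : fx Γ (perp Q W))) LinearMap.id := by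
    refine span_le.2 ?_
    rintro s (rfl | rfl)
    · exact Subtype.ext (hh _ (hx n).2.2.2.1)
    · exact Subtype.ext (hh _ (hx n).2.2.2.2)
  exact fun z hz => this hz

lemma InfD.stepNN (hE : InfD Q Γ E) (hfree : ∀ (g : Γ) (y : Y), g • y = y → g = 1) [Finite F] (h2k : (2 : k) ≠ 0)
    {x : ℕ → V × V} (hx : ∀ n, HP Q (E n) (x n)) (hEs : ∀ n, E (n + 1) = E n ⊔ span F (prs (x n))) {q n : ℕ} (hq : q + 2 ≤ n)
    {f : List Y → k} (hf : IsC (fx Γ (perp Q (E n))) (q + 1) f) (hd : ∀ l, eps l f = 0) (m : ℕ) (hm : n ≤ m) :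
    ∃ f' : List Y → k, IsC (fx Γ (perp Q (E m))) (q + 1) f' ∧ (∀ l, eps l f' = 0) ∧
      CobC (fx Γ (perp Q (E n))) q (fun l => f l - f' l) := by
  induction m, hm using Nat.le_induction with
  | base =>
    refine ⟨f, hf, hd, fun _ => 0, ⟨fun _ _ _ => rfl, fun l hl => absurd rfl hl⟩, fun l => ?_⟩
    show _ = f l - f l
    rw [eps_zero, sub_self]
  | succ m hm ih =>
    obtain ⟨f', h1, h2, h3⟩ := ih
    obtain ⟨f'', h1', h2', h3'⟩ := hE.stepN hfree h2k hx hEs (hq.trans hm) h1 h2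
    refine ⟨f'', h1', h2', ?_⟩
    have := h3.add (h3'.mono (fx_anti (perp_anti (hE.mono hm))))
    simpa using this

theorem InfD.final (hE : InfD Q Γ E) (hfree : ∀ (g : Γ) (y : Y), g • y = y → g = 1) [Finite F] (h2k : (2 : k) ≠ 0)
    (hk : (Nat.card F : k) = 0)
    {x : ℕ → V × V} (hx : ∀ n, HP Q (E n) (x n)) (hEs : ∀ n, E (n + 1) = E n ⊔ span F (prs (x n))) {q n : ℕ} (hq : q + 2 ≤ n)
    {f : List Y → k} (hf : IsC (fx Γ (perp Q (E n))) (q + 1) f) (hd : ∀ l, eps l f = 0) :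
    CobC (fx Γ (perp Q (E n))) q f := by
  have hmono : Monotone fun m => fx Γ (perp Q (E m)) := fun a b h => fx_anti (perp_anti (hE.mono h))
  refine cob_of_ev hf.supp fun c hc => ?_
  -- c lies in the range of bd plus the augmentation submodule
  have hc1 : c ∈ (LinearMap.range (bd (Y := Y) (k := k)) ⊔ aug Y k (⊤ : Subgroup Γ)) ⊔
      span k {s | ∃ l : List Y, l.length ≠ q + 2 ∧ s = Finsupp.single l (1 : k)} := by
    by_contra hne
    obtain ⟨ψ, hψ, hker⟩ := Submodule.exists_le_ker_of_notMem hne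
    have k1 : ∀ c, ψ (bd c) = 0 := fun c => hker (mem_sup_left (mem_sup_left ⟨c, rfl⟩))
    have k2 : ∀ c ∈ aug Y k (⊤ : Subgroup Γ), ψ c = 0 := fun c hc => hker (mem_sup_left (mem_sup_right hc))
    have k3 : ∀ l : List Y, l.length ≠ q + 2 → ψ (Finsupp.single l 1) = 0 :=
      fun l hl => hker (mem_sup_right (subset_span ⟨l, hl, rfl⟩))
    have k4 : ev (fun l => ψ (Finsupp.single l 1)) = ψ := by
      refine Finsupp.lhom_ext' fun l => LinearMap.ext_ring ?_
      simp only [LinearMap.comp_apply, Finsupp.lsingle_apply]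
      rw [ev_single]
    have k5 := hE.SP hfree hk q ⊥ inferInstance (fun l => ψ (Finsupp.single l 1))
      ⟨fun g _ l => aug_inv k2 g trivial l, fun l hl => by_contra fun h => hl (k3 l h)⟩
      (fun l => by rw [← map_eps, k1])
    have k6 := k5.ev_zero (c := c) (aug_mono (by rw [fx_bot]; exact le_top) hc)
    rw [k4] at k6
    exact hψ k6
  obtain ⟨_, h1, s, hs, rfl⟩ := mem_sup.1 hc1
  obtain ⟨_, ⟨e, rfl⟩, a, ha, rfl⟩ := mem_sup.1 h1
  obtain ⟨m, hm, ham⟩ := aug_union hmono (fun g _ => hE.fixes g) n ha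
  obtain ⟨f', h1, h2, h3⟩ := hE.stepNN hfree h2k hx hEs hq hf hd m hm
  have e0 : ev f' s = 0 := by
    have : span k {s | ∃ l : List Y, l.length ≠ q + 2 ∧ s = Finsupp.single l (1 : k)} ≤ LinearMap.ker (ev f') := by
      refine span_le.2 ?_
      rintro _ ⟨l, hl, rfl⟩
      show ev f' _ = 0
      rw [ev_single]
      exact h1.zero' hl
    exact this hs
  have e1 : ev f' (bd e + a + s) = 0 := by
    rw [map_add, map_add, ev_aug h1.inv ham, ev_bd, e0, add_zero, add_zero]
    simp only [h2]
    simp [ev, Finsupp.linearCombination_apply]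
  have e2 := h3.ev_zero hc
  have e3 : ∀ c, ev (fun l => f l - f' l) c = ev f c - ev f' c := by
    intro c
    simp [ev, Finsupp.linearCombination_apply, mul_sub, Finsupp.sum_sub]
  rw [e3, e1, sub_zero] at e2
  exact e2
end S7
end OV

set_option linter.unusedSectionVars false
namespace OV
open Submodule
section S8a
variable {F V : Type*} [Field F] [AddCommGroup V] [Module F V] {Q : QuadraticForm F V} {E : ℕ → Submodule F V}

/-- finitely supported isometries -/
def grp (Q : QuadraticForm F V) (E : ℕ → Submodule F V) (hE : Monotone E) : Subgroup (V ≃ₗ[F] V) where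
  carrier := {g | (∀ v, Q (g v) = Q v) ∧ ∃ n, ∀ w ∈ perp Q (E n), g w = w}
  one_mem' := ⟨fun _ => rfl, 0, fun _ _ => rfl⟩
  mul_mem' := by
    rintro a b ⟨ha, n, hn⟩ ⟨hb, m, hm⟩
    refine ⟨fun v => ?_, max n m, fun w hw => ?_⟩
    · show Q (a (b v)) = Q v
      rw [ha, hb]
    · show a (b w) = w
      rw [hm w (perp_anti (hE (le_max_right n m)) hw), hn w (perp_anti (hE (le_max_left n m)) hw)]
  inv_mem' := by
    rintro a ⟨ha, n, hn⟩
    refine ⟨fun v => ?_, n, fun w hw => ?_⟩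
    · show Q (a.symm v) = Q v
      rw [← ha (a.symm v), a.apply_symm_apply]
    · show a.symm w = w
      rw [LinearEquiv.symm_apply_eq, hn w hw]

lemma grp_InfD (h2 : (2 : F) ≠ 0) (hE : Monotone E) (hfd : ∀ n, FiniteDimensional F (E n)) (hnd : ∀ n, Nd Q (E n))
    (hc : ∀ v, ∃ n, v ∈ E n) (hyp : ∀ n, ∃ x, HP Q (E n) x) : InfD Q ↥(grp Q E hE) E where
  good := {
    isom := fun g v => g.2.1 v
    refl := fun a ha => by
      obtain ⟨n, hn⟩ := hc a
      refine ⟨⟨refl Q a ha, refl_isom a ha, n, fun w hw => refl_fix a ha w ?_⟩, fun v => rfl⟩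
      rw [bl_comm]; exact hw a hn
    faithful := fun g h hgh => Subtype.ext (LinearEquiv.ext hgh)
    two := h2 }
  fd := hfd
  nd := hnd
  mono := hE
  cover := hc
  fixes g := g.2.2
  full φ n h1 h2 := ⟨⟨φ, h1, n, h2⟩, fun _ => rfl⟩
  hyp := hyp
end S8a

section S8b
variable (F : Type*) [Field F]
/-- model space -/
abbrev MV := ℕ →₀ (F × F)
/-- half of the pairing -/
noncomputable def mB : MV F →ₗ[F] MV F →ₗ[F] F :=
  Finsupp.lsum F fun i => (LinearMap.mul F F).compl₁₂ (LinearMap.fst F F F) ((LinearMap.snd F F F) ∘ₗ Finsupp.lapply i)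
lemma mB_single (i : ℕ) (a : F × F) (w : MV F) : mB F (Finsupp.single i a) w = a.1 * (w i).2 := by
  simp [mB]
lemma mB_single' (v : MV F) (i : ℕ) (a : F × F) : mB F v (Finsupp.single i a) = (v i).1 * a.2 := by
  induction v using Finsupp.induction_linear with
  | zero => simp
  | add f g hf hg => rw [map_add, LinearMap.add_apply, hf, hg]; simp [add_mul]
  | single j b =>
    rw [mB_single]
    by_cases h : i = j
    · subst h; simp
    · simp [h, Ne.symm h]
/-- model form -/
noncomputable def mQ : QuadraticForm F (MV F) := LinearMap.BilinMap.toQuadraticMap (mB F)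
lemma mQ_apply (v : MV F) : mQ F v = mB F v v := rfl
lemma bl_mQ (v w : MV F) : bl (mQ F) v w = mB F v w + mB F w v := by
  have := Q_add (Q := mQ F) v w
  simp only [mQ_apply, map_add, LinearMap.add_apply] at this
  linear_combination -this
lemma bl_single (v : MV F) (i : ℕ) (a : F × F) :
    bl (mQ F) v (Finsupp.single i a) = (v i).1 * a.2 + a.1 * (v i).2 := by
  rw [bl_mQ, mB_single, mB_single']
def mE (n : ℕ) : Submodule F (MV F) where
  carrier := {v | ∀ i, n ≤ i → v i = 0}
  add_mem' ha hb i hi := by rw [Finsupp.add_apply, ha i hi, hb i hi, add_zero]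
  zero_mem' _ _ := rfl
  smul_mem' c v hv i hi := by rw [Finsupp.smul_apply, hv i hi, smul_zero]
lemma single_mem_mE {n i : ℕ} (h : i < n) (a : F × F) : Finsupp.single i a ∈ mE F n := by
  intro j hj
  rw [Finsupp.single_apply, if_neg (by omega)]
lemma bl_zero {v w : MV F} (h : ∀ i, v i = 0 ∨ w i = 0) : bl (mQ F) v w = 0 := by
  rw [← Finsupp.sum_single w, Finsupp.sum, map_sum]
  refine Finset.sum_eq_zero fun i hi => ?_
  rw [bl_single]
  rcases h i with h | h <;> simp [h]
lemma mem_perp_mE {n : ℕ} {v : MV F} : v ∈ perp (mQ F) (mE F n) ↔ ∀ i, i < n → v i = 0 := by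
  constructor
  · intro h i hi
    have h1 := h _ (single_mem_mE F hi (1, 0))
    have h2 := h _ (single_mem_mE F hi (0, 1))
    rw [bl_single] at h1 h2
    refine Prod.ext ?_ ?_
    · simpa using h2
    · simpa using h1
  · intro h w hw
    refine bl_zero F fun i => ?_
    by_cases hi : i < n
    · exact Or.inl (h i hi)
    · exact Or.inr (hw i (by omega))
lemma mE_mono : Monotone (mE F) := fun _ _ h _ hv i hi => hv i (h.trans hi)
/-- model pairs -/
noncomputable def mx (n : ℕ) : MV F × MV F := (Finsupp.single n (1, 0), Finsupp.single n (0, 1))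
lemma mx_HP (n : ℕ) : HP (mQ F) (mE F n) (mx F n) := by
  refine ⟨?_, ?_, ?_, ?_, ?_⟩
  · simp [mx, mQ_apply, mB_single]
  · simp [mx, mQ_apply, mB_single]
  · simp [mx, bl_single]
  · rw [mem_perp_mE]
    intro i hi
    simp only [mx]
    rw [Finsupp.single_apply, if_neg (by omega)]
  · rw [mem_perp_mE]
    intro i hi
    simp only [mx]
    rw [Finsupp.single_apply, if_neg (by omega)]
lemma mE_succ (n : ℕ) : mE F (n + 1) = mE F n ⊔ span F (prs (mx F n)) := by
  apply le_antisymm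
  · intro v hv
    have e : v = (v - ((v n).1 • (mx F n).1 + (v n).2 • (mx F n).2)) + ((v n).1 • (mx F n).1 + (v n).2 • (mx F n).2) := by abel
    rw [e]
    refine add_mem (mem_sup_left ?_) (mem_sup_right (add_mem (smul_mem _ _ (subset_span (by simp [prs])))
      (smul_mem _ _ (subset_span (by simp [prs])))))
    intro i hi
    by_cases h : i = n
    · subst h
      simp [mx]
    · rw [Finsupp.sub_apply, hv i (by omega)]
      simp [mx, Ne.symm h]
  · refine sup_le (mE_mono F (Nat.le_succ n)) (span_le.2 ?_)
    rintro _ (rfl | rfl)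
    · exact single_mem_mE F (Nat.lt_succ_self n) _
    · exact single_mem_mE F (Nat.lt_succ_self n) _
lemma mE_zero : mE F 0 = ⊥ := by
  refine eq_bot_iff.2 fun v hv => ?_
  rw [mem_bot]
  exact Finsupp.ext fun i => hv i (Nat.zero_le i)
lemma mE_fd (n : ℕ) : FiniteDimensional F (mE F n) := by
  induction n with
  | zero => rw [mE_zero]; infer_instance
  | succ n ih =>
    rw [mE_succ]
    have : FiniteDimensional F (span F (prs (mx F n))) := FiniteDimensional.span_of_finite F (by simp [prs])
    infer_instance
lemma mE_nd (n : ℕ) : Nd (mQ F) (mE F n) := by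
  refine eq_bot_iff.2 ?_
  rintro v ⟨h1, h2⟩
  rw [SetLike.mem_coe, mem_perp_mE] at h2
  rw [mem_bot]
  refine Finsupp.ext fun i => ?_
  by_cases hi : i < n
  · exact h2 i hi
  · exact h1 i (by omega)
lemma mE_cover (v : MV F) : ∃ n, v ∈ mE F n := by
  refine ⟨v.support.sup id + 1, fun i hi => ?_⟩
  by_contra h
  have : i ≤ v.support.sup id := Finset.le_sup (f := id) (Finsupp.mem_support_iff.2 h)
  omega
/-- the infinite orthogonal group -/
noncomputable abbrev mG : Subgroup (MV F ≃ₗ[F] MV F) := grp (mQ F) (mE F) (mE_mono F)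
lemma mG_InfD (h2 : (2 : F) ≠ 0) : InfD (mQ F) ↥(mG F) (mE F) :=
  grp_InfD h2 (mE_mono F) (mE_fd F) (mE_nd F) (mE_cover F) fun n => ⟨_, mx_HP F n⟩

/-- inclusion of the finite model -/
noncomputable def emb (n : ℕ) : (Fin n → F × F) →ₗ[F] MV F :=
  LinearMap.lsum F (fun _ : Fin n => F × F) F fun i => Finsupp.lsingle (i : ℕ)
/-- restriction to the finite model -/
noncomputable def res (n : ℕ) : MV F →ₗ[F] (Fin n → F × F) := LinearMap.pi fun i => Finsupp.lapply (i : ℕ)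
lemma emb_apply (n : ℕ) (w : Fin n → F × F) : emb F n w = ∑ i : Fin n, Finsupp.single (i : ℕ) (w i) := by
  simp [emb]
lemma emb_val (n : ℕ) (w : Fin n → F × F) (i : Fin n) : emb F n w i = w i := by
  rw [emb_apply, Finsupp.finsetSum_apply, Finset.sum_eq_single i]
  · simp
  · intro j _ hj
    rw [Finsupp.single_apply, if_neg (fun h => hj (Fin.ext h))]
  · simp
lemma emb_mem (n : ℕ) (w : Fin n → F × F) : emb F n w ∈ mE F n := by
  rw [emb_apply]
  exact sum_mem fun i _ => single_mem_mE F i.2 _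
lemma res_apply (n : ℕ) (v : MV F) (i : Fin n) : res F n v i = v i := rfl
lemma res_emb (n : ℕ) (w : Fin n → F × F) : res F n (emb F n w) = w := funext fun i => by rw [res_apply, emb_val]
lemma sub_emb_mem (n : ℕ) (v : MV F) : v - emb F n (res F n v) ∈ perp (mQ F) (mE F n) := by
  rw [mem_perp_mE]
  intro i hi
  rw [Finsupp.sub_apply, sub_eq_zero]
  exact (emb_val F n (res F n v) ⟨i, hi⟩).symm
lemma emb_res {n : ℕ} {v : MV F} (hv : v ∈ mE F n) : emb F n (res F n v) = v := by
  have := (mE_nd F n).eq_zero (sub_mem hv (emb_mem F n (res F n v))) (sub_emb_mem F n v)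
  exact (sub_eq_zero.1 this).symm
lemma res_perp {n : ℕ} {v : MV F} (hv : v ∈ perp (mQ F) (mE F n)) : res F n v = 0 :=
  funext fun i => (mem_perp_mE F).1 hv i i.2
end S8b
section S8c
variable (F : Type) [Field F]
lemma mQ_emb (n : ℕ) (w : Fin n → F × F) : mQ F (emb F n w) = sumForm F (hypPlaneQuad F) n w := by
  have h : ∀ u, mB F (emb F n w) u = ∑ i : Fin n, mB F (Finsupp.single (i : ℕ) (w i)) u := fun u => by
    rw [emb_apply, map_sum, LinearMap.sum_apply]
  rw [mQ_apply, h]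
  refine Finset.sum_congr rfl fun i _ => ?_
  rw [mB_single, emb_val, hypPlaneQuad]

/-- extension of linear maps -/
noncomputable def jl (n : ℕ) (g : (Fin n → F × F) →ₗ[F] (Fin n → F × F)) : MV F →ₗ[F] MV F :=
  LinearMap.id - (emb F n).comp (res F n) + (emb F n).comp (g.comp (res F n))
lemma jl_apply (n : ℕ) (g : (Fin n → F × F) →ₗ[F] (Fin n → F × F)) (v : MV F) :
    jl F n g v = (v - emb F n (res F n v)) + emb F n (g (res F n v)) := rfl
lemma jl_jl (n : ℕ) (g h : (Fin n → F × F) →ₗ[F] (Fin n → F × F)) (v : MV F) :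
    jl F n g (jl F n h v) = jl F n (g.comp h) v := by
  have : res F n (jl F n h v) = h (res F n v) := by
    rw [jl_apply, map_add, res_emb, map_sub, res_emb, sub_self, zero_add]
  rw [jl_apply, this, jl_apply, jl_apply, LinearMap.comp_apply]
  abel
lemma jl_id (n : ℕ) (v : MV F) : jl F n LinearMap.id v = v := by
  rw [jl_apply, LinearMap.id_apply]; abel
lemma jl_Q (n : ℕ) (g : (Fin n → F × F) →ₗ[F] (Fin n → F × F))
    (hg : ∀ w, sumForm F (hypPlaneQuad F) n (g w) = sumForm F (hypPlaneQuad F) n w) (v : MV F) : mQ F (jl F n g v) = mQ F v := by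
  have e : v = (v - emb F n (res F n v)) + emb F n (res F n v) := by abel
  have h1 := sub_emb_mem F n v
  conv_rhs => rw [e]
  rw [jl_apply, Q_add, Q_add, h1 _ (emb_mem F n _), h1 _ (emb_mem F n _), mQ_emb, mQ_emb, hg]
/-- finite orthogonal groups -/
abbrev fG (n : ℕ) := quadIsoms F (sumForm F (hypPlaneQuad F) n)
/-- extension of equivalences -/
noncomputable def jE (n : ℕ) (g : (Fin n → F × F) ≃ₗ[F] (Fin n → F × F)) : MV F ≃ₗ[F] MV F :=
  LinearEquiv.ofLinearMap (jl F n g.toLinearMap) (jl F n g.symm.toLinearMap)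
    (LinearMap.ext fun v => by rw [LinearMap.comp_apply, jl_jl, LinearEquiv.comp_symm, jl_id, LinearMap.id_apply])
    (LinearMap.ext fun v => by rw [LinearMap.comp_apply, jl_jl, LinearEquiv.symm_comp, jl_id, LinearMap.id_apply])
lemma jE_apply (n : ℕ) (g : (Fin n → F × F) ≃ₗ[F] (Fin n → F × F)) (v : MV F) :
    jE F n g v = jl F n g.toLinearMap v := rfl
lemma jE_mem (n : ℕ) (g : fG F n) : jE F n g.1 ∈ mG F := by
  refine ⟨fun v => ?_, n, fun w hw => ?_⟩
  · rw [jE_apply]; exact jl_Q F n _ g.2 v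
  · rw [jE_apply, jl_apply, res_perp F hw, map_zero, map_zero, map_zero, sub_zero, add_zero]
lemma jE_one (n : ℕ) : jE F n 1 = 1 := LinearEquiv.ext fun v => jl_id F n v
lemma jE_mul (n : ℕ) (g h : (Fin n → F × F) ≃ₗ[F] (Fin n → F × F)) : jE F n (g * h) = jE F n g * jE F n h :=
  LinearEquiv.ext fun v => (jl_jl F n g.toLinearMap h.toLinearMap v).symm
/-- inclusion of groups -/
noncomputable def jG (n : ℕ) : fG F n →* mG F where
  toFun g := ⟨jE F n g.1, jE_mem F n g⟩
  map_one' := Subtype.ext (jE_one F n)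
  map_mul' g h := Subtype.ext (jE_mul F n g.1 h.1)
lemma jG_apply (n : ℕ) (g : fG F n) (v : MV F) :
    (jG F n g) • v = (v - emb F n (res F n v)) + emb F n (g.1 (res F n v)) := rfl
lemma jG_mem (n : ℕ) (g : fG F n) : jG F n g ∈ fx ↥(mG F) (perp (mQ F) (mE F n)) := by
  intro w hw
  rw [jG_apply, res_perp F hw, map_zero, map_zero, map_zero, sub_zero, add_zero]
lemma jG_inj (n : ℕ) : Function.Injective (jG F n) := by
  intro g h e
  refine Subtype.ext (LinearEquiv.ext fun w => ?_)
  have h1 := congrArg (fun t : mG F => res F n (t • emb F n w)) e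
  simp only [jG_apply, res_emb, sub_self, zero_add] at h1
  exact h1
lemma jG_surj (h2 : (2 : F) ≠ 0) (n : ℕ) (h : mG F) (hh : h ∈ fx ↥(mG F) (perp (mQ F) (mE F n))) : ∃ g, jG F n g = h := by
  have hE := mG_InfD F h2
  have hfd := mE_fd F n
  have hpp := (mE_nd F n).perp_perp hE.perp_top
  have key : ∀ h : mG F, h ∈ fx ↥(mG F) (perp (mQ F) (mE F n)) → ∀ w, emb F n (res F n (h • emb F n w)) = h • emb F n w := by
    intro h hh w
    refine emb_res F ?_
    have := hE.good.perp_smul hh (v := emb F n w) (by rw [hpp]; exact emb_mem F n w)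
    rwa [hpp] at this
  let g : (Fin n → F × F) ≃ₗ[F] (Fin n → F × F) := LinearEquiv.ofLinearMap
    ((res F n).comp ((h.1 : MV F →ₗ[F] MV F).comp (emb F n))) ((res F n).comp (((h⁻¹).1 : MV F →ₗ[F] MV F).comp (emb F n)))
    (LinearMap.ext fun w => by
      show res F n (h • emb F n (res F n (h⁻¹ • emb F n w))) = w
      rw [key _ (inv_mem hh), smul_inv_smul, res_emb])
    (LinearMap.ext fun w => by
      show res F n (h⁻¹ • emb F n (res F n (h • emb F n w))) = w
      rw [key _ hh, inv_smul_smul, res_emb])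
  have hg : ∀ w, emb F n (g w) = h • emb F n w := fun w => key h hh w
  refine ⟨⟨g, fun w => ?_⟩, hE.good.faithful _ _ fun v => ?_⟩
  · rw [← mQ_emb, ← mQ_emb, hg, hE.good.isom]
  · rw [jG_apply]
    show _ + emb F n (g _) = _
    rw [hg]
    have e : v = (v - emb F n (res F n v)) + emb F n (res F n v) := by abel
    conv_rhs => rw [e, smul_add, hh _ (sub_emb_mem F n v)]
end S8c
end OV

set_option linter.unusedSectionVars false
namespace OV
open Submodule
lemma transfer {k G Γ : Type*} [Group G] [Group Γ] [Field k] (j : G →* Γ) (hj : Function.Injective j) (S : Subgroup Γ)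
    (hS : ∀ h, h ∈ S ↔ ∃ g, j g = h) (q : ℕ)
    (H : ∀ f : List Γ → k, IsC S (q + 1) f → (∀ l, eps l f = 0) → CobC S q f)
    (f : List G → k) (hf : IsC (⊤ : Subgroup G) (q + 1) f) (hd : ∀ l, eps l f = 0) : CobC (⊤ : Subgroup G) q f := by
  obtain ⟨ρ, hρ, hρ1⟩ : ∃ ρ : Γ → G, (∀ g y, ρ (j g * y) = g * ρ y) ∧ ∀ g, ρ (j g) = g := by
    let _ : MulAction G Γ := MulAction.compHom Γ j
    have ha : ∀ (g : G) (y : Γ), g • y = j g * y := fun _ _ => rfl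
    obtain ⟨ρ, -, h⟩ := equivariant_choice (A := Γ) (B := G) (⊤ : Subgroup G) (fun _ _ => True) (fun _ _ _ _ _ => trivial)
      (fun a => ⟨1, trivial, fun g _ hg => by
        rw [ha, mul_eq_right, ← map_one j] at hg
        rw [hj hg, one_smul]⟩)
    have h' : ∀ g y, ρ (j g * y) = g * ρ y := fun g y => h g trivial y
    refine ⟨fun y => ρ y * (ρ 1)⁻¹, fun g y => ?_, fun g => ?_⟩
    · simp only [h', mul_assoc]
    · have := h' g 1
      rw [mul_one] at this
      simp [this]
  have e1 : ∀ (g : G) (l : List Γ), (j g • l).map ρ = g • l.map ρ := by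
    intro g l
    simp only [smul_list_def, List.map_map]
    exact List.map_congr_left fun y _ => hρ g y
  have e2 : ∀ (g : G) (l : List G), (g • l).map j = j g • l.map j := by
    intro g l
    simp only [smul_list_def, List.map_map]
    exact List.map_congr_left fun y _ => map_mul j g y
  have e3 : ∀ l : List G, (l.map j).map ρ = l := by
    intro l
    rw [List.map_map]
    conv_rhs => rw [← List.map_id l]
    exact List.map_congr_left fun y _ => hρ1 y
  obtain ⟨u, hu, hu2⟩ := H (fun l => f (l.map ρ)) ⟨fun h hh l => by
      obtain ⟨g, rfl⟩ := (hS h).1 hh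
      rw [e1, hf.inv g trivial], fun l hl => by simpa using hf.supp _ hl⟩ (fun l => by rw [← eps_map]; exact hd _)
  refine ⟨fun l => u (l.map j), ⟨fun g _ l => ?_, fun l hl => by simpa using hu.supp _ hl⟩, fun l => ?_⟩
  · show u _ = u _
    rw [e2, hu.inv _ ((hS _).2 ⟨g, rfl⟩)]
  · rw [← eps_map, hu2]
    show f _ = f l
    rw [e3]

theorem main_vanish (ℓ r : ℕ) (hℓ : ℓ.Prime) (hodd : Odd ℓ) (hr : 1 ≤ r)
    (F : Type) [Field F] [Fintype F] (hcard : Fintype.card F = ℓ ^ r)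
    (n d : ℕ) (hd0 : 0 < d) (hdn : d < n) :
    Subsingleton (GroupHomologyBar.Homology (↥(quadIsoms F (sumForm F (hypPlaneQuad F) n))) (ZMod ℓ) d) := by
  have : Fact ℓ.Prime := ⟨hℓ⟩
  obtain ⟨q, rfl⟩ : ∃ q, d = q + 1 := ⟨d - 1, by omega⟩
  have hℓ2 : ℓ ≠ 2 := by rintro rfl; exact absurd hodd (by decide)
  have h2k : (2 : ZMod ℓ) ≠ 0 := by
    intro h
    have h' : ((2 : ℕ) : ZMod ℓ) = 0 := by exact_mod_cast h
    rw [ZMod.natCast_eq_zero_iff] at h'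
    exact hℓ2 ((Nat.prime_dvd_prime_iff_eq hℓ Nat.prime_two).1 h')
  have hk : (Nat.card F : ZMod ℓ) = 0 := by
    rw [Nat.card_eq_fintype_card, hcard, Nat.cast_pow, ZMod.natCast_self, zero_pow (by omega)]
  have h2 : (2 : F) ≠ 0 := by
    intro h
    have h0 : ((ℓ : ℕ) : F) = 0 := by
      have h3 : ((Fintype.card F : ℕ) : F) = 0 := FiniteField.cast_card_eq_zero F
      rw [hcard, Nat.cast_pow] at h3
      exact pow_eq_zero_iff (by omega) |>.1 h3
    obtain ⟨m, rfl⟩ := hodd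
    push_cast at h0
    rw [h, zero_mul, zero_add] at h0
    exact one_ne_zero h0
  refine bar_vanish ℓ q fun f hf hd => ?_
  refine transfer (jG F n) (jG_inj F n) (fx ↥(mG F) (perp (mQ F) (mE F n)))
    (fun h => ⟨fun hh => jG_surj F h2 n h hh, ?_⟩) q (fun f hf hd => ?_) f hf hd
  · rintro ⟨g, rfl⟩
    exact jG_mem F n g
  · exact (mG_InfD F h2).final (fun g y h => mul_eq_right.1 h) h2k hk (mx_HP F) (mE_succ F) (by omega) hf hd
end OV

open GroupHomologyBar in
/-- Vanishing of the homology of the hyperbolic orthogonal groups over the finite field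
`𝔽_{ℓ^r}` with `ℓ` an odd prime, at the characteristic:
`H_d(O_{n,n}(𝔽_{ℓ^r}); 𝔽_ℓ) = 0` for `0 < d < n`.  Here `O_{n,n}(F)` is realized as the
group of linear automorphisms of `F^{2n} = (F²)ⁿ` preserving the hyperbolic quadratic
form `q_H^n(v) = ∑ᵢ vᵢ v_{n+i}`, where the `i`-th copy of `F²` carries the pair of
coordinates `(vᵢ, v_{n+i})`. -/
theorem O_hyperbolic_homology_vanishing (ℓ r : ℕ) (hℓ : ℓ.Prime) (hodd : Odd ℓ) (hr : 1 ≤ r)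
    (F : Type) [Field F] [Fintype F] (hcard : Fintype.card F = ℓ ^ r)
    (n d : ℕ) (hd0 : 0 < d) (hdn : d < n) :
    Subsingleton (Homology (↥(quadIsoms F (sumForm F (hypPlaneQuad F) n))) (ZMod ℓ) d) := by
  exact OV.main_vanish ℓ r hℓ hodd hr F hcard n d hd0 hdn
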